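/- Let w=(w₁,w₂) be a pair of real numbers with w₁ ≥ w₂ > 0 and w₁+w₂ = 1. Then the Hausdorff dimension (with respect to the Euclidean metric) of the set Sing(w) of w-singular vectors in ℝ² equals 2 − 1/(1+w₁). -/

import Mathlib

open MeasureTheory

/-- The set of `(w₁,w₂)`-weighted singular vectors in `ℝ²`. -/
def Sing (w₁ w₂ : ℝ) : Set (EuclideanSpace ℝ (Fin 2)) :=
  {x | ∀ ε : ℝ, 0 < ε → ∃ T₀ : ℝ, 1 < T₀ ∧ ∀ T : ℝ, T₀ < T →
    ∃ p₁ p₂ q : ℤ,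
      |(q : ℝ) * x 0 - (p₁ : ℝ)| < ε ^ w₁ * T ^ (-w₁) ∧
      |(q : ℝ) * x 1 - (p₂ : ℝ)| < ε ^ w₂ * T ^ (-w₂) ∧
      0 < q ∧ (q : ℝ) < T}

/-- The cross product on triples. -/
def cr {R : Type*} [CommRing R] (v w : R × R × R) : R × R × R :=
  (v.2.1 * w.2.2 - v.2.2 * w.2.1, v.2.2 * w.1 - v.1 * w.2.2, v.1 * w.2.1 - v.2.1 * w.1)

lemma cr_sub_right {R : Type*} [CommRing R] (v w w' : R × R × R) :
    cr v (w - w') = cr v w - cr v w' := by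
  ext <;> simp [cr] <;> ring

lemma cr_cr_cr {R : Type*} [CommRing R] (v a b : R × R × R) :
    cr v (cr (cr v a) (cr v b)) = 0 := by
  ext <;> simp [cr] <;> ring

lemma triple_norm_le {v : ℝ × ℝ × ℝ} {r : ℝ} :
    ‖v‖ ≤ r ↔ |v.1| ≤ r ∧ |v.2.1| ≤ r ∧ |v.2.2| ≤ r := by
  simp [Prod.norm_def]

lemma triple_norm_lt {v : ℝ × ℝ × ℝ} {r : ℝ} :
    ‖v‖ < r ↔ |v.1| < r ∧ |v.2.1| < r ∧ |v.2.2| < r := by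
  simp [Prod.norm_def]

lemma abs_mul_sub_mul_le {a b c d x y : ℝ} (ha : |a| ≤ x) (hb : |b| ≤ x) (hc : |c| ≤ y)
    (hd : |d| ≤ y) : |a * d - b * c| ≤ 2 * x * y := by
  have h1 : |a * d| ≤ x * y := by
    rw [abs_mul]; exact mul_le_mul ha hd (abs_nonneg _) ((abs_nonneg _).trans ha)
  have h2 : |b * c| ≤ x * y := by
    rw [abs_mul]; exact mul_le_mul hb hc (abs_nonneg _) ((abs_nonneg _).trans ha)
  have := abs_sub (a * d) (b * c)
  linarith

lemma norm_cr_le (v w : ℝ × ℝ × ℝ) : ‖cr v w‖ ≤ 2 * ‖v‖ * ‖w‖ := by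
  obtain ⟨a, b, c⟩ := triple_norm_le.1 (le_refl ‖v‖)
  obtain ⟨d, e, f⟩ := triple_norm_le.1 (le_refl ‖w‖)
  exact triple_norm_le.2 ⟨abs_mul_sub_mul_le b c e f, abs_mul_sub_mul_le c a f d,
    abs_mul_sub_mul_le a b d e⟩

/-- One-dimensional packing bound. -/
lemma card_le_of_separated {ι : Type*} (s : Finset ι) (f : ι → ℝ) {ρ δ : ℝ} (hδ : 0 < δ)
    (hρ : 0 ≤ ρ) (hf : ∀ x ∈ s, |f x| ≤ ρ)
    (hs : ∀ x ∈ s, ∀ y ∈ s, x ≠ y → δ ≤ |f x - f y|) : (s.card : ℝ) ≤ 1 + 2 * ρ / δ := by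
  have key : s.card ≤ (Finset.range (⌊2 * ρ / δ⌋₊ + 1)).card := by
    refine Finset.card_le_card_of_injOn (fun x => ⌊(f x + ρ) / δ⌋₊) ?_ ?_
    · intro x hx
      have := abs_le.1 (hf x hx)
      simp only [Finset.coe_range, Set.mem_Iio, Nat.lt_succ_iff]
      apply Nat.floor_le_floor
      gcongr
      linarith
    · intro x hx y hy hxy
      by_contra hne
      have h1 := hs x hx y hy hne
      have hx0 : 0 ≤ (f x + ρ) / δ := div_nonneg (by linarith [(abs_le.1 (hf x hx)).1]) hδ.le
      have hy0 : 0 ≤ (f y + ρ) / δ := div_nonneg (by linarith [(abs_le.1 (hf y hy)).1]) hδ.le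
      simp only at hxy
      have a1 := Nat.floor_le hx0
      have a2 := Nat.lt_floor_add_one ((f x + ρ) / δ)
      have a3 := Nat.floor_le hy0
      have a4 := Nat.lt_floor_add_one ((f y + ρ) / δ)
      rw [hxy] at a1 a2
      have : |(f x + ρ) / δ - (f y + ρ) / δ| < 1 := by
        rw [abs_lt]; constructor <;> linarith
      rw [← sub_div, abs_div, abs_of_pos hδ, div_lt_one hδ] at this
      have e : f x + ρ - (f y + ρ) = f x - f y := by ring
      rw [e] at this
      linarith
  rw [Finset.card_range] at key
  have h2 := Nat.floor_le (show 0 ≤ 2 * ρ / δ by positivity)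
  have : (s.card : ℝ) ≤ (⌊2 * ρ / δ⌋₊ : ℝ) + 1 := by exact_mod_cast key
  linarith

/-- A coordinate which computes the norm on the line spanned by `a`. -/
lemma exists_coordinate (a : ℝ × ℝ × ℝ) (ha : a ≠ 0) :
    ∃ f : ℝ × ℝ × ℝ →ₗ[ℝ] ℝ, (∀ b, |f b| ≤ ‖b‖) ∧ f a ≠ 0 ∧ ∀ b, cr a b = 0 →
      ‖b‖ = |f b| ∧ f a • b = f b • a := by
  have hn := norm_pos_iff.2 ha
  have key : ∀ b, cr a b = 0 → a.2.1 * b.2.2 = a.2.2 * b.2.1 ∧ a.2.2 * b.1 = a.1 * b.2.2 ∧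
      a.1 * b.2.1 = a.2.1 * b.1 := by
    intro b hb
    simp only [cr, Prod.ext_iff, Prod.fst_zero, Prod.snd_zero, sub_eq_zero] at hb
    exact hb
  have aux : ∀ x y u v : ℝ, |u| ≤ |x| → 0 < |x| → x * v = u * y → |v| ≤ |y| := by
    intro x y u v h1 h2 h3
    have : |x| * |v| = |u| * |y| := by rw [← abs_mul, ← abs_mul, h3]
    have h4 : |u| * |y| ≤ |x| * |y| := by gcongr
    nlinarith
  obtain ⟨l1, l2, l3⟩ := triple_norm_le.1 (le_refl ‖a‖)
  have hcase : ‖a‖ = |a.1| ∨ ‖a‖ = |a.2.1| ∨ ‖a‖ = |a.2.2| := by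
    simp only [Prod.norm_def, Real.norm_eq_abs]
    rcases max_choice |a.1| (max |a.2.1| |a.2.2|) with h | h
    · exact Or.inl h
    · rcases max_choice |a.2.1| |a.2.2| with h' | h' <;> rw [h, h'] <;> simp
  rcases hcase with h | h | h
  · refine ⟨LinearMap.fst ℝ ℝ (ℝ × ℝ), fun b => (triple_norm_le.1 le_rfl).1, ?_, ?_⟩
    · intro h0; simp only [LinearMap.fst_apply] at h0; rw [h0] at h; simp at h; exact ha h
    intro b hb
    obtain ⟨e1, e2, e3⟩ := key b hb
    rw [h] at l1 l2 l3 hn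
    refine ⟨le_antisymm (triple_norm_le.2 ⟨le_rfl, aux _ _ _ _ l2 hn e3,
      aux _ _ _ _ l3 hn e2.symm⟩) (triple_norm_le.1 le_rfl).1, ?_⟩
    ext <;> simp <;> linarith
  · refine ⟨(LinearMap.fst ℝ ℝ ℝ).comp (LinearMap.snd ℝ ℝ (ℝ × ℝ)),
      fun b => (triple_norm_le.1 le_rfl).2.1, ?_, ?_⟩
    · intro h0; simp at h0; rw [h0] at h; simp at h; exact ha h
    intro b hb
    obtain ⟨e1, e2, e3⟩ := key b hb
    rw [h] at l1 l2 l3 hn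
    refine ⟨le_antisymm (triple_norm_le.2 ⟨aux _ _ _ _ l1 hn e3.symm, le_rfl,
      aux _ _ _ _ l3 hn e1⟩) (triple_norm_le.1 le_rfl).2.1, ?_⟩
    ext <;> simp <;> linarith
  · refine ⟨(LinearMap.snd ℝ ℝ ℝ).comp (LinearMap.snd ℝ ℝ (ℝ × ℝ)),
      fun b => (triple_norm_le.1 le_rfl).2.2, ?_, ?_⟩
    · intro h0; simp at h0; rw [h0] at h; simp at h; exact ha h
    intro b hb
    obtain ⟨e1, e2, e3⟩ := key b hb
    rw [h] at l1 l2 l3 hn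
    refine ⟨le_antisymm (triple_norm_le.2 ⟨aux _ _ _ _ l1 hn e2,
      aux _ _ _ _ l2 hn e1.symm, le_rfl⟩) (triple_norm_le.1 le_rfl).2.2, ?_⟩
    ext <;> simp <;> linarith

lemma card_le_of_collinear (a : ℝ × ℝ × ℝ) (ha : a ≠ 0) (s : Finset (ℝ × ℝ × ℝ)) {ρ δ : ℝ}
    (hδ : 0 < δ) (hρ : 0 ≤ ρ) (hs : ∀ x ∈ s, ‖x‖ ≤ ρ)
    (h : ∀ x ∈ s, ∀ y ∈ s, x ≠ y → cr a (x - y) = 0 ∧ δ ≤ ‖x - y‖) :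
    (s.card : ℝ) ≤ 1 + 2 * ρ / δ := by
  obtain ⟨f, hf, -, hf'⟩ := exists_coordinate a ha
  refine card_le_of_separated s f hδ hρ (fun x hx => (hf x).trans (hs x hx)) ?_
  intro x hx y hy hxy
  obtain ⟨h1, h2⟩ := h x hx y hy hxy
  rwa [← map_sub, ← (hf' _ h1).1]

lemma card_le_card_image_mul {ι κ : Type*} [DecidableEq κ] (s : Finset ι) (f : ι → κ) {c : ℝ}
    (h : ∀ k ∈ s.image f, ((s.filter (fun x => f x = k)).card : ℝ) ≤ c) :
    (s.card : ℝ) ≤ (s.image f).card * c := by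
  rw [Finset.card_eq_sum_card_image f s]
  push_cast
  calc _ ≤ ∑ _k ∈ s.image f, c := Finset.sum_le_sum h
    _ = _ := by rw [Finset.sum_const, nsmul_eq_mul]

/-- Counting points of a lattice in a ball in terms of the first minima of the lattice and of its
dual. -/
lemma card_lattice_le (Λ M : AddSubgroup (ℝ × ℝ × ℝ))
    (hΛ : ∀ v ∈ Λ, ∀ w ∈ Λ, cr v w ∈ M) (hM : ∀ v ∈ M, ∀ w ∈ M, cr v w ∈ Λ)
    (v₀ : ℝ × ℝ × ℝ) (hv₀ : v₀ ∈ Λ) (hv₀0 : v₀ ≠ 0) (hmin : ∀ v ∈ Λ, v ≠ 0 → ‖v₀‖ ≤ ‖v‖)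
    {μ : ℝ} (hμ : 0 < μ) (hμM : ∀ d ∈ M, d ≠ 0 → μ ≤ ‖d‖) {ρ : ℝ} (hρ : 1 ≤ ρ)
    (hv₀1 : ‖v₀‖ ≤ 1) (s : Finset (ℝ × ℝ × ℝ)) (hs : ∀ x ∈ s, x ∈ Λ ∧ ‖x‖ ≤ ρ) :
    (s.card : ℝ) ≤ 3 * ρ / ‖v₀‖ + 192 * ρ ^ 3 + 24 * ρ ^ 2 / μ := by
  classical
  have hl := norm_pos_iff.2 hv₀0
  set l := ‖v₀‖ with hldef
  have hρ0 : 0 < ρ := by linarith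
  set I := s.image (cr v₀) with hI
  have h1 : (s.card : ℝ) ≤ I.card * (3 * ρ / l) := by
    apply card_le_card_image_mul
    intro k _
    have : ((s.filter (fun x => cr v₀ x = k)).card : ℝ) ≤ 1 + 2 * ρ / l := by
      refine card_le_of_collinear v₀ hv₀0 _ hl hρ0.le
        (fun x hx => (hs x (Finset.mem_filter.1 hx).1).2) ?_
      intro x hx y hy hxy
      rw [Finset.mem_filter] at hx hy
      refine ⟨by rw [cr_sub_right, hx.2, hy.2, sub_self], hmin _ ?_ (sub_ne_zero.2 hxy)⟩
      exact Λ.sub_mem (hs x hx.1).1 (hs y hy.1).1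
    refine this.trans ?_
    have : 1 ≤ ρ / l := by rw [le_div_iff₀ hl]; linarith
    have e1 : 2 * ρ / l = 2 * (ρ / l) := by ring
    have e2 : 3 * ρ / l = 3 * (ρ / l) := by ring
    rw [e1, e2]; linarith
  have hI' : ∀ x ∈ I, (∃ a ∈ Λ, x = cr v₀ a) ∧ x ∈ M ∧ ‖x‖ ≤ 2 * l * ρ := by
    intro x hx
    obtain ⟨a, ha, rfl⟩ := Finset.mem_image.1 hx
    refine ⟨⟨a, (hs a ha).1, rfl⟩, hΛ _ hv₀ _ (hs a ha).1, (norm_cr_le _ _).trans ?_⟩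
    have := (hs a ha).2
    gcongr
  by_cases hc : I.card ≤ 1
  · have : (I.card : ℝ) ≤ 1 := by exact_mod_cast hc
    have h3 : (I.card : ℝ) * (3 * ρ / l) ≤ 1 * (3 * ρ / l) := by gcongr
    have : 0 ≤ 192 * ρ ^ 3 + 24 * ρ ^ 2 / μ := by positivity
    linarith
  push Not at hc
  have hne : I.offDiag.Nonempty := by
    obtain ⟨a, ha, b, hb, hab⟩ := Finset.one_lt_card.1 hc
    exact ⟨(a, b), by simp [ha, hb, hab]⟩
  obtain ⟨⟨x, y⟩, hxy, hxymin⟩ := Finset.exists_min_image I.offDiag (fun p => ‖p.1 - p.2‖) hne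
  simp only [Finset.mem_offDiag] at hxy hxymin
  obtain ⟨hx, hy, hxyne⟩ := hxy
  set d := x - y with hd
  have hd0 : d ≠ 0 := sub_ne_zero.2 hxyne
  have hdM : d ∈ M := M.sub_mem (hI' x hx).2.1 (hI' y hy).2.1
  have hμd : μ ≤ ‖d‖ := hμM d hdM hd0
  have hdpos : 0 < ‖d‖ := norm_pos_iff.2 hd0
  have hdle : ‖d‖ ≤ 4 * l * ρ := by
    have := norm_sub_le x y
    linarith [(hI' x hx).2.2, (hI' y hy).2.2]
  obtain ⟨a₀, ha₀, hda₀⟩ : ∃ a ∈ Λ, d = cr v₀ a := by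
    obtain ⟨a, ha, rfl⟩ := (hI' x hx).1
    obtain ⟨b, hb, rfl⟩ := (hI' y hy).1
    exact ⟨a - b, Λ.sub_mem ha hb, by rw [hd, cr_sub_right]⟩
  set J := I.image (cr d) with hJ
  have h2 : (I.card : ℝ) ≤ J.card * (8 * l * ρ / ‖d‖) := by
    apply card_le_card_image_mul
    intro k _
    have : ((I.filter (fun x => cr d x = k)).card : ℝ) ≤ 1 + 2 * (2 * l * ρ) / ‖d‖ := by
      refine card_le_of_collinear d hd0 _ hdpos (by positivity)
        (fun x hx => (hI' x (Finset.mem_filter.1 hx).1).2.2) ?_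
      intro x hx y hy hxy
      rw [Finset.mem_filter] at hx hy
      exact ⟨by rw [cr_sub_right, hx.2, hy.2, sub_self], hxymin (x, y) ⟨hx.1, hy.1, hxy⟩⟩
    refine this.trans ?_
    have : 1 ≤ 4 * l * ρ / ‖d‖ := by rw [le_div_iff₀ hdpos]; linarith
    have e1 : 2 * (2 * l * ρ) / ‖d‖ = 4 * l * ρ / ‖d‖ := by ring
    have e2 : 8 * l * ρ / ‖d‖ = 2 * (4 * l * ρ / ‖d‖) := by ring
    rw [e1, e2]; linarith
  have h3 : (J.card : ℝ) ≤ 1 + 2 * (4 * ‖d‖ * l * ρ) / l := by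
    refine card_le_of_collinear v₀ hv₀0 _ hl (by positivity) ?_ ?_
    · intro z hz
      obtain ⟨a, ha, rfl⟩ := Finset.mem_image.1 hz
      refine (norm_cr_le _ _).trans ?_
      have := (hI' a ha).2.2
      calc _ ≤ 2 * ‖d‖ * (2 * l * ρ) := by gcongr
        _ = _ := by ring
    · intro z hz z' hz' hzz
      obtain ⟨a, ha, rfl⟩ := Finset.mem_image.1 hz
      obtain ⟨a', ha', rfl⟩ := Finset.mem_image.1 hz'
      obtain ⟨⟨b, hb, e⟩, hbM, -⟩ := hI' a ha
      obtain ⟨⟨b', hb', e'⟩, hbM', -⟩ := hI' a' ha'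
      refine ⟨?_, hmin _ (Λ.sub_mem (hM _ hdM _ hbM) (hM _ hdM _ hbM')) (sub_ne_zero.2 hzz)⟩
      rw [cr_sub_right, e, e', hda₀, cr_cr_cr, cr_cr_cr, sub_zero]
  have e3 : 1 + 2 * (4 * ‖d‖ * l * ρ) / l = 1 + 8 * ‖d‖ * ρ := by field_simp; ring
  rw [e3] at h3
  calc (s.card : ℝ) ≤ I.card * (3 * ρ / l) := h1
    _ ≤ (J.card * (8 * l * ρ / ‖d‖)) * (3 * ρ / l) := by gcongr
    _ ≤ ((1 + 8 * ‖d‖ * ρ) * (8 * l * ρ / ‖d‖)) * (3 * ρ / l) := by gcongr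
    _ = 24 * ρ ^ 2 / ‖d‖ + 192 * ρ ^ 3 := by field_simp; ring
    _ ≤ 24 * ρ ^ 2 / μ + 192 * ρ ^ 3 := by gcongr
    _ ≤ _ := by
      have : 0 ≤ 3 * ρ / l := by positivity
      linarith

lemma sum_inv_succ_le (n : ℕ) :
    ∑ i ∈ Finset.range n, (1 : ℝ) / (1 + i) ≤ 1 + Real.log n := by
  have h := harmonic_le_one_add_log n
  rw [harmonic] at h
  push_cast at h
  refine le_trans (le_of_eq ?_) h
  refine Finset.sum_congr rfl fun i _ => ?_
  rw [one_div, add_comm]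

lemma sum_inv_abs_le {n m : ℕ} (hm : m ≤ n) :
    ∑ i ∈ Finset.range n, (1 : ℝ) / (1 + |(m : ℝ) - i|) ≤ 2 * (1 + Real.log n) := by
  have hsub : ∀ k, k ≤ n → ∑ i ∈ Finset.range k, (1 : ℝ) / (1 + i) ≤ 1 + Real.log n :=
    fun k hk => (Finset.sum_le_sum_of_subset_of_nonneg (Finset.range_mono hk)
      (fun _ _ _ => by positivity)).trans (sum_inv_succ_le n)
  obtain ⟨k, rfl⟩ := Nat.exists_eq_add_of_le hm
  rw [Finset.sum_range_add, two_mul]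
  apply add_le_add
  · rw [← Finset.sum_range_reflect]
    refine le_trans (Finset.sum_le_sum fun i hi => ?_) (hsub m (by omega))
    have hi' := Finset.mem_range.1 hi
    have e : ((m - 1 - i : ℕ) : ℝ) = m - 1 - i := by
      rw [Nat.cast_sub (by omega), Nat.cast_sub (by omega)]; simp
    gcongr
    rw [e]
    refine le_trans ?_ (le_abs_self _)
    linarith
  · refine le_trans (Finset.sum_le_sum fun i hi => ?_) (hsub k (by omega))
    gcongr
    push_cast
    rw [abs_sub_comm]
    refine le_trans ?_ (le_abs_self _)
    linarith

lemma sum_inv_max_le (n : ℕ) (z : ℝ) :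
    ∑ i ∈ Finset.range n, 1 / max 1 |z - i| ≤ 6 * (1 + Real.log n) := by
  set m : ℕ := min n ⌊z⌋.toNat with hm
  have h := sum_inv_abs_le (min_le_left n ⌊z⌋.toNat)
  calc _ ≤ ∑ i ∈ Finset.range n, 3 * ((1 : ℝ) / (1 + |(m : ℝ) - i|)) := by
        refine Finset.sum_le_sum fun i hi => ?_
        have hi' := Finset.mem_range.1 hi
        have h1 : |(m : ℤ) - i| ≤ |⌊z⌋ - i| := by
          rcases abs_cases ((m : ℤ) - i) with h | h <;> rcases abs_cases (⌊z⌋ - i) with h' | h' <;>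
            omega
        have h2 : |(m : ℝ) - i| ≤ |(⌊z⌋ : ℝ) - i| := by exact_mod_cast h1
        have h3 : |(⌊z⌋ : ℝ) - i| ≤ |z - i| + 1 := by
          have := Int.floor_le z
          have := Int.lt_floor_add_one z
          rw [abs_le]
          constructor
          · linarith [neg_abs_le (z - i)]
          · linarith [le_abs_self (z - i)]
        rw [mul_one_div, div_le_div_iff₀ (by positivity) (by positivity)]
        have := le_max_left 1 |z - i|
        have := le_max_right 1 |z - i|
        linarith
    _ = 3 * ∑ i ∈ Finset.range n, ((1 : ℝ) / (1 + |(m : ℝ) - i|)) := by rw [Finset.mul_sum]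
    _ ≤ _ := by linarith

/-- Centres of the `⌈m⌉` subintervals of length `1 / m` covering `[-1/2, 1/2]`. -/
noncomputable def gridPt (m : ℝ) (i : ℕ) : ℝ := -1 / 2 + (i + 1 / 2) / m

lemma abs_gridPt_le {m : ℝ} (hm : 1 ≤ m) {i : ℕ} (hi : i < ⌈m⌉₊) : |gridPt m i| ≤ 1 := by
  have h1 : (i : ℝ) < m := Nat.lt_ceil.1 hi
  have h2 : ((i : ℝ) + 1 / 2) / m ≤ 3 / 2 := by
    rw [div_le_iff₀ (by linarith)]; linarith
  have h3 : 0 ≤ ((i : ℝ) + 1 / 2) / m := by positivity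
  rw [gridPt, abs_le]
  constructor <;> linarith

lemma exists_gridPt_near {m t : ℝ} (hm : 1 ≤ m) (ht : |t| ≤ 1 / 2) :
    ∃ i < ⌈m⌉₊, |t - gridPt m i| ≤ 1 / (2 * m) := by
  have hm0 : 0 < m := by linarith
  obtain ⟨h1, h2⟩ := abs_le.1 ht
  have key : ∀ i : ℕ, (i : ℝ) ≤ (t + 1 / 2) * m → (t + 1 / 2) * m ≤ i + 1 →
      |t - gridPt m i| ≤ 1 / (2 * m) := by
    intro i hi hi'
    have e : t - gridPt m i = ((t + 1 / 2) * m - (i + 1 / 2)) / m := by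
      rw [gridPt]; field_simp; ring
    rw [e, abs_div, abs_of_pos hm0, div_le_div_iff₀ hm0 (by positivity)]
    have : |(t + 1 / 2) * m - (i + 1 / 2)| ≤ 1 / 2 := by
      rw [abs_le]; constructor <;> linarith
    nlinarith
  have h0 : 0 ≤ (t + 1 / 2) * m := mul_nonneg (by linarith) hm0.le
  have hle : (t + 1 / 2) * m ≤ m := by nlinarith
  by_cases hlt : (t + 1 / 2) * m < m
  · refine ⟨⌊(t + 1 / 2) * m⌋₊, ?_, key _ (Nat.floor_le h0) (Nat.lt_floor_add_one _).le⟩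
    rw [Nat.lt_ceil]
    exact (Nat.floor_le h0).trans_lt hlt
  · have he : (t + 1 / 2) * m = m := le_antisymm hle (not_lt.1 hlt)
    have hpos : 0 < ⌈m⌉₊ := Nat.ceil_pos.2 hm0
    obtain ⟨k, hk⟩ : ∃ k, ⌈m⌉₊ = k + 1 := ⟨_, (Nat.succ_pred_eq_of_pos hpos).symm⟩
    refine ⟨k, by omega, key k ?_ ?_⟩
    · rw [he]; exact (Nat.lt_ceil.1 (by omega)).le
    · rw [he]; have := Nat.le_ceil m; rw [hk] at this; exact_mod_cast this

lemma natCeil_le_two_mul {m : ℝ} (hm : 1 ≤ m) : (⌈m⌉₊ : ℝ) ≤ 2 * m := by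
  have := Nat.ceil_lt_add_one (show 0 ≤ m by linarith)
  linarith

/-- Sum over the subdivision of the first factor of the height function. -/
lemma sum_grid_inv_le {a b A C L : ℝ} (ha : 1 ≤ a) (hb : 1 ≤ b) (hC : C ≠ 0) (hL2 : 2 ≤ L)
    (hL : ∀ z : ℝ, ∑ i ∈ Finset.range ⌈b * a⌉₊, 1 / max 1 |z - i| ≤ L) :
    ∑ i ∈ Finset.range ⌈b * a⌉₊, 1 / max |a * (A - gridPt (b * a) i * C)| |C / b| ≤
      b * (2 * L) / max |A| |C| := by
  have hab : 1 ≤ b * a := one_le_mul_of_one_le_of_one_le hb ha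
  have hb0 : 0 < b := by linarith
  have ha0 : 0 < a := by linarith
  have hC0 : 0 < |C| := abs_pos.2 hC
  rcases le_total (2 * |C|) |A| with h | h
  · have hA : 0 < |A| := by linarith
    rw [max_eq_left (by linarith : |C| ≤ |A|)]
    calc _ ≤ ∑ i ∈ Finset.range ⌈b * a⌉₊, 2 / (a * |A|) := by
          refine Finset.sum_le_sum fun i hi => ?_
          have h1 := abs_gridPt_le hab (Finset.mem_range.1 hi)
          have h2 : |A| / 2 ≤ |A - gridPt (b * a) i * C| := by
            have := abs_sub_abs_le_abs_sub A (gridPt (b * a) i * C)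
            rw [abs_mul] at this
            nlinarith
          have h3 : a * |A| / 2 ≤ max |a * (A - gridPt (b * a) i * C)| |C / b| := by
            refine le_trans ?_ (le_max_left _ _)
            rw [abs_mul, abs_of_pos ha0]
            nlinarith
          calc _ ≤ 1 / (a * |A| / 2) := by gcongr
            _ = _ := by field_simp
      _ = ⌈b * a⌉₊ * (2 / (a * |A|)) := by rw [Finset.sum_const, Finset.card_range, nsmul_eq_mul]
      _ ≤ (2 * (b * a)) * (2 / (a * |A|)) := by gcongr; exact natCeil_le_two_mul hab
      _ = b * 4 / |A| := by field_simp; ring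
      _ ≤ _ := by gcongr; linarith
  · have hmax : max |A| |C| ≤ 2 * |C| := max_le h (by linarith)
    calc _ = ∑ i ∈ Finset.range ⌈b * a⌉₊, (b / |C|) *
          (1 / max 1 |((A / C + 1 / 2) * (b * a) - 1 / 2) - i|) := by
          refine Finset.sum_congr rfl fun i hi => ?_
          have e1 : a * (A - gridPt (b * a) i * C) =
              (C / b) * (((A / C + 1 / 2) * (b * a) - 1 / 2) - i) := by
            rw [gridPt]; field_simp; ring
          have e2 : max |a * (A - gridPt (b * a) i * C)| |C / b| =
              |C / b| * max 1 |((A / C + 1 / 2) * (b * a) - 1 / 2) - i| := by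
            rw [e1, abs_mul, mul_max_of_nonneg _ _ (abs_nonneg _), mul_one, max_comm]
          rw [e2, abs_div, abs_of_pos hb0]
          field_simp
      _ ≤ (b / |C|) * L := by rw [← Finset.mul_sum]; gcongr; exact hL _
      _ = b * (2 * L) / (2 * |C|) := by field_simp
      _ ≤ _ := by gcongr

lemma sum_grid_dual_aux {a b A C L : ℝ} (ha : 1 ≤ a) (hb : 1 ≤ b) (hA : A ≠ 0)
    (hL : ∀ z : ℝ, ∑ i ∈ Finset.range ⌈b * a⌉₊, 1 / max 1 |z - i| ≤ L) :
    ∑ i ∈ Finset.range ⌈b * a⌉₊, 1 / max |A / a| |b * (C + gridPt (b * a) i * A)| ≤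
      a * L / |A| := by
  have hb0 : 0 < b := by linarith
  have ha0 : 0 < a := by linarith
  have hA0 : 0 < |A| := abs_pos.2 hA
  calc _ = ∑ i ∈ Finset.range ⌈b * a⌉₊, (a / |A|) *
          (1 / max 1 |(-(C / A - 1 / 2) * (b * a) - 1 / 2) - i|) := by
          refine Finset.sum_congr rfl fun i hi => ?_
          have e1 : b * (C + gridPt (b * a) i * A) =
              -((A / a) * ((-(C / A - 1 / 2) * (b * a) - 1 / 2) - i)) := by
            rw [gridPt]; field_simp; ring
          have e2 : max |A / a| |b * (C + gridPt (b * a) i * A)| =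
              |A / a| * max 1 |(-(C / A - 1 / 2) * (b * a) - 1 / 2) - i| := by
            rw [e1, abs_neg, abs_mul, mul_max_of_nonneg _ _ (abs_nonneg _), mul_one]
          rw [e2, abs_div, abs_of_pos ha0]
          field_simp
      _ ≤ (a / |A|) * L := by rw [← Finset.mul_sum]; gcongr; exact hL _
      _ = _ := by ring

/-- Change of coordinates of a vector when passing to a child box. -/
noncomputable def stepV (a₁ a₂ s t : ℝ) (v : ℝ × ℝ × ℝ) : ℝ × ℝ × ℝ :=
  (a₁ * (v.1 - s * v.2.2), a₂ * (v.2.1 - t * v.2.2), v.2.2 / (a₁ * a₂))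

/-- Change of coordinates of a dual vector when passing to a child box. -/
noncomputable def stepD (a₁ a₂ s t : ℝ) (v : ℝ × ℝ × ℝ) : ℝ × ℝ × ℝ :=
  (v.1 / a₁, v.2.1 / a₂, (a₁ * a₂) * (v.2.2 + s * v.1 + t * v.2.1))

lemma sum_grid_dual {a₁ a₂ L : ℝ} (h₁ : 1 ≤ a₁) (h₂ : 1 ≤ a₂) (hL1 : 1 ≤ L)
    (hLa : ∀ z : ℝ, ∑ i ∈ Finset.range ⌈a₁ * a₂ * a₁⌉₊, 1 / max 1 |z - i| ≤ L)
    (hLb : ∀ z : ℝ, ∑ i ∈ Finset.range ⌈a₁ * a₂ * a₂⌉₊, 1 / max 1 |z - i| ≤ L)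
    {d : ℝ × ℝ × ℝ} (hd : d ≠ 0) :
    ∑ i ∈ Finset.range ⌈a₁ * a₂ * a₁⌉₊, ∑ j ∈ Finset.range ⌈a₁ * a₂ * a₂⌉₊,
      1 / ‖stepD a₁ a₂ (gridPt (a₁ * a₂ * a₁) i) (gridPt (a₁ * a₂ * a₂) j) d‖ ≤
      (a₁ * a₂) ^ 2 * (8 * L) / ‖d‖ := by
  have hd0 := norm_pos_iff.2 hd
  have hb : 1 ≤ a₁ * a₂ := one_le_mul_of_one_le_of_one_le h₁ h₂
  set b := a₁ * a₂ with hbdef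
  have hb1 : 1 ≤ b * a₁ := one_le_mul_of_one_le_of_one_le hb h₁
  have hb2 : 1 ≤ b * a₂ := one_le_mul_of_one_le_of_one_le hb h₂
  have hb0 : 0 < b := by linarith
  have ha1 : 0 < a₁ := by linarith
  have ha2 : 0 < a₂ := by linarith
  obtain ⟨A, B, C⟩ := d
  have hnorm : ∀ s t, ‖stepD a₁ a₂ s t (A, B, C)‖ =
      max |A / a₁| (max |B / a₂| |b * (C + s * A + t * B)|) := by
    intro s t
    simp only [stepD, Prod.norm_def, Real.norm_eq_abs, hbdef]
  simp only [hnorm]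
  have hnd : ‖(A, B, C)‖ = max |A| (max |B| |C|) := by simp [Prod.norm_def]
  by_cases hC : 4 * max |A| |B| ≤ |C|
  · have hA : 4 * |A| ≤ |C| := le_trans (by gcongr; exact le_max_left _ _) hC
    have hB : 4 * |B| ≤ |C| := le_trans (by gcongr; exact le_max_right _ _) hC
    have hn : ‖(A, B, C)‖ = |C| := by
      rw [hnd, max_eq_right, max_eq_right]
      · linarith [abs_nonneg B]
      · exact le_trans (by linarith [abs_nonneg A]) (le_max_right _ _)
    rw [hn] at hd0 ⊢
    calc _ ≤ ∑ i ∈ Finset.range ⌈b * a₁⌉₊, ∑ j ∈ Finset.range ⌈b * a₂⌉₊, 2 / (b * |C|) := by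
          refine Finset.sum_le_sum fun i hi => Finset.sum_le_sum fun j hj => ?_
          have h1 := abs_gridPt_le hb1 (Finset.mem_range.1 hi)
          have h2 := abs_gridPt_le hb2 (Finset.mem_range.1 hj)
          set s := gridPt (b * a₁) i
          set t := gridPt (b * a₂) j
          have h3 : |C| / 2 ≤ |C + s * A + t * B| := by
            have e1 : |s * A| ≤ |A| := by rw [abs_mul]; nlinarith [abs_nonneg A]
            have e2 : |t * B| ≤ |B| := by rw [abs_mul]; nlinarith [abs_nonneg B]
            have e3 := abs_add_le (s * A) (t * B)
            have := abs_sub_abs_le_abs_sub C (-(s * A + t * B))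
            rw [abs_neg] at this
            have e : C - -(s * A + t * B) = C + s * A + t * B := by ring
            rw [e] at this
            linarith
          have h4 : b * |C| / 2 ≤ max |A / a₁| (max |B / a₂| |b * (C + s * A + t * B)|) := by
            refine le_trans ?_ ((le_max_right _ _).trans (le_max_right _ _))
            rw [abs_mul, abs_of_pos hb0]
            nlinarith
          calc _ ≤ 1 / (b * |C| / 2) := by gcongr
            _ = _ := by field_simp
      _ = ⌈b * a₁⌉₊ * (⌈b * a₂⌉₊ * (2 / (b * |C|))) := by
          simp only [Finset.sum_const, Finset.card_range, nsmul_eq_mul]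
      _ ≤ (2 * (b * a₁)) * ((2 * (b * a₂)) * (2 / (b * |C|))) := by
          gcongr
          · exact natCeil_le_two_mul hb1
          · exact natCeil_le_two_mul hb2
      _ = b ^ 2 * 8 / |C| := by rw [hbdef]; field_simp; ring
      _ ≤ _ := by gcongr; linarith
  · push Not at hC
    rcases le_total |B| |A| with hAB | hAB
    · rw [max_eq_left hAB] at hC
      have hA0 : 0 < |A| := by
        have := abs_nonneg C
        linarith
      have hn : ‖(A, B, C)‖ ≤ 4 * |A| := by
        rw [hnd]; exact max_le (by linarith) (max_le (by linarith) hC.le)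
      rw [Finset.sum_comm]
      calc _ ≤ ∑ j ∈ Finset.range ⌈b * a₂⌉₊, a₁ * L / |A| := by
            refine Finset.sum_le_sum fun j hj => ?_
            refine le_trans (Finset.sum_le_sum fun i hi => ?_)
              (sum_grid_dual_aux (C := C + gridPt (b * a₂) j * B) h₁ hb (abs_pos.1 hA0) hLa)
            refine one_div_le_one_div_of_le (lt_max_of_lt_left
              (abs_pos.2 (div_ne_zero (abs_pos.1 hA0) ha1.ne'))) (max_le_max le_rfl ?_)
            refine (le_of_eq ?_).trans (le_max_right _ _)
            congr 2; ring
        _ = ⌈b * a₂⌉₊ * (a₁ * L / |A|) := by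
            simp only [Finset.sum_const, Finset.card_range, nsmul_eq_mul]
        _ ≤ (2 * (b * a₂)) * (a₁ * L / |A|) := by gcongr; exact natCeil_le_two_mul hb2
        _ = b ^ 2 * (8 * L) / (4 * |A|) := by rw [hbdef]; field_simp; ring
        _ ≤ _ := by gcongr
    · rw [max_eq_right hAB] at hC
      have hB0 : 0 < |B| := by
        have := abs_nonneg C
        linarith
      have hn : ‖(A, B, C)‖ ≤ 4 * |B| := by
        rw [hnd]; exact max_le (by linarith) (max_le (by linarith) hC.le)
      calc _ ≤ ∑ i ∈ Finset.range ⌈b * a₁⌉₊, a₂ * L / |B| := by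
            refine Finset.sum_le_sum fun j hj => ?_
            refine le_trans (Finset.sum_le_sum fun i hi => ?_)
              (sum_grid_dual_aux (C := C + gridPt (b * a₁) j * A) h₂ hb (abs_pos.1 hB0) hLb)
            refine one_div_le_one_div_of_le (lt_max_of_lt_left
              (abs_pos.2 (div_ne_zero (abs_pos.1 hB0) ha2.ne'))) (le_max_right _ _)
        _ = ⌈b * a₁⌉₊ * (a₂ * L / |B|) := by
            simp only [Finset.sum_const, Finset.card_range, nsmul_eq_mul]
        _ ≤ (2 * (b * a₁)) * (a₂ * L / |B|) := by gcongr; exact natCeil_le_two_mul hb1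
        _ = b ^ 2 * (8 * L) / (4 * |B|) := by rw [hbdef]; field_simp; ring
        _ ≤ _ := by gcongr

/-- A box in the plane centred at `(x, y)`, with the scaling parameters of the associated
unimodular lattice. -/
structure BoxState where
  α : ℝ
  β : ℝ
  γ : ℝ
  x : ℝ
  y : ℝ
  one_le_α : 1 ≤ α
  one_le_β : 1 ≤ β
  γ_pos : 0 < γ
  mul_eq_one : α * β * γ = 1

namespace BoxState

variable (S : BoxState)

lemma α_pos : 0 < S.α := by linarith [S.one_le_α]

lemma β_pos : 0 < S.β := by linarith [S.one_le_β]

/-- The lattice attached to a box. -/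
noncomputable def latP : ℤ × ℤ × ℤ →+ ℝ × ℝ × ℝ :=
  AddMonoidHom.mk' (fun v => (S.α * (v.1 - v.2.2 * S.x), S.β * (v.2.1 - v.2.2 * S.y),
    S.γ * v.2.2)) (fun v w => by ext <;> simp <;> ring)

/-- The dual lattice attached to a box. -/
noncomputable def latD : ℤ × ℤ × ℤ →+ ℝ × ℝ × ℝ :=
  AddMonoidHom.mk' (fun d => (d.1 / S.α, d.2.1 / S.β, (d.2.2 + S.x * d.1 + S.y * d.2.1) / S.γ))
    (fun v w => by ext <;> simp <;> ring)

lemma latP_apply (v : ℤ × ℤ × ℤ) : S.latP v = (S.α * (v.1 - v.2.2 * S.x),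
    S.β * (v.2.1 - v.2.2 * S.y), S.γ * v.2.2) := rfl

lemma latD_apply (d : ℤ × ℤ × ℤ) : S.latD d = (d.1 / S.α, d.2.1 / S.β,
    (d.2.2 + S.x * d.1 + S.y * d.2.1) / S.γ) := rfl

lemma cr_latP (v w : ℤ × ℤ × ℤ) : cr (S.latP v) (S.latP w) = S.latD (cr v w) := by
  have h := S.mul_eq_one
  have ha := S.α_pos.ne'
  have hb := S.β_pos.ne'
  have hg := S.γ_pos.ne'
  simp only [latP_apply, latD_apply, cr]
  push_cast
  ext
  · simp only
    rw [eq_div_iff ha]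
    linear_combination ((v.2.1 : ℝ) * w.2.2 - v.2.2 * w.2.1) * h
  · simp only
    rw [eq_div_iff hb]
    linear_combination ((v.2.2 : ℝ) * w.1 - v.1 * w.2.2) * h
  · simp only
    rw [eq_div_iff hg]
    linear_combination (v.1 * w.2.1 - v.2.1 * w.1 + S.x * (v.2.1 * w.2.2 - v.2.2 * w.2.1) +
      S.y * ((v.2.2 : ℝ) * w.1 - v.1 * w.2.2)) * h

lemma cr_latD (v w : ℤ × ℤ × ℤ) : cr (S.latD v) (S.latD w) = S.latP (cr v w) := by
  have h := S.mul_eq_one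
  have ha := S.α_pos.ne'
  have hb := S.β_pos.ne'
  have hg := S.γ_pos.ne'
  have hγ : S.γ = 1 / (S.α * S.β) := by rw [eq_div_iff (by positivity)]; linarith
  simp only [latP_apply, latD_apply, cr]
  push_cast
  rw [hγ]
  ext <;> simp only <;> field_simp <;> ring

lemma finite_of_bound (f : ℤ × ℤ × ℤ → ℝ × ℝ × ℝ) (ρ B : ℝ)
    (h : ∀ v : ℤ × ℤ × ℤ, ‖f v‖ ≤ ρ → |(v.1 : ℝ)| ≤ B ∧ |(v.2.1 : ℝ)| ≤ B ∧ |(v.2.2 : ℝ)| ≤ B) :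
    {v | ‖f v‖ ≤ ρ}.Finite := by
  have key : ∀ z : ℤ, |(z : ℝ)| ≤ B → z ∈ Set.Icc (-⌈B⌉) ⌈B⌉ := by
    intro z hz
    have := (abs_le.1 hz)
    have h2 := Int.le_ceil B
    constructor
    · have : (-⌈B⌉ : ℝ) ≤ z := by linarith
      exact_mod_cast this
    · have : (z : ℝ) ≤ ⌈B⌉ := by linarith
      exact_mod_cast this
  refine Set.Finite.subset ((Set.finite_Icc (-⌈B⌉) ⌈B⌉).prod
    ((Set.finite_Icc (-⌈B⌉) ⌈B⌉).prod (Set.finite_Icc (-⌈B⌉) ⌈B⌉))) ?_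
  intro v hv
  obtain ⟨h1, h2, h3⟩ := h v hv
  exact ⟨key _ h1, key _ h2, key _ h3⟩

lemma finite_latP (ρ : ℝ) : {v | ‖S.latP v‖ ≤ ρ}.Finite := by
  have ha := S.α_pos
  have hb := S.β_pos
  have hg := S.γ_pos
  refine finite_of_bound _ ρ (|ρ / S.γ| + |ρ / S.α| + |ρ / S.β| + |ρ / S.γ| * |S.x| +
    |ρ / S.γ| * |S.y|) ?_
  intro v hv
  obtain ⟨h1, h2, h3⟩ := triple_norm_le.1 hv
  simp only [latP_apply, abs_mul, abs_of_pos ha, abs_of_pos hb, abs_of_pos hg] at h1 h2 h3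
  have hq : |(v.2.2 : ℝ)| ≤ |ρ / S.γ| :=
    le_trans ((le_div_iff₀ hg).2 (by linarith)) (le_abs_self _)
  have hp1 : |v.1 - v.2.2 * S.x| ≤ |ρ / S.α| :=
    le_trans ((le_div_iff₀ ha).2 (by linarith)) (le_abs_self _)
  have hp2 : |v.2.1 - v.2.2 * S.y| ≤ |ρ / S.β| :=
    le_trans ((le_div_iff₀ hb).2 (by linarith)) (le_abs_self _)
  have e1 := abs_sub_abs_le_abs_sub (v.1 : ℝ) (v.2.2 * S.x)
  have e2 := abs_sub_abs_le_abs_sub (v.2.1 : ℝ) (v.2.2 * S.y)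
  rw [abs_mul] at e1 e2
  have q1 : |(v.2.2 : ℝ)| * |S.x| ≤ |ρ / S.γ| * |S.x| := by gcongr
  have q2 : |(v.2.2 : ℝ)| * |S.y| ≤ |ρ / S.γ| * |S.y| := by gcongr
  have n1 : 0 ≤ |ρ / S.γ| * |S.x| := by positivity
  have n2 : 0 ≤ |ρ / S.γ| * |S.y| := by positivity
  have n3 := abs_nonneg (ρ / S.γ)
  have n4 := abs_nonneg (ρ / S.α)
  have n5 := abs_nonneg (ρ / S.β)
  refine ⟨?_, ?_, ?_⟩ <;> linarith

lemma finite_latD (ρ : ℝ) : {v | ‖S.latD v‖ ≤ ρ}.Finite := by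
  have ha := S.α_pos
  have hb := S.β_pos
  have hg := S.γ_pos
  refine finite_of_bound _ ρ (|ρ * S.γ| + |ρ * S.α| + |ρ * S.β| + |S.x| * |ρ * S.α| +
    |S.y| * |ρ * S.β|) ?_
  intro v hv
  obtain ⟨h1, h2, h3⟩ := triple_norm_le.1 hv
  simp only [latD_apply, abs_div, abs_of_pos ha, abs_of_pos hb, abs_of_pos hg] at h1 h2 h3
  have hp1 : |(v.1 : ℝ)| ≤ |ρ * S.α| :=
    le_trans ((div_le_iff₀ ha).1 h1) (le_abs_self _)
  have hp2 : |(v.2.1 : ℝ)| ≤ |ρ * S.β| :=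
    le_trans ((div_le_iff₀ hb).1 h2) (le_abs_self _)
  have hp3 : |v.2.2 + S.x * v.1 + S.y * v.2.1| ≤ |ρ * S.γ| :=
    le_trans ((div_le_iff₀ hg).1 h3) (le_abs_self _)
  have e1 := abs_sub_abs_le_abs_sub (v.2.2 : ℝ) (-(S.x * v.1 + S.y * v.2.1))
  rw [abs_neg] at e1
  have e : (v.2.2 : ℝ) - -(S.x * v.1 + S.y * v.2.1) = v.2.2 + S.x * v.1 + S.y * v.2.1 := by ring
  rw [e] at e1
  have e2 := abs_add_le (S.x * (v.1 : ℝ)) (S.y * v.2.1)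
  rw [abs_mul, abs_mul] at e2
  have q1 : |S.x| * |(v.1 : ℝ)| ≤ |S.x| * |ρ * S.α| := by gcongr
  have q2 : |S.y| * |(v.2.1 : ℝ)| ≤ |S.y| * |ρ * S.β| := by gcongr
  have n1 : 0 ≤ |S.x| * |ρ * S.α| := by positivity
  have n2 : 0 ≤ |S.y| * |ρ * S.β| := by positivity
  have n3 := abs_nonneg (ρ * S.γ)
  have n4 := abs_nonneg (ρ * S.α)
  have n5 := abs_nonneg (ρ * S.β)
  refine ⟨?_, ?_, ?_⟩ <;> linarith

lemma latP_ne_zero {v : ℤ × ℤ × ℤ} (hv : v ≠ 0) : S.latP v ≠ 0 := by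
  contrapose! hv
  simp only [latP_apply, Prod.ext_iff, Prod.fst_zero, Prod.snd_zero, mul_eq_zero, S.α_pos.ne',
    S.β_pos.ne', S.γ_pos.ne', false_or] at hv
  obtain ⟨h1, h2, h3⟩ := hv
  rw [h3] at h1 h2
  simp only [zero_mul, sub_zero] at h1 h2
  ext <;> simp <;> assumption_mod_cast

lemma latD_ne_zero {v : ℤ × ℤ × ℤ} (hv : v ≠ 0) : S.latD v ≠ 0 := by
  contrapose! hv
  simp only [latD_apply, Prod.ext_iff, Prod.fst_zero, Prod.snd_zero, div_eq_zero_iff, S.α_pos.ne',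
    S.β_pos.ne', S.γ_pos.ne', or_false] at hv
  obtain ⟨h1, h2, h3⟩ := hv
  rw [h1, h2] at h3
  simp only [mul_zero, add_zero] at h3
  ext <;> simp <;> assumption_mod_cast

lemma exists_min_of_finite (f : ℤ × ℤ × ℤ → ℝ × ℝ × ℝ) (hf : ∀ ρ, {v | ‖f v‖ ≤ ρ}.Finite) :
    ∃ d, d ≠ 0 ∧ ∀ v, v ≠ 0 → ‖f d‖ ≤ ‖f v‖ := by
  have hfin : ({v | ‖f v‖ ≤ ‖f (1, 0, 0)‖} ∩ {v | v ≠ 0}).Finite := (hf _).inter_of_left _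
  have h10 : ((1, 0, 0) : ℤ × ℤ × ℤ) ≠ 0 := by simp [Prod.ext_iff]
  obtain ⟨d, hd, hmin⟩ := Set.exists_min_image _ (fun v => ‖f v‖) hfin ⟨(1, 0, 0), le_refl ‖f (1, 0, 0)‖, h10⟩
  refine ⟨d, hd.2, fun v hv => ?_⟩
  by_cases h : ‖f v‖ ≤ ‖f (1, 0, 0)‖
  · exact hmin v ⟨h, hv⟩
  · exact le_trans hd.1 (not_le.1 h).le

/-- A shortest nonzero dual vector. -/
noncomputable def minD : ℤ × ℤ × ℤ := (exists_min_of_finite _ S.finite_latD).choose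

lemma minD_ne_zero : S.minD ≠ 0 := (exists_min_of_finite _ S.finite_latD).choose_spec.1

lemma norm_minD_le {v : ℤ × ℤ × ℤ} (hv : v ≠ 0) : ‖S.latD S.minD‖ ≤ ‖S.latD v‖ :=
  (exists_min_of_finite _ S.finite_latD).choose_spec.2 v hv

lemma norm_minD_pos : 0 < ‖S.latD S.minD‖ := norm_pos_iff.2 (S.latD_ne_zero S.minD_ne_zero)

lemma finite_short : {v | v ≠ 0 ∧ ‖S.latP v‖ < 1}.Finite :=
  (S.finite_latP 1).subset fun _ hv => hv.2.le

/-- The set of short nonzero lattice vectors. -/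
noncomputable def short : Finset (ℤ × ℤ × ℤ) := S.finite_short.toFinset

lemma mem_short {v : ℤ × ℤ × ℤ} : v ∈ S.short ↔ v ≠ 0 ∧ ‖S.latP v‖ < 1 := by
  simp [short]

end BoxState

/-- The height of a single vector. -/
noncomputable def vecHeight (v : ℝ × ℝ × ℝ) : ℝ :=
  1 / max |v.1| |v.2.2| * (1 / max |v.2.1| |v.2.2|)

lemma vecHeight_nonneg (v : ℝ × ℝ × ℝ) : 0 ≤ vecHeight v := by
  unfold vecHeight; positivity

namespace BoxState

variable (S : BoxState)

/-- The primal part of the height function. -/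
noncomputable def heightP : ℝ := ∑ v ∈ S.short, vecHeight (S.latP v)

/-- The dual part of the height function. -/
noncomputable def heightD : ℝ := 1 / ‖S.latD S.minD‖

lemma heightP_nonneg : 0 ≤ S.heightP := Finset.sum_nonneg fun _ _ => vecHeight_nonneg _

lemma heightD_nonneg : 0 ≤ S.heightD := by unfold heightD; positivity

lemma latP_third_ne_zero {v : ℤ × ℤ × ℤ} (hv : v ∈ S.short) : (S.latP v).2.2 ≠ 0 := by
  obtain ⟨h0, h⟩ := S.mem_short.1 hv
  intro hz
  simp only [latP_apply, mul_eq_zero, S.γ_pos.ne', false_or] at hz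
  obtain ⟨h1, h2, -⟩ := triple_norm_lt.1 h
  simp only [latP_apply, hz, zero_mul, sub_zero, abs_mul, abs_of_pos S.α_pos,
    abs_of_pos S.β_pos] at h1 h2
  have key : ∀ (c : ℝ) (z : ℤ), 1 ≤ c → c * |(z : ℝ)| < 1 → z = 0 := by
    intro c z hc hcz
    by_contra hne
    have : (1 : ℝ) ≤ |(z : ℝ)| := by exact_mod_cast Int.one_le_abs hne
    nlinarith
  apply h0
  ext
  · exact key _ _ S.one_le_α h1
  · exact key _ _ S.one_le_β h2
  · simpa using hz

lemma inv_sq_le_vecHeight {v : ℤ × ℤ × ℤ} (hv : v ∈ S.short) :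
    1 / ‖S.latP v‖ ^ 2 ≤ vecHeight (S.latP v) := by
  have hC := abs_pos.2 (S.latP_third_ne_zero hv)
  obtain ⟨h1, h2, h3⟩ := triple_norm_le.1 (le_refl ‖S.latP v‖)
  have e : 1 / ‖S.latP v‖ ^ 2 = 1 / ‖S.latP v‖ * (1 / ‖S.latP v‖) := by field_simp
  rw [e, vecHeight]
  have m1 : 0 < max |(S.latP v).1| |(S.latP v).2.2| := lt_max_of_lt_right hC
  have m2 : 0 < max |(S.latP v).2.1| |(S.latP v).2.2| := lt_max_of_lt_right hC
  gcongr
  · exact max_le h1 h3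
  · exact max_le h2 h3

lemma inv_sq_le_heightP {v : ℤ × ℤ × ℤ} (hv : v ∈ S.short) :
    1 / ‖S.latP v‖ ^ 2 ≤ S.heightP :=
  (S.inv_sq_le_vecHeight hv).trans
    (Finset.single_le_sum (f := fun v => vecHeight (S.latP v)) (fun _ _ => vecHeight_nonneg _) hv)

/-- The child box with relative centre `(s, t)`, rescaled by `(a₁, a₂)`. -/
noncomputable def child (a₁ a₂ : ℝ) (h₁ : 1 ≤ a₁) (h₂ : 1 ≤ a₂) (s t : ℝ) : BoxState where
  α := a₁ * S.α
  β := a₂ * S.β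
  γ := S.γ / (a₁ * a₂)
  x := S.x + s * (S.γ / S.α)
  y := S.y + t * (S.γ / S.β)
  one_le_α := one_le_mul_of_one_le_of_one_le h₁ S.one_le_α
  one_le_β := one_le_mul_of_one_le_of_one_le h₂ S.one_le_β
  γ_pos := div_pos S.γ_pos (mul_pos (by linarith) (by linarith))
  mul_eq_one := by
    have : a₁ ≠ 0 := by linarith
    have : a₂ ≠ 0 := by linarith
    have := S.mul_eq_one
    field_simp
    linarith

section

variable {a₁ a₂ : ℝ} (h₁ : 1 ≤ a₁) (h₂ : 1 ≤ a₂) (s t : ℝ)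

lemma latP_child (v : ℤ × ℤ × ℤ) :
    (S.child a₁ a₂ h₁ h₂ s t).latP v = stepV a₁ a₂ s t (S.latP v) := by
  have ha := S.α_pos.ne'
  have hb := S.β_pos.ne'
  simp only [latP_apply, stepV, child]
  ext
  · simp only; field_simp; ring
  · simp only; field_simp; ring
  · simp only; ring

lemma latD_child (v : ℤ × ℤ × ℤ) :
    (S.child a₁ a₂ h₁ h₂ s t).latD v = stepD a₁ a₂ s t (S.latD v) := by
  have ha := S.α_pos.ne'
  have hb := S.β_pos.ne'
  have hg := S.γ_pos.ne'
  have : a₁ ≠ 0 := by linarith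
  have : a₂ ≠ 0 := by linarith
  simp only [latD_apply, stepD, child]
  ext <;> simp only <;> field_simp
  ring

end

end BoxState

lemma stepD_smul (a₁ a₂ s t c : ℝ) (v : ℝ × ℝ × ℝ) :
    stepD a₁ a₂ s t (c • v) = c • stepD a₁ a₂ s t v := by
  ext <;> simp [stepD] <;> ring

lemma norm_le_norm_stepD {a₁ a₂ s t : ℝ} (h₁ : 1 ≤ a₁) (h₂ : 1 ≤ a₂) (hs : |s| ≤ 1)
    (ht : |t| ≤ 1) (d : ℝ × ℝ × ℝ) : ‖d‖ ≤ 3 * (a₁ * a₂) * ‖stepD a₁ a₂ s t d‖ := by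
  set X := ‖stepD a₁ a₂ s t d‖ with hX
  obtain ⟨x1, x2, x3⟩ := triple_norm_le.1 hX.symm.le
  have hX0 : 0 ≤ X := norm_nonneg _
  have ha1 : 0 < a₁ := by linarith
  have ha2 : 0 < a₂ := by linarith
  simp only [stepD] at x1 x2 x3
  rw [abs_div, abs_of_pos ha1, div_le_iff₀ ha1] at x1
  rw [abs_div, abs_of_pos ha2, div_le_iff₀ ha2] at x2
  rw [abs_mul, abs_of_pos (mul_pos ha1 ha2)] at x3
  have hb : 1 ≤ a₁ * a₂ := one_le_mul_of_one_le_of_one_le h₁ h₂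
  have k1 : |d.1| ≤ a₁ * a₂ * X := by nlinarith [mul_nonneg hX0 ha1.le]
  have k2 : |d.2.1| ≤ a₁ * a₂ * X := by nlinarith [mul_nonneg hX0 ha2.le]
  have k3 : |d.2.2 + s * d.1 + t * d.2.1| ≤ a₁ * a₂ * X := by
    have := abs_nonneg (d.2.2 + s * d.1 + t * d.2.1)
    nlinarith [mul_nonneg hX0 (sub_nonneg.2 hb)]
  have hbX : 0 ≤ a₁ * a₂ * X := by positivity
  refine triple_norm_le.2 ⟨by linarith, by linarith, ?_⟩
  have e1 : |s * d.1| ≤ |d.1| := by rw [abs_mul]; nlinarith [abs_nonneg d.1]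
  have e2 : |t * d.2.1| ≤ |d.2.1| := by rw [abs_mul]; nlinarith [abs_nonneg d.2.1]
  have e3 := abs_add_le (s * d.1) (t * d.2.1)
  have e4 := abs_sub_abs_le_abs_sub d.2.2 (-(s * d.1 + t * d.2.1))
  rw [abs_neg, show d.2.2 - -(s * d.1 + t * d.2.1) = d.2.2 + s * d.1 + t * d.2.1 by ring] at e4
  linarith

namespace BoxState

variable (S : BoxState) {a₁ a₂ : ℝ} (h₁ : 1 ≤ a₁) (h₂ : 1 ≤ a₂) {s t l : ℝ}

lemma heightD_child_le (hs : |s| ≤ 1) (ht : |t| ≤ 1) (hl : 0 < l)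
    (hmin : ∀ v, v ≠ 0 → l ≤ ‖S.latP v‖) :
    (S.child a₁ a₂ h₁ h₂ s t).heightD ≤ 1 / ‖stepD a₁ a₂ s t (S.latD S.minD)‖ +
      3 * (a₁ * a₂) * (1 + 2 / l) := by
  have hb : 1 ≤ a₁ * a₂ := one_le_mul_of_one_le_of_one_le h₁ h₂
  set S' := S.child a₁ a₂ h₁ h₂ s t with hS'
  have hd0 := S.minD_ne_zero
  have hd' := S'.minD_ne_zero
  have hpos' := S'.norm_minD_pos
  set d₀ := S.minD
  set d' := S'.minD
  have hd0E := S.latD_ne_zero hd0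
  have hd'E := S.latD_ne_zero hd'
  have hle := S.norm_minD_le hd'
  have hpos := norm_pos_iff.2 hd'E
  have e : S'.latD d' = stepD a₁ a₂ s t (S.latD d') := S.latD_child h₁ h₂ s t d'
  have hstep0 : ∀ d, d ≠ 0 → 0 < ‖stepD a₁ a₂ s t (S.latD d)‖ := by
    intro d hd
    rw [← S.latD_child h₁ h₂ s t d]
    exact norm_pos_iff.2 (latD_ne_zero _ hd)
  unfold heightD
  by_cases hcr : cr d₀ d' = 0
  · obtain ⟨f, -, hf0, hf⟩ := exists_coordinate _ hd0E
    obtain ⟨n1, n2⟩ := hf (S.latD d') (by rw [S.cr_latD, hcr, map_zero])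
    obtain ⟨n3, -⟩ := hf (S.latD d₀) (by ext <;> simp [cr] <;> ring)
    rw [n1, n3] at hle
    have e2 := congrArg (fun v => ‖stepD a₁ a₂ s t v‖) n2
    simp only [stepD_smul, norm_smul, Real.norm_eq_abs] at e2
    rw [← e] at e2
    have hf0' := abs_pos.2 hf0
    have : ‖stepD a₁ a₂ s t (S.latD d₀)‖ ≤ ‖S'.latD d'‖ := by
      have h3 := mul_le_mul_of_nonneg_right hle (hstep0 _ hd0).le
      rw [← e2] at h3
      exact le_of_mul_le_mul_left h3 hf0'
    have h4 : 1 / ‖S'.latD d'‖ ≤ 1 / ‖stepD a₁ a₂ s t (S.latD d₀)‖ :=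
      one_div_le_one_div_of_le (hstep0 _ hd0) this
    have : 0 ≤ 3 * (a₁ * a₂) * (1 + 2 / l) := by positivity
    linarith
  · have h3 := hmin _ hcr
    rw [← S.cr_latD] at h3
    have h4 := h3.trans (norm_cr_le _ _)
    set X := ‖S.latD d'‖ with hX
    have h5 : l ≤ 2 * X ^ 2 := by nlinarith
    have h6 : X ≤ 3 * (a₁ * a₂) * ‖S'.latD d'‖ := by
      rw [e]; exact norm_le_norm_stepD h₁ h₂ hs ht _
    have h7 : 1 / ‖S'.latD d'‖ ≤ 3 * (a₁ * a₂) * (1 / X) := by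
      rw [mul_one_div, div_le_div_iff₀ hpos' hpos]; linarith
    have h8 : 1 / X ≤ 1 + 2 / l := by
      have h9 : (1 / X) ^ 2 ≤ 2 / l := by
        rw [div_pow, one_pow, div_le_div_iff₀ (by positivity) hl]; linarith
      nlinarith [sq_nonneg (1 / X - 1 / 2)]
    have h10 : 3 * (a₁ * a₂) * (1 / X) ≤ 3 * (a₁ * a₂) * (1 + 2 / l) := by gcongr
    have h11 := one_div_pos.2 (hstep0 _ hd0)
    linarith

lemma heightP_child_le (h₁ : 2 ≤ a₁) (h₂ : 2 ≤ a₂) (hs : |s| ≤ 1) (ht : |t| ≤ 1)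
    (v₀ : ℤ × ℤ × ℤ) (hv₀ : v₀ ≠ 0) (hv₀1 : ‖S.latP v₀‖ ≤ 1)
    (hmin : ∀ v, v ≠ 0 → ‖S.latP v₀‖ ≤ ‖S.latP v‖) :
    (S.child a₁ a₂ (by linarith) (by linarith) s t).heightP ≤
      ∑ v ∈ S.short, vecHeight (stepV a₁ a₂ s t (S.latP v)) +
      4 * (a₁ * a₂) ^ 2 * (6 * (a₁ * a₂) / ‖S.latP v₀‖ + 1536 * (a₁ * a₂) ^ 3 +
        96 * (a₁ * a₂) ^ 2 * S.heightD) := by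
  classical
  have h₁' : 1 ≤ a₁ := by linarith
  have h₂' : 1 ≤ a₂ := by linarith
  have ha1 : 0 < a₁ := by linarith
  have ha2 : 0 < a₂ := by linarith
  have hb : 1 ≤ a₁ * a₂ := one_le_mul_of_one_le_of_one_le h₁' h₂'
  set S' := S.child a₁ a₂ h₁' h₂' s t with hS'
  have e : ∀ v, S'.latP v = stepV a₁ a₂ s t (S.latP v) := S.latP_child h₁' h₂' s t
  rw [heightP, ← Finset.sum_filter_add_sum_filter_not S'.short (fun v => v ∈ S.short)]
  simp only [e]
  set N := S'.short.filter (fun v => v ∉ S.short) with hN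
  apply add_le_add
  · apply Finset.sum_le_sum_of_subset_of_nonneg
    · intro v hv; exact (Finset.mem_filter.1 hv).2
    · intro v _ _; exact vecHeight_nonneg _
  set b := a₁ * a₂ with hbdef
  have hb0 : 0 < b := by linarith
  have hnew : ∀ v ∈ N, ‖S.latP v‖ ≤ 2 * b ∧
      vecHeight (stepV a₁ a₂ s t (S.latP v)) ≤ 4 * b ^ 2 := by
    intro v hv
    obtain ⟨hv1, hv2⟩ := Finset.mem_filter.1 hv
    obtain ⟨hv0, hv3⟩ := S'.mem_short.1 hv1
    have hv4 : 1 ≤ ‖S.latP v‖ := by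
      by_contra h; exact hv2 (S.mem_short.2 ⟨hv0, not_le.1 h⟩)
    rw [e] at hv3
    obtain ⟨x1, x2, x3⟩ := triple_norm_lt.1 hv3
    set A := (S.latP v).1 with hA
    set B := (S.latP v).2.1 with hB
    set C := (S.latP v).2.2 with hC
    simp only [stepV, ← hA, ← hB, ← hC, ← hbdef] at x1 x2 x3
    rw [abs_mul, abs_of_pos ha1] at x1
    rw [abs_mul, abs_of_pos ha2] at x2
    rw [abs_div, abs_of_pos hb0, div_lt_one hb0] at x3
    have y1 : |A - s * C| < 1 / 2 := by nlinarith [abs_nonneg (A - s * C)]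
    have y2 : |B - t * C| < 1 / 2 := by nlinarith [abs_nonneg (B - t * C)]
    have e1 : |s * C| ≤ |C| := by rw [abs_mul]; nlinarith [abs_nonneg C]
    have e2 : |t * C| ≤ |C| := by rw [abs_mul]; nlinarith [abs_nonneg C]
    have z1 := abs_sub_abs_le_abs_sub A (s * C)
    have z2 := abs_sub_abs_le_abs_sub B (t * C)
    refine ⟨triple_norm_le.2 ⟨?_, ?_, ?_⟩, ?_⟩
    · change |A| ≤ _; linarith
    · change |B| ≤ _; linarith
    · change |C| ≤ _; linarith
    have hC2 : 1 / 2 ≤ |C| := by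
      by_contra hlt
      push Not at hlt
      have : ‖S.latP v‖ < 1 := triple_norm_lt.2
        ⟨by change |A| < _; linarith, by change |B| < _; linarith, by change |C| < _; linarith⟩
      linarith
    have hC3 : 1 / (2 * b) ≤ |C / b| := by
      rw [abs_div, abs_of_pos hb0, div_le_div_iff₀ (by positivity) hb0]; nlinarith
    have key : ∀ u : ℝ, 1 / max |u| |C / b| ≤ 2 * b := by
      intro u
      have : 1 / (2 * b) ≤ max |u| |C / b| := hC3.trans (le_max_right _ _)
      calc _ ≤ 1 / (1 / (2 * b)) := one_div_le_one_div_of_le (by positivity) this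
        _ = _ := by rw [one_div_one_div]
    have h5 : vecHeight (stepV a₁ a₂ s t (S.latP v)) =
        1 / max |a₁ * (A - s * C)| |C / b| * (1 / max |a₂ * (B - t * C)| |C / b|) := rfl
    rw [h5]
    calc _ ≤ 2 * b * (2 * b) := by
          apply mul_le_mul (key _) (key _) (by positivity) (by positivity)
      _ = _ := by ring
  have hcard : (N.card : ℝ) ≤ 3 * (2 * b) / ‖S.latP v₀‖ + 192 * (2 * b) ^ 3 +
      24 * (2 * b) ^ 2 / ‖S.latD S.minD‖ := by
    have hinj : Function.Injective S.latP := by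
      rw [injective_iff_map_eq_zero]
      intro v hv
      by_contra h
      exact S.latP_ne_zero h hv
    rw [← Finset.card_image_of_injective N hinj]
    apply card_lattice_le S.latP.range S.latD.range
    · rintro _ ⟨v, rfl⟩ _ ⟨w, rfl⟩; exact ⟨_, (S.cr_latP v w).symm⟩
    · rintro _ ⟨v, rfl⟩ _ ⟨w, rfl⟩; exact ⟨_, (S.cr_latD v w).symm⟩
    · exact ⟨_, rfl⟩
    · exact S.latP_ne_zero hv₀
    · rintro _ ⟨v, rfl⟩ hv
      exact hmin v (by rintro rfl; simp at hv)
    · exact S.norm_minD_pos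
    · rintro _ ⟨v, rfl⟩ hv
      exact S.norm_minD_le (by rintro rfl; simp at hv)
    · linarith
    · exact hv₀1
    · intro x hx
      obtain ⟨v, hv, rfl⟩ := Finset.mem_image.1 hx
      exact ⟨⟨v, rfl⟩, (hnew v hv).1⟩
  calc _ ≤ ∑ v ∈ N, 4 * b ^ 2 := Finset.sum_le_sum fun v hv => (hnew v hv).2
    _ = 4 * b ^ 2 * N.card := by rw [Finset.sum_const, nsmul_eq_mul, mul_comm]
    _ ≤ 4 * b ^ 2 * (3 * (2 * b) / ‖S.latP v₀‖ + 192 * (2 * b) ^ 3 +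
      24 * (2 * b) ^ 2 / ‖S.latD S.minD‖) := by gcongr
    _ = _ := by rw [heightD]; ring

end BoxState

namespace BoxState

variable (S : BoxState)

/-- The total height of a box; the parameter weighs the dual part. -/
noncomputable def height (M : ℝ) : ℝ := S.heightP + M * S.heightD

lemma height_nonneg {M : ℝ} (hM : 0 ≤ M) : 0 ≤ S.height M :=
  add_nonneg S.heightP_nonneg (mul_nonneg hM S.heightD_nonneg)

/-- The child box with index `(i, j)`. -/
noncomputable def gridChild (a₁ a₂ : ℝ) (h₁ : 1 ≤ a₁) (h₂ : 1 ≤ a₂) (i j : ℕ) : BoxState :=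
  S.child a₁ a₂ h₁ h₂ (gridPt (a₁ * a₂ * a₁) i) (gridPt (a₁ * a₂ * a₂) j)

lemma sum_vecHeight_le {a₁ a₂ L : ℝ} (h₁ : 1 ≤ a₁) (h₂ : 1 ≤ a₂) (hL2 : 2 ≤ L)
    (hLa : ∀ z : ℝ, ∑ i ∈ Finset.range ⌈a₁ * a₂ * a₁⌉₊, 1 / max 1 |z - i| ≤ L)
    (hLb : ∀ z : ℝ, ∑ i ∈ Finset.range ⌈a₁ * a₂ * a₂⌉₊, 1 / max 1 |z - i| ≤ L)
    {v : ℤ × ℤ × ℤ} (hv : v ∈ S.short) :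
    ∑ i ∈ Finset.range ⌈a₁ * a₂ * a₁⌉₊, ∑ j ∈ Finset.range ⌈a₁ * a₂ * a₂⌉₊,
      vecHeight (stepV a₁ a₂ (gridPt (a₁ * a₂ * a₁) i) (gridPt (a₁ * a₂ * a₂) j) (S.latP v)) ≤
      (a₁ * a₂) ^ 2 * (4 * L ^ 2) * vecHeight (S.latP v) := by
  have hb : 1 ≤ a₁ * a₂ := one_le_mul_of_one_le_of_one_le h₁ h₂
  have hC := S.latP_third_ne_zero hv
  simp only [vecHeight, stepV, ← Finset.mul_sum]
  rw [← Finset.sum_mul]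
  calc _ ≤ (a₁ * a₂) * (2 * L) / max |(S.latP v).1| |(S.latP v).2.2| *
        ((a₁ * a₂) * (2 * L) / max |(S.latP v).2.1| |(S.latP v).2.2|) :=
        mul_le_mul (sum_grid_inv_le h₁ hb hC hL2 hLa) (sum_grid_inv_le h₂ hb hC hL2 hLb)
          (Finset.sum_nonneg fun _ _ => by positivity) (by positivity)
    _ = _ := by ring

/-- The average height of the children of a box containing a very short vector is controlled by
the height of the box. -/
lemma sum_height_child_le {a₁ a₂ L r : ℝ} (h₁ : 2 ≤ a₁) (h₂ : 2 ≤ a₂) (hL2 : 2 ≤ L)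
    (hLa : ∀ z : ℝ, ∑ i ∈ Finset.range ⌈a₁ * a₂ * a₁⌉₊, 1 / max 1 |z - i| ≤ L)
    (hLb : ∀ z : ℝ, ∑ i ∈ Finset.range ⌈a₁ * a₂ * a₂⌉₊, 1 / max 1 |z - i| ≤ L)
    (hr : 80000 * (a₁ * a₂) ^ 9 * r ≤ 1) (hS : ∃ v, v ≠ 0 ∧ ‖S.latP v‖ ≤ r) :
    ∑ i ∈ Finset.range ⌈a₁ * a₂ * a₁⌉₊, ∑ j ∈ Finset.range ⌈a₁ * a₂ * a₂⌉₊,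
      (S.gridChild a₁ a₂ (by linarith) (by linarith) i j).height (1536 * (a₁ * a₂) ^ 5) ≤
      9 * L ^ 2 * (a₁ * a₂) ^ 2 * S.height (1536 * (a₁ * a₂) ^ 5) := by
  have h₁' : 1 ≤ a₁ := by linarith
  have h₂' : 1 ≤ a₂ := by linarith
  have hb : 1 ≤ a₁ * a₂ := one_le_mul_of_one_le_of_one_le h₁' h₂'
  have hb0 : 0 < a₁ * a₂ := by linarith
  obtain ⟨v₀, hv₀, hmin⟩ := exists_min_of_finite _ S.finite_latP
  set l := ‖S.latP v₀‖ with hl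
  have hl0 : 0 < l := norm_pos_iff.2 (S.latP_ne_zero hv₀)
  have hlr : l ≤ r := by obtain ⟨v, hv, hvr⟩ := hS; exact (hmin v hv).trans hvr
  have hr0 : 0 < r := by linarith
  have hb9 : 1 ≤ (a₁ * a₂) ^ 9 := one_le_pow₀ hb
  have hr1 : r < 1 := by nlinarith
  have hF1 : 1 / l ≤ r * S.heightP := by
    have h := S.inv_sq_le_heightP (S.mem_short.2 ⟨hv₀, by linarith⟩)
    rw [← hl] at h
    calc 1 / l = l * (1 / l ^ 2) := by field_simp
      _ ≤ r * S.heightP := by gcongr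
  have hDpos := S.heightD_nonneg
  have hPpos := S.heightP_nonneg
  set n₁ := ⌈a₁ * a₂ * a₁⌉₊ with hn1
  set n₂ := ⌈a₁ * a₂ * a₂⌉₊ with hn2
  have hb1 : 1 ≤ a₁ * a₂ * a₁ := one_le_mul_of_one_le_of_one_le hb h₁'
  have hb2 : 1 ≤ a₁ * a₂ * a₂ := one_le_mul_of_one_le_of_one_le hb h₂'
  have hnn : (n₁ : ℝ) * n₂ ≤ 4 * (a₁ * a₂) ^ 3 := by
    calc (n₁ : ℝ) * n₂ ≤ (2 * (a₁ * a₂ * a₁)) * (2 * (a₁ * a₂ * a₂)) := by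
          gcongr
          · exact natCeil_le_two_mul hb1
          · exact natCeil_le_two_mul hb2
      _ = _ := by ring
  have hP : ∑ i ∈ Finset.range n₁, ∑ j ∈ Finset.range n₂,
      (S.gridChild a₁ a₂ h₁' h₂' i j).heightP ≤ (a₁ * a₂) ^ 2 * (4 * L ^ 2) * S.heightP +
        4 * (a₁ * a₂) ^ 3 * (4 * (a₁ * a₂) ^ 2 * (6 * (a₁ * a₂) / l + 1536 * (a₁ * a₂) ^ 3 +
        96 * (a₁ * a₂) ^ 2 * S.heightD)) := by
    calc _ ≤ ∑ i ∈ Finset.range n₁, ∑ j ∈ Finset.range n₂, (∑ v ∈ S.short,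
          vecHeight (stepV a₁ a₂ (gridPt (a₁ * a₂ * a₁) i) (gridPt (a₁ * a₂ * a₂) j)
            (S.latP v)) + 4 * (a₁ * a₂) ^ 2 * (6 * (a₁ * a₂) / l + 1536 * (a₁ * a₂) ^ 3 +
            96 * (a₁ * a₂) ^ 2 * S.heightD)) := by
          refine Finset.sum_le_sum fun i hi => Finset.sum_le_sum fun j hj => ?_
          exact S.heightP_child_le h₁ h₂ (abs_gridPt_le hb1 (Finset.mem_range.1 hi))
            (abs_gridPt_le hb2 (Finset.mem_range.1 hj)) v₀ hv₀ (by linarith) hmin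
      _ = ∑ v ∈ S.short, ∑ i ∈ Finset.range n₁, ∑ j ∈ Finset.range n₂,
          vecHeight (stepV a₁ a₂ (gridPt (a₁ * a₂ * a₁) i) (gridPt (a₁ * a₂ * a₂) j)
            (S.latP v)) + (n₁ * n₂) * (4 * (a₁ * a₂) ^ 2 * (6 * (a₁ * a₂) / l +
              1536 * (a₁ * a₂) ^ 3 + 96 * (a₁ * a₂) ^ 2 * S.heightD)) := by
          simp only [Finset.sum_add_distrib, Finset.sum_const, Finset.card_range, nsmul_eq_mul]
          congr 1
          · rw [Finset.sum_comm]
            simp_rw [Finset.sum_comm (s := Finset.range n₂)]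
            rw [Finset.sum_comm]
          · ring
      _ ≤ _ := by
          apply add_le_add
          · rw [heightP, Finset.mul_sum]
            exact Finset.sum_le_sum fun v hv => S.sum_vecHeight_le h₁' h₂' hL2 hLa hLb hv
          · gcongr
  have hD : ∑ i ∈ Finset.range n₁, ∑ j ∈ Finset.range n₂,
      (S.gridChild a₁ a₂ h₁' h₂' i j).heightD ≤ (a₁ * a₂) ^ 2 * (8 * L) * S.heightD +
        4 * (a₁ * a₂) ^ 3 * (3 * (a₁ * a₂) * (1 + 2 / l)) := by
    calc _ ≤ ∑ i ∈ Finset.range n₁, ∑ j ∈ Finset.range n₂,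
          (1 / ‖stepD a₁ a₂ (gridPt (a₁ * a₂ * a₁) i) (gridPt (a₁ * a₂ * a₂) j)
            (S.latD S.minD)‖ + 3 * (a₁ * a₂) * (1 + 2 / l)) := by
          refine Finset.sum_le_sum fun i hi => Finset.sum_le_sum fun j hj => ?_
          exact S.heightD_child_le h₁' h₂' (abs_gridPt_le hb1 (Finset.mem_range.1 hi))
            (abs_gridPt_le hb2 (Finset.mem_range.1 hj)) hl0 hmin
      _ = ∑ i ∈ Finset.range n₁, ∑ j ∈ Finset.range n₂,
          1 / ‖stepD a₁ a₂ (gridPt (a₁ * a₂ * a₁) i) (gridPt (a₁ * a₂ * a₂) j)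
            (S.latD S.minD)‖ + (n₁ * n₂) * (3 * (a₁ * a₂) * (1 + 2 / l)) := by
          simp only [Finset.sum_add_distrib, Finset.sum_const, Finset.card_range, nsmul_eq_mul]
          ring
      _ ≤ _ := by
          apply add_le_add
          · refine (sum_grid_dual h₁' h₂' (by linarith) hLa hLb
              (S.latD_ne_zero S.minD_ne_zero)).trans (le_of_eq ?_)
            rw [heightD]; ring
          · gcongr
  simp only [height, Finset.sum_add_distrib, ← Finset.mul_sum]
  set b := a₁ * a₂ with hbdef
  have hil : 1 ≤ 1 / l := by rw [le_div_iff₀ hl0]; linarith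
  have hP' : b ^ 2 * (4 * L ^ 2) * S.heightP + 4 * b ^ 3 * (4 * b ^ 2 * (6 * b / l +
      1536 * b ^ 3 + 96 * b ^ 2 * S.heightD)) ≤ b ^ 2 * (4 * L ^ 2) * S.heightP +
      24672 * b ^ 9 * (r * S.heightP) + 1536 * b ^ 7 * S.heightD := by
    have k1 : 6 * b / l + 1536 * b ^ 3 ≤ 1542 * b ^ 4 * (r * S.heightP) := by
      have e1 : 6 * b / l ≤ 6 * b ^ 4 * (1 / l) := by
        have : b ≤ b ^ 4 := le_self_pow₀ hb (by norm_num)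
        calc 6 * b / l = 6 * b * (1 / l) := by ring
          _ ≤ _ := by gcongr
      have e2 : 1536 * b ^ 3 ≤ 1536 * b ^ 4 * (1 / l) := by
        have : b ^ 3 ≤ b ^ 4 := pow_le_pow_right₀ hb (by norm_num)
        have : 1536 * b ^ 4 * 1 ≤ 1536 * b ^ 4 * (1 / l) := by gcongr
        linarith
      have e3 : 1542 * b ^ 4 * (1 / l) ≤ 1542 * b ^ 4 * (r * S.heightP) := by gcongr
      linarith
    have k2 : 16 * b ^ 5 * (6 * b / l + 1536 * b ^ 3) ≤
        16 * b ^ 5 * (1542 * b ^ 4 * (r * S.heightP)) := by gcongr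
    linarith
  have hD' : b ^ 2 * (8 * L) * S.heightD + 4 * b ^ 3 * (3 * b * (1 + 2 / l)) ≤
      b ^ 2 * (8 * L) * S.heightD + 36 * b ^ 4 * (r * S.heightP) := by
    have e1 : 1 + 2 / l ≤ 3 * (r * S.heightP) := by
      rw [div_eq_mul_one_div]; linarith
    have : 12 * b ^ 4 * (1 + 2 / l) ≤ 12 * b ^ 4 * (3 * (r * S.heightP)) := by gcongr
    linarith
  have hsum := mul_le_mul_of_nonneg_left (hD.trans hD') (show 0 ≤ 1536 * b ^ 5 by positivity)
  have hPs := hP.trans hP'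
  have hF : 80000 * b ^ 9 * (r * S.heightP) ≤ S.heightP := by
    calc _ = (80000 * b ^ 9 * r) * S.heightP := by ring
      _ ≤ 1 * S.heightP := by gcongr
      _ = _ := one_mul _
  have hF2 : 0 ≤ b ^ 9 * (r * S.heightP) := by positivity
  have hb2' : 1 ≤ b ^ 2 := one_le_pow₀ hb
  have f1 : (b ^ 2 * (4 * L ^ 2) + 1) * S.heightP ≤ 9 * L ^ 2 * b ^ 2 * S.heightP := by
    gcongr
    nlinarith [mul_nonneg (sub_nonneg.2 hb2') (sq_nonneg L)]
  have f2 : (1536 * b ^ 7 * (1 + 8 * L)) * S.heightD ≤ 1536 * b ^ 7 * (9 * L ^ 2) * S.heightD := by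
    gcongr
    nlinarith
  nlinarith

lemma norm_latP_le_of_near {ξ : ℝ × ℝ} {v : ℤ × ℤ × ℤ} {r : ℝ}
    (h1 : |S.α * (v.1 - v.2.2 * ξ.1)| ≤ r) (h2 : |S.β * (v.2.1 - v.2.2 * ξ.2)| ≤ r)
    (h3 : |S.γ * v.2.2| ≤ r) (hx : |ξ.1 - S.x| ≤ S.γ / S.α / 2)
    (hy : |ξ.2 - S.y| ≤ S.γ / S.β / 2) : ‖S.latP v‖ ≤ 2 * r := by
  have ha := S.α_pos
  have hb := S.β_pos
  have hg := S.γ_pos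
  have key : ∀ (c p q u z : ℝ), 0 < c → |c * (p - q * u)| ≤ r → |S.γ * q| ≤ r →
      |u - z| ≤ S.γ / c / 2 → |c * (p - q * z)| ≤ 2 * r := by
    intro c p q u z hc e1 e2 e3
    have e4 : c * (p - q * z) = c * (p - q * u) + c * q * (u - z) := by ring
    have e5 : |c * q * (u - z)| ≤ |S.γ * q| / 2 := by
      rw [abs_mul, abs_mul, abs_mul, abs_of_pos hc, abs_of_pos hg]
      calc _ ≤ c * |q| * (S.γ / c / 2) := by gcongr
        _ = _ := by field_simp
    rw [e4]
    have := abs_add_le (c * (p - q * u)) (c * q * (u - z))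
    linarith [abs_nonneg (S.γ * q)]
  have := abs_nonneg (S.γ * v.2.2)
  exact triple_norm_le.2 ⟨key _ _ _ _ _ ha h1 h3 hx, key _ _ _ _ _ hb h2 h3 hy,
    h3.trans (by linarith)⟩

/-- Covering of the points which see a very short vector at every scale. -/
lemma exists_cover {a₁ a₂ L r : ℝ} (h₁ : 2 ≤ a₁) (h₂ : 2 ≤ a₂) (hL2 : 2 ≤ L)
    (hLa : ∀ z : ℝ, ∑ i ∈ Finset.range ⌈a₁ * a₂ * a₁⌉₊, 1 / max 1 |z - i| ≤ L)
    (hLb : ∀ z : ℝ, ∑ i ∈ Finset.range ⌈a₁ * a₂ * a₂⌉₊, 1 / max 1 |z - i| ≤ L)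
    (hr : 80000 * (a₁ * a₂) ^ 9 * (2 * r) ≤ 1) (E : Set (ℝ × ℝ)) (n : ℕ) :
    ∀ S : BoxState, (∀ m : ℕ, ∀ ξ ∈ E, ∃ v : ℤ × ℤ × ℤ, v ≠ 0 ∧
      |a₁ ^ m * S.α * (v.1 - v.2.2 * ξ.1)| ≤ r ∧ |a₂ ^ m * S.β * (v.2.1 - v.2.2 * ξ.2)| ≤ r ∧
      |S.γ / (a₁ * a₂) ^ m * v.2.2| ≤ r) →
    ∃ F : Finset (ℝ × ℝ), (F.card : ℝ) ≤
      (9 * L ^ 2 * (a₁ * a₂) ^ 2) ^ n * S.height (1536 * (a₁ * a₂) ^ 5) ∧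
      ∀ ξ ∈ E, |ξ.1 - S.x| ≤ S.γ / S.α / 2 → |ξ.2 - S.y| ≤ S.γ / S.β / 2 →
        ∃ c ∈ F, |ξ.1 - c.1| ≤ S.γ / S.α / 2 / (a₁ * a₂ * a₁) ^ n ∧
          |ξ.2 - c.2| ≤ S.γ / S.β / 2 / (a₁ * a₂ * a₂) ^ n := by
  classical
  have h₁' : 1 ≤ a₁ := by linarith
  have h₂' : 1 ≤ a₂ := by linarith
  have ha1 : 0 < a₁ := by linarith
  have ha2 : 0 < a₂ := by linarith
  have hb : 1 ≤ a₁ * a₂ := one_le_mul_of_one_le_of_one_le h₁' h₂'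
  have hb0 : 0 < a₁ * a₂ := by linarith
  have hb1 : 1 ≤ a₁ * a₂ * a₁ := one_le_mul_of_one_le_of_one_le hb h₁'
  have hb2 : 1 ≤ a₁ * a₂ * a₂ := one_le_mul_of_one_le_of_one_le hb h₂'
  have hM : 0 ≤ 1536 * (a₁ * a₂) ^ 5 := by positivity
  have hK : 0 ≤ 9 * L ^ 2 * (a₁ * a₂) ^ 2 := by positivity
  have halive : ∀ S : BoxState, (∀ m : ℕ, ∀ ξ ∈ E, ∃ v : ℤ × ℤ × ℤ, v ≠ 0 ∧
      |a₁ ^ m * S.α * (v.1 - v.2.2 * ξ.1)| ≤ r ∧ |a₂ ^ m * S.β * (v.2.1 - v.2.2 * ξ.2)| ≤ r ∧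
      |S.γ / (a₁ * a₂) ^ m * v.2.2| ≤ r) →
      (∃ ξ ∈ E, |ξ.1 - S.x| ≤ S.γ / S.α / 2 ∧ |ξ.2 - S.y| ≤ S.γ / S.β / 2) →
      ∃ v, v ≠ 0 ∧ ‖S.latP v‖ ≤ 2 * r := by
    rintro S hE ⟨ξ, hξ, hx, hy⟩
    obtain ⟨v, hv0, g1, g2, g3⟩ := hE 0 ξ hξ
    simp only [pow_zero, one_mul, div_one] at g1 g2 g3
    exact ⟨v, hv0, S.norm_latP_le_of_near g1 g2 g3 hx hy⟩
  induction n with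
  | zero =>
    intro S hE
    by_cases hne : ∃ ξ ∈ E, |ξ.1 - S.x| ≤ S.γ / S.α / 2 ∧ |ξ.2 - S.y| ≤ S.γ / S.β / 2
    · obtain ⟨v, hv0, hv⟩ := halive S hE hne
      have hb9 : 1 ≤ (a₁ * a₂) ^ 9 := one_le_pow₀ hb
      have hpos : 0 < ‖S.latP v‖ := norm_pos_iff.2 (S.latP_ne_zero hv0)
      have hr1 : 2 * r < 1 := by nlinarith
      refine ⟨{(S.x, S.y)}, ?_, fun ξ _ h1 h2 => ⟨(S.x, S.y), by simp, by simpa using h1,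
        by simpa using h2⟩⟩
      have h1 := S.inv_sq_le_heightP (S.mem_short.2 ⟨hv0, by linarith⟩)
      have h2 : 1 ≤ 1 / ‖S.latP v‖ ^ 2 := by
        rw [le_div_iff₀ (by positivity), one_mul]
        exact pow_le_one₀ hpos.le (by linarith)
      simp only [Finset.card_singleton, Nat.cast_one, pow_zero, one_mul, height]
      linarith [mul_nonneg hM S.heightD_nonneg]
    · refine ⟨∅, by simpa using S.height_nonneg hM, fun ξ h h1 h2 => (hne ⟨ξ, h, h1, h2⟩).elim⟩
  | succ n ih =>
    intro S hE
    by_cases hne : ∃ ξ ∈ E, |ξ.1 - S.x| ≤ S.γ / S.α / 2 ∧ |ξ.2 - S.y| ≤ S.γ / S.β / 2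
    · have hsum := S.sum_height_child_le h₁ h₂ hL2 hLa hLb hr (halive S hE hne)
      have hch : ∀ i j, ∃ F : Finset (ℝ × ℝ), (F.card : ℝ) ≤ (9 * L ^ 2 * (a₁ * a₂) ^ 2) ^ n *
          (S.gridChild a₁ a₂ h₁' h₂' i j).height (1536 * (a₁ * a₂) ^ 5) ∧
          ∀ ξ ∈ E, |ξ.1 - (S.gridChild a₁ a₂ h₁' h₂' i j).x| ≤
            S.γ / S.α / 2 / (a₁ * a₂ * a₁) →
            |ξ.2 - (S.gridChild a₁ a₂ h₁' h₂' i j).y| ≤ S.γ / S.β / 2 / (a₁ * a₂ * a₂) →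
            ∃ c ∈ F, |ξ.1 - c.1| ≤ S.γ / S.α / 2 / (a₁ * a₂ * a₁) ^ (n + 1) ∧
              |ξ.2 - c.2| ≤ S.γ / S.β / 2 / (a₁ * a₂ * a₂) ^ (n + 1) := by
        intro i j
        have eα : (S.gridChild a₁ a₂ h₁' h₂' i j).α = a₁ * S.α := rfl
        have eβ : (S.gridChild a₁ a₂ h₁' h₂' i j).β = a₂ * S.β := rfl
        have eγ : (S.gridChild a₁ a₂ h₁' h₂' i j).γ = S.γ / (a₁ * a₂) := rfl
        obtain ⟨F, hF, hcov⟩ := ih (S.gridChild a₁ a₂ h₁' h₂' i j) (by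
          intro m ξ hξ
          obtain ⟨v, hv, g1, g2, g3⟩ := hE (m + 1) ξ hξ
          refine ⟨v, hv, ?_, ?_, ?_⟩
          · rw [eα, ← mul_assoc, ← pow_succ]; exact g1
          · rw [eβ, ← mul_assoc, ← pow_succ]; exact g2
          · rw [eγ, div_div, ← pow_succ']; exact g3)
        rw [eα, eβ, eγ] at hcov
        have q1 : S.γ / (a₁ * a₂) / (a₁ * S.α) / 2 = S.γ / S.α / 2 / (a₁ * a₂ * a₁) := by ring
        have q2 : S.γ / (a₁ * a₂) / (a₂ * S.β) / 2 = S.γ / S.β / 2 / (a₁ * a₂ * a₂) := by ring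
        rw [q1, q2, div_div _ _ (_ ^ n), div_div _ _ (_ ^ n), ← pow_succ', ← pow_succ'] at hcov
        exact ⟨F, hF, hcov⟩
      choose F hF hcov using hch
      refine ⟨(Finset.range ⌈a₁ * a₂ * a₁⌉₊).biUnion fun i =>
        (Finset.range ⌈a₁ * a₂ * a₂⌉₊).biUnion fun j => F i j, ?_, ?_⟩
      · calc _ ≤ ∑ i ∈ Finset.range ⌈a₁ * a₂ * a₁⌉₊, ∑ j ∈ Finset.range ⌈a₁ * a₂ * a₂⌉₊,
              ((F i j).card : ℝ) := by
              exact_mod_cast Finset.card_biUnion_le.trans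
                (Finset.sum_le_sum fun i _ => Finset.card_biUnion_le)
          _ ≤ ∑ i ∈ Finset.range ⌈a₁ * a₂ * a₁⌉₊, ∑ j ∈ Finset.range ⌈a₁ * a₂ * a₂⌉₊,
              (9 * L ^ 2 * (a₁ * a₂) ^ 2) ^ n *
              (S.gridChild a₁ a₂ h₁' h₂' i j).height (1536 * (a₁ * a₂) ^ 5) :=
              Finset.sum_le_sum fun i _ => Finset.sum_le_sum fun j _ => hF i j
          _ ≤ (9 * L ^ 2 * (a₁ * a₂) ^ 2) ^ n * (9 * L ^ 2 * (a₁ * a₂) ^ 2 *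
              S.height (1536 * (a₁ * a₂) ^ 5)) := by
              simp only [← Finset.mul_sum]
              gcongr
          _ = _ := by ring
      · intro ξ hξ hx hy
        have key : ∀ (c u z m : ℝ), 0 < c → 1 ≤ m → |u - z| ≤ S.γ / c / 2 →
            ∃ i < ⌈m⌉₊, |u - (z + gridPt m i * (S.γ / c))| ≤ S.γ / c / 2 / m := by
          intro c u z m hc hm hu
          have hgc : 0 < S.γ / c := div_pos S.γ_pos hc
          obtain ⟨i, hi, hi'⟩ := exists_gridPt_near hm (t := (u - z) / (S.γ / c)) (by
            rw [abs_div, abs_of_pos hgc, div_le_iff₀ hgc]; linarith)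
          refine ⟨i, hi, ?_⟩
          have e : u - (z + gridPt m i * (S.γ / c)) =
              (S.γ / c) * ((u - z) / (S.γ / c) - gridPt m i) := by
            rw [mul_sub, mul_div_cancel₀ _ hgc.ne']; ring
          rw [e, abs_mul, abs_of_pos hgc]
          calc _ ≤ (S.γ / c) * (1 / (2 * m)) := by gcongr
            _ = _ := by ring
        obtain ⟨i, hi, hi'⟩ := key _ _ _ _ S.α_pos hb1 hx
        obtain ⟨j, hj, hj'⟩ := key _ _ _ _ S.β_pos hb2 hy
        obtain ⟨c, hc, hc'⟩ := hcov i j ξ hξ hi' hj'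
        exact ⟨c, Finset.mem_biUnion.2 ⟨i, Finset.mem_range.2 hi,
          Finset.mem_biUnion.2 ⟨j, Finset.mem_range.2 hj, hc⟩⟩, hc'⟩
    · refine ⟨∅, by simpa using mul_nonneg (pow_nonneg hK _) (S.height_nonneg hM),
        fun ξ h h1 h2 => (hne ⟨ξ, h, h1, h2⟩).elim⟩

end BoxState

open Filter Topology in
/-- An upper bound for the Hausdorff dimension from a sequence of finite covers by balls. -/
lemma dimH_le_of_covers {X : Type*} [MetricSpace X] {E : Set X} {σ : ℝ} (hσ : 0 ≤ σ) (K : ℝ)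
    (s : ℕ → ℝ) (hs0 : ∀ n, 0 ≤ s n) (hs : Tendsto s atTop (𝓝 0))
    (h : ∀ n, ∃ F : Finset X, (F.card : ℝ) * (2 * s n) ^ σ ≤ K ∧
      E ⊆ ⋃ c ∈ F, Metric.closedBall c (s n)) :
    dimH E ≤ ENNReal.ofReal σ := by
  borelize X
  choose F hF hcov using h
  have hdiam : ∀ (n : ℕ) (c : X), Metric.ediam (Metric.closedBall c (s n)) ≤
      ENNReal.ofReal (2 * s n) := by
    intro n c
    refine Metric.ediam_le_of_forall_dist_le fun x hx y hy => ?_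
    have := dist_triangle_right x y c
    rw [Metric.mem_closedBall] at hx hy
    linarith
  have key := Measure.hausdorffMeasure_le_liminf_sum (β := ℕ) (ι := fun n => F n) σ E
    (l := atTop) (fun n => ENNReal.ofReal (2 * s n)) (by
      rw [← ENNReal.ofReal_zero]
      apply ENNReal.tendsto_ofReal
      simpa using hs.const_mul 2) (fun n c => Metric.closedBall (c : X) (s n))
    (Eventually.of_forall fun n c => hdiam n c)
    (Eventually.of_forall fun n => (hcov n).trans (by
      simp only [Set.iUnion_subset_iff]
      intro c hc
      exact Set.subset_iUnion (fun c : F n => Metric.closedBall (c : X) (s n)) ⟨c, hc⟩))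
  have hle : Measure.hausdorffMeasure σ E ≤ ENNReal.ofReal K := by
    refine key.trans ?_
    refine (liminf_le_liminf (Eventually.of_forall fun n => ?_)).trans_eq (liminf_const _)
    calc _ ≤ ∑ _c : F n, ENNReal.ofReal ((2 * s n) ^ σ) := by
          refine Finset.sum_le_sum fun c _ => ?_
          rw [← ENNReal.ofReal_rpow_of_nonneg (by linarith [hs0 n]) hσ]
          exact ENNReal.rpow_le_rpow (hdiam n c) hσ
      _ = ENNReal.ofReal ((F n).card * (2 * s n) ^ σ) := by
          rw [Finset.sum_const, nsmul_eq_mul, ENNReal.ofReal_mul (by positivity)]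
          simp
      _ ≤ _ := ENNReal.ofReal_le_ofReal (hF n)
  have : dimH E ≤ (σ.toNNReal : ENNReal) := by
    apply dimH_le_of_hausdorffMeasure_ne_top
    rw [Real.coe_toNNReal _ hσ]
    exact ne_top_of_le_ne_top ENNReal.ofReal_ne_top hle
  exact this

namespace BoxState

/-- Subdividing a rectangle into squares. -/
lemma exists_square_cover {E : Set (ℝ × ℝ)} {h k : ℝ} (hh : 0 < h) (hk : h ≤ k)
    (F : Finset (ℝ × ℝ)) (hF : ∀ ξ ∈ E, ∃ c ∈ F, |ξ.1 - c.1| ≤ h ∧ |ξ.2 - c.2| ≤ k) :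
    ∃ F' : Finset (ℝ × ℝ), (F'.card : ℝ) ≤ F.card * (2 * (k / h)) ∧
      E ⊆ ⋃ c ∈ F', Metric.closedBall c h := by
  classical
  have hm : 1 ≤ k / h := (one_le_div hh).2 hk
  have hk0 : 0 < k := by linarith
  refine ⟨F.biUnion fun c => (Finset.range ⌈k / h⌉₊).image fun i =>
    (c.1, c.2 + gridPt (k / h) i * (2 * k)), ?_, ?_⟩
  · calc _ ≤ ∑ c ∈ F, (⌈k / h⌉₊ : ℝ) := by
          refine le_trans (Nat.cast_le.2 Finset.card_biUnion_le) ?_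
          push_cast
          refine Finset.sum_le_sum fun c _ => ?_
          exact_mod_cast Finset.card_image_le.trans (Finset.card_range _).le
      _ = F.card * ⌈k / h⌉₊ := by rw [Finset.sum_const, nsmul_eq_mul]
      _ ≤ _ := by gcongr; exact natCeil_le_two_mul hm
  · intro ξ hξ
    obtain ⟨c, hc, h1, h2⟩ := hF ξ hξ
    obtain ⟨i, hi, hi'⟩ := exists_gridPt_near hm (t := (ξ.2 - c.2) / (2 * k)) (by
      rw [abs_div, abs_of_pos (by positivity : 0 < 2 * k), div_le_iff₀ (by positivity)]; linarith)
    simp only [Set.mem_iUnion, exists_prop]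
    refine ⟨_, Finset.mem_biUnion.2 ⟨c, hc, Finset.mem_image.2 ⟨i, Finset.mem_range.2 hi, rfl⟩⟩, ?_⟩
    rw [Metric.mem_closedBall, Prod.dist_eq, max_le_iff]
    refine ⟨h1, ?_⟩
    have e : ξ.2 - (c.2 + gridPt (k / h) i * (2 * k)) =
        (2 * k) * ((ξ.2 - c.2) / (2 * k) - gridPt (k / h) i) := by
      rw [mul_sub, mul_div_cancel₀ _ (by positivity)]; ring
    rw [Real.dist_eq]
    simp only
    rw [e, abs_mul, abs_of_pos (by positivity : 0 < 2 * k)]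
    calc _ ≤ 2 * k * (1 / (2 * (k / h))) := by gcongr
      _ = h := by field_simp

lemma dimH_box_le {a₁ a₂ L r σ : ℝ} (h₁ : 2 ≤ a₁) (h₂ : 2 ≤ a₂) (hL2 : 2 ≤ L) (hσ : 0 ≤ σ)
    (hLa : ∀ z : ℝ, ∑ i ∈ Finset.range ⌈a₁ * a₂ * a₁⌉₊, 1 / max 1 |z - i| ≤ L)
    (hLb : ∀ z : ℝ, ∑ i ∈ Finset.range ⌈a₁ * a₂ * a₂⌉₊, 1 / max 1 |z - i| ≤ L)
    (hr : 80000 * (a₁ * a₂) ^ 9 * (2 * r) ≤ 1) (ha : a₂ ≤ a₁)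
    (hgrow : 9 * L ^ 2 * (a₁ * a₂) ^ 2 * (a₁ / a₂) ≤ (a₁ * a₂ * a₁) ^ σ)
    (E : Set (ℝ × ℝ)) (S : BoxState) (hS : S.β ≤ S.α)
    (hE : ∀ m : ℕ, ∀ ξ ∈ E, ∃ v : ℤ × ℤ × ℤ, v ≠ 0 ∧
      |a₁ ^ m * S.α * (v.1 - v.2.2 * ξ.1)| ≤ r ∧ |a₂ ^ m * S.β * (v.2.1 - v.2.2 * ξ.2)| ≤ r ∧
      |S.γ / (a₁ * a₂) ^ m * v.2.2| ≤ r) :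
    dimH {ξ ∈ E | |ξ.1 - S.x| ≤ S.γ / S.α / 2 ∧ |ξ.2 - S.y| ≤ S.γ / S.β / 2} ≤
      ENNReal.ofReal σ := by
  have hα := S.α_pos
  have hβ := S.β_pos
  have hγ := S.γ_pos
  have ha1 : 0 < a₁ := by linarith
  have ha2 : 0 < a₂ := by linarith
  have hb4 : 4 ≤ a₁ * a₂ := by nlinarith
  have hm1 : 1 < a₁ * a₂ * a₁ := by nlinarith
  have hm2 : 1 ≤ a₁ * a₂ * a₂ := by nlinarith
  have hm0 : 0 < a₁ * a₂ * a₁ := by linarith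
  have hM : 0 ≤ 1536 * (a₁ * a₂) ^ 5 := by positivity
  have hG := S.height_nonneg hM
  set G := S.height (1536 * (a₁ * a₂) ^ 5)
  refine dimH_le_of_covers hσ (G * (2 * (S.α / S.β)) * (S.γ / S.α) ^ σ)
    (fun n => S.γ / S.α / 2 / (a₁ * a₂ * a₁) ^ n) (fun n => by positivity) ?_ fun n => ?_
  · simp only [div_eq_mul_inv _ ((a₁ * a₂ * a₁) ^ _), ← inv_pow]
    rw [← mul_zero (S.γ / S.α / 2)]
    exact (tendsto_pow_atTop_nhds_zero_of_lt_one (by positivity)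
      (inv_lt_one_of_one_lt₀ hm1)).const_mul _
  obtain ⟨F, hFc, hF⟩ := exists_cover h₁ h₂ hL2 hLa hLb hr E n S hE
  have hle : S.γ / S.α / 2 / (a₁ * a₂ * a₁) ^ n ≤ S.γ / S.β / 2 / (a₁ * a₂ * a₂) ^ n := by
    gcongr
  obtain ⟨F', hF'c, hF'⟩ := exists_square_cover
    (E := {ξ ∈ E | |ξ.1 - S.x| ≤ S.γ / S.α / 2 ∧ |ξ.2 - S.y| ≤ S.γ / S.β / 2})
    (by positivity) hle F (fun ξ hξ => hF ξ hξ.1 hξ.2.1 hξ.2.2)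
  refine ⟨F', ?_, hF'⟩
  have e1 : S.γ / S.β / 2 / (a₁ * a₂ * a₂) ^ n / (S.γ / S.α / 2 / (a₁ * a₂ * a₁) ^ n) =
      (S.α / S.β) * (a₁ / a₂) ^ n := by
    rw [div_pow, mul_pow, mul_pow _ a₁]
    field_simp
  have e2 : (2 * (S.γ / S.α / 2 / (a₁ * a₂ * a₁) ^ n)) ^ σ =
      (S.γ / S.α) ^ σ / ((a₁ * a₂ * a₁) ^ σ) ^ n := by
    have : 2 * (S.γ / S.α / 2 / (a₁ * a₂ * a₁) ^ n) = (S.γ / S.α) / (a₁ * a₂ * a₁) ^ n := by ring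
    rw [this, Real.div_rpow (by positivity) (by positivity), ← Real.rpow_natCast,
      ← Real.rpow_mul hm0.le, mul_comm (n : ℝ) σ, Real.rpow_mul hm0.le, Real.rpow_natCast]
  rw [e1] at hF'c
  rw [e2]
  have hp : 0 < (a₁ * a₂ * a₁) ^ σ := Real.rpow_pos_of_pos hm0 _
  calc _ ≤ ((9 * L ^ 2 * (a₁ * a₂) ^ 2) ^ n * G * (2 * ((S.α / S.β) * (a₁ / a₂) ^ n))) *
        ((S.γ / S.α) ^ σ / ((a₁ * a₂ * a₁) ^ σ) ^ n) := by
        gcongr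
        exact hF'c.trans (by gcongr)
    _ = G * (2 * (S.α / S.β)) * (S.γ / S.α) ^ σ *
        ((9 * L ^ 2 * (a₁ * a₂) ^ 2 * (a₁ / a₂)) / (a₁ * a₂ * a₁) ^ σ) ^ n := by
        rw [div_pow _ ((a₁ * a₂ * a₁) ^ σ), mul_pow _ (a₁ / a₂)]; ring
    _ ≤ G * (2 * (S.α / S.β)) * (S.γ / S.α) ^ σ * 1 := by
        gcongr
        exact pow_le_one₀ (by positivity) ((div_le_one hp).2 hgrow)
    _ = _ := mul_one _

end BoxState

/-- The points of the plane whose lattice trajectory has a vector of norm at most `r` at every time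
after `N`. -/
def escaping (w₁ w₂ r N : ℝ) : Set (ℝ × ℝ) :=
  {ξ | ∀ T : ℝ, N ≤ T → ∃ v : ℤ × ℤ × ℤ, v ≠ 0 ∧ |T ^ w₁ * (v.1 - v.2.2 * ξ.1)| ≤ r ∧
    |T ^ w₂ * (v.2.1 - v.2.2 * ξ.2)| ≤ r ∧ |1 / T * v.2.2| ≤ r}

/-- The standard identification of the Euclidean plane with a product. -/
noncomputable def planeEquiv : EuclideanSpace ℝ (Fin 2) ≃L[ℝ] ℝ × ℝ :=
  (EuclideanSpace.equiv (Fin 2) ℝ).trans (ContinuousLinearEquiv.finTwoArrow ℝ ℝ)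

lemma planeEquiv_apply (x : EuclideanSpace ℝ (Fin 2)) : planeEquiv x = (x 0, x 1) := rfl

lemma image_sing_subset {w₁ w₂ r : ℝ} (hw₂ : 0 < w₂) (hw : w₂ ≤ w₁) (hr : 0 < r) (hr1 : r ≤ 1) :
    planeEquiv '' Sing w₁ w₂ ⊆ ⋃ N : ℕ, escaping w₁ w₂ r (N + 1) := by
  rintro _ ⟨x, hx, rfl⟩
  rw [planeEquiv_apply]
  set t : ℝ := r ^ (1 / w₂) with ht
  have ht0 : 0 < t := Real.rpow_pos_of_pos hr _
  have ht1 : t ≤ 1 := Real.rpow_le_one hr.le hr1 (by positivity)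
  have htw : t ^ w₂ = r := by
    rw [ht, ← Real.rpow_mul hr.le, one_div_mul_cancel hw₂.ne', Real.rpow_one]
  have htw1 : t ^ w₁ ≤ r := htw ▸ Real.rpow_le_rpow_of_exponent_ge ht0 ht1 hw
  obtain ⟨T₀, hT₀, h⟩ := hx (t * r) (by positivity)
  rw [Set.mem_iUnion]
  obtain ⟨N, hN⟩ := exists_nat_ge (T₀ / r)
  refine ⟨N, fun T hT => ?_⟩
  have hT0 : 0 < T := by have : (0 : ℝ) ≤ N := N.cast_nonneg; linarith
  have hrT : T₀ < r * T := by
    rw [div_le_iff₀ hr] at hN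
    nlinarith
  obtain ⟨p₁, p₂, q, h1, h2, hq, hqT⟩ := h _ hrT
  have key : ∀ w A : ℝ, |A| < (t * r) ^ w * (r * T) ^ (-w) → |T ^ w * A| ≤ t ^ w := by
    intro w A hA
    have hTw := Real.rpow_pos_of_pos hT0 w
    have hrw := Real.rpow_pos_of_pos hr w
    rw [abs_mul, abs_of_pos hTw]
    calc T ^ w * |A| ≤ T ^ w * ((t * r) ^ w * (r * T) ^ (-w)) := by gcongr
      _ = t ^ w := by
        rw [Real.mul_rpow ht0.le hr.le, Real.rpow_neg (by positivity), Real.mul_rpow hr.le hT0.le]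
        field_simp
  refine ⟨(p₁, p₂, q), fun h0 => ?_, ?_, ?_, ?_⟩
  · simp only [Prod.mk_eq_zero] at h0
    omega
  · refine (key w₁ _ ?_).trans htw1
    rwa [abs_sub_comm]
  · refine (key w₂ _ ?_).trans htw.le
    rwa [abs_sub_comm]
  · have : (0 : ℝ) < q := by exact_mod_cast hq
    simp only
    rw [abs_of_pos (by positivity), one_div_mul_eq_div, div_le_iff₀ hT0]
    exact hqT.le

lemma exists_int_near {s : ℝ} (hs : 0 < s) (x : ℝ) : ∃ i : ℤ, |x - i * s| ≤ s / 2 := by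
  refine ⟨round (x / s), ?_⟩
  have := abs_sub_round (x / s)
  calc |x - round (x / s) * s| = |x / s - round (x / s)| * s := by
        rw [← abs_of_pos hs, ← abs_mul, abs_of_pos hs, sub_mul, div_mul_cancel₀ _ hs.ne']
    _ ≤ 1 / 2 * s := by gcongr
    _ = s / 2 := by ring

/-- The scale factors used in the covering argument. -/
lemma exists_scale {w₁ w₂ σ : ℝ} (hw₂ : 0 < w₂) (hw : w₂ ≤ w₁) (hsum : w₁ + w₂ = 1)
    (hσ : 1 + 2 * w₁ < (1 + w₁) * σ) :
    ∃ b L : ℝ, 1 ≤ b ∧ 2 ≤ b ^ w₁ ∧ 2 ≤ b ^ w₂ ∧ 2 ≤ L ∧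
      (∀ z : ℝ, ∑ i ∈ Finset.range ⌈b * b ^ w₁⌉₊, 1 / max 1 |z - i| ≤ L) ∧
      (∀ z : ℝ, ∑ i ∈ Finset.range ⌈b * b ^ w₂⌉₊, 1 / max 1 |z - i| ≤ L) ∧
      9 * L ^ 2 * b ^ 2 * (b ^ w₁ / b ^ w₂) ≤ (b * b ^ w₁) ^ σ := by
  set δ := (1 + w₁) * σ - (1 + 2 * w₁) with hδ
  have hδ0 : 0 < δ := by linarith
  set u := max 1 (max (31104 / δ ^ 3) (1 / w₂)) with hu
  have hu1 : 1 ≤ u := le_max_left _ _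
  have hu2 : 31104 / δ ^ 3 ≤ u := (le_max_left _ _).trans (le_max_right _ _)
  have hu3 : 1 / w₂ ≤ u := (le_max_right _ _).trans (le_max_right _ _)
  rw [div_le_iff₀ (by positivity)] at hu2
  rw [div_le_iff₀ (by positivity)] at hu3
  have hpow : ∀ w : ℝ, Real.exp u ^ w = Real.exp (u * w) := fun w => (Real.exp_mul u w).symm
  have hexp : ∀ z : ℝ, 1 ≤ z → 2 ≤ Real.exp z := fun z hz => by
    linarith [Real.add_one_le_exp z]
  have hsumle : ∀ w : ℝ, 0 ≤ w → w ≤ 1 → ∀ z : ℝ,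
      ∑ i ∈ Finset.range ⌈Real.exp u * Real.exp (u * w)⌉₊, 1 / max 1 |z - i| ≤ 24 * u := by
    intro w hw0 hw1 z
    refine (sum_inv_max_le _ z).trans ?_
    have hle : Real.exp u * Real.exp (u * w) ≤ Real.exp (2 * u) := by
      rw [← Real.exp_add, Real.exp_le_exp]
      nlinarith
    have h1 : 1 ≤ Real.exp u * Real.exp (u * w) := by
      rw [← Real.exp_add, Real.one_le_exp_iff]
      positivity
    have hlog : Real.log ⌈Real.exp u * Real.exp (u * w)⌉₊ ≤ 1 + 2 * u := by
      rw [← Real.log_exp (1 + 2 * u)]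
      refine Real.log_le_log (Nat.cast_pos.2 (Nat.ceil_pos.2 (by positivity))) ?_
      refine (natCeil_le_two_mul h1).trans ?_
      rw [Real.exp_add]
      have := hexp 1 le_rfl
      gcongr
    linarith
  refine ⟨Real.exp u, 24 * u, Real.one_le_exp (by linarith), ?_, ?_, by linarith, ?_, ?_, ?_⟩
  · rw [hpow]; exact hexp _ (by nlinarith)
  · rw [hpow]; exact hexp _ hu3
  · rw [hpow]; exact hsumle w₁ (by linarith) (by linarith)
  · rw [hpow]; exact hsumle w₂ (by linarith) (by linarith)
  · rw [hpow, hpow, ← Real.exp_add, ← Real.exp_mul, ← Real.exp_nat_mul, ← Real.exp_sub, mul_assoc,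
      ← Real.exp_add (((2 : ℕ) : ℝ) * u)]
    have e : (u + u * w₁) * σ = δ * u + (((2 : ℕ) : ℝ) * u + (u * w₁ - u * w₂)) := by
      rw [hδ, show w₂ = 1 - w₁ by linarith]
      push_cast
      ring
    rw [e, Real.exp_add (δ * u)]
    refine mul_le_mul_of_nonneg_right ?_ (Real.exp_nonneg _)
    refine le_trans ?_ (Real.pow_div_factorial_le_exp (δ * u) (by positivity) 3)
    rw [le_div_iff₀ (by positivity)]
    simp only [Nat.factorial]
    push_cast
    nlinarith [mul_le_mul_of_nonneg_right hu2 (show 0 ≤ u ^ 2 by positivity)]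

lemma dimH_escaping_le {w₁ w₂ σ : ℝ} (hw₂ : 0 < w₂) (hw : w₂ ≤ w₁) (hsum : w₁ + w₂ = 1)
    (hσ0 : 0 ≤ σ) (hσ : 1 + 2 * w₁ < (1 + w₁) * σ) :
    ∃ r : ℝ, 0 < r ∧ r ≤ 1 ∧
      ∀ N : ℝ, 1 ≤ N → dimH (escaping w₁ w₂ r N) ≤ ENNReal.ofReal σ := by
  obtain ⟨b, L, hb, h₁, h₂, hL, hLa, hLb, hgrow⟩ := exists_scale hw₂ hw hsum hσ
  have hb0 : 0 < b := by linarith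
  have hbb : b ^ w₁ * b ^ w₂ = b := by rw [← Real.rpow_add hb0, hsum, Real.rpow_one]
  have hb9 : 1 ≤ b ^ 9 := one_le_pow₀ hb
  refine ⟨1 / (160000 * b ^ 9), by positivity,
    (div_le_one (by positivity)).2 (by linarith), fun N hN => ?_⟩
  have hN0 : 0 < N := by linarith
  let S : ℤ × ℤ → BoxState := fun p =>
    { α := N ^ w₁
      β := N ^ w₂
      γ := 1 / N
      x := p.1 * (1 / N / N ^ w₁)
      y := p.2 * (1 / N / N ^ w₂)
      one_le_α := Real.one_le_rpow hN (by linarith)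
      one_le_β := Real.one_le_rpow hN hw₂.le
      γ_pos := by positivity
      mul_eq_one := by
        rw [← Real.rpow_add hN0, hsum, Real.rpow_one, mul_one_div_cancel hN0.ne'] }
  set E := escaping w₁ w₂ (1 / (160000 * b ^ 9)) N with hE
  have hcov : E ⊆ ⋃ p : ℤ × ℤ, {ξ ∈ E | |ξ.1 - (S p).x| ≤ (S p).γ / (S p).α / 2 ∧
      |ξ.2 - (S p).y| ≤ (S p).γ / (S p).β / 2} := by
    intro ξ hξ
    obtain ⟨i, hi⟩ := exists_int_near (show 0 < 1 / N / N ^ w₁ by positivity) ξ.1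
    obtain ⟨j, hj⟩ := exists_int_near (show 0 < 1 / N / N ^ w₂ by positivity) ξ.2
    exact Set.mem_iUnion.2 ⟨(i, j), hξ, hi, hj⟩
  refine (dimH_mono hcov).trans ?_
  rw [dimH_iUnion]
  refine iSup_le fun p => BoxState.dimH_box_le h₁ h₂ hL hσ0
    (by simpa only [hbb] using hLa) (by simpa only [hbb] using hLb)
    (r := 1 / (160000 * b ^ 9)) ?_
    (Real.rpow_le_rpow_of_exponent_le hb hw) (by simpa only [hbb] using hgrow) E (S p)
    (Real.rpow_le_rpow_of_exponent_le hN hw) ?_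
  · rw [hbb]
    apply le_of_eq
    field_simp
    norm_num
  · intro m ξ hξ
    have hbm : 1 ≤ b ^ m := one_le_pow₀ hb
    have hpow : ∀ w : ℝ, (b ^ m * N) ^ w = (b ^ w) ^ m * N ^ w := fun w => by
      rw [Real.mul_rpow (by positivity) hN0.le, Real.rpow_pow_comm hb0.le]
    obtain ⟨v, hv, h1, h2, h3⟩ := hξ (b ^ m * N) (by nlinarith)
    refine ⟨v, hv, ?_, ?_, ?_⟩
    · rwa [hpow] at h1
    · rwa [hpow] at h2
    · rw [hbb]
      convert h3 using 3
      simp only [S]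
      field_simp

theorem dimH_sing_le {w₁ w₂ : ℝ} (hw₂ : 0 < w₂) (hw : w₂ ≤ w₁) (hsum : w₁ + w₂ = 1) :
    dimH (Sing w₁ w₂) ≤ ENNReal.ofReal (2 - 1 / (1 + w₁)) := by
  have hw1 : 0 < 1 + w₁ := by linarith
  have e : 2 - 1 / (1 + w₁) = (1 + 2 * w₁) / (1 + w₁) := by field_simp; ring
  have hσ : ∀ σ : ℝ, 2 - 1 / (1 + w₁) < σ → dimH (Sing w₁ w₂) ≤ ENNReal.ofReal σ := by
    intro σ hσ
    rw [e, div_lt_iff₀ hw1, mul_comm σ] at hσ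
    have hσ0 : 0 ≤ σ := by nlinarith
    obtain ⟨r, hr, hr1, h⟩ := dimH_escaping_le hw₂ hw hsum hσ0 hσ
    rw [← planeEquiv.dimH_image]
    refine (dimH_mono (image_sing_subset hw₂ hw hr hr1)).trans ?_
    rw [dimH_iUnion]
    exact iSup_le fun N => h _ (by simp)
  refine ge_of_tendsto (ENNReal.continuous_ofReal.tendsto _ |>.mono_left nhdsWithin_le_nhds)
    (Filter.eventually_of_mem self_mem_nhdsWithin hσ : ∀ᶠ σ in nhdsWithin _ (Set.Ioi _), _)

/-- Lattice points in a strip of width `W` whose direction is primitive. -/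
lemma card_strip_le (m Δ : ℤ) (hm : 0 < m) (hc : IsCoprime m Δ) (t : ℝ) {W : ℝ} (hW : 0 ≤ W)
    (j₀ : ℤ) (n : ℕ) (F : Finset (ℤ × ℤ))
    (hF : ∀ p ∈ F, (j₀ ≤ p.1 ∧ p.1 < j₀ + n) ∧ |(m * p.2 - Δ * p.1 : ℝ) - t| ≤ W) :
    (F.card : ℝ) ≤ (2 * W + 1) * (n / m + 1) := by
  have hm' : (0 : ℝ) < m := by exact_mod_cast hm
  refine (card_le_card_image_mul F (fun p => m * p.2 - Δ * p.1) (c := n / m + 1) ?_).trans ?_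
  · intro k _
    refine (card_le_of_separated _ (fun p : ℤ × ℤ => (p.1 : ℝ) - j₀ - n / 2) (ρ := n / 2) hm'
      (by positivity) ?_ ?_).trans (by apply le_of_eq; ring)
    · intro p hp
      obtain ⟨⟨h1, h2⟩, -⟩ := hF p (Finset.mem_filter.1 hp).1
      have h1' : (j₀ : ℝ) ≤ p.1 := by exact_mod_cast h1
      have h2' : (p.1 : ℝ) < j₀ + n := by exact_mod_cast h2
      rw [abs_le]
      constructor <;> linarith
    · intro p hp p' hp' hne
      have e1 := (Finset.mem_filter.1 hp).2
      have e2 := (Finset.mem_filter.1 hp').2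
      have e : m * (p.2 - p'.2) = Δ * (p.1 - p'.1) := by linear_combination e1 - e2
      have hdvd : m ∣ p.1 - p'.1 := hc.dvd_of_dvd_mul_left ⟨_, e.symm⟩
      have hne1 : p.1 - p'.1 ≠ 0 := by
        intro h0
        rw [h0, mul_zero] at e
        have := (mul_eq_zero.1 e).resolve_left hm.ne'
        exact hne (Prod.ext (by omega) (by omega))
      have := Int.le_of_dvd (abs_pos.2 hne1) ((dvd_abs _ _).2 hdvd)
      have h' : (m : ℝ) ≤ |(p.1 : ℝ) - p'.1| := by exact_mod_cast this
      calc (m : ℝ) ≤ _ := h'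
        _ = _ := by congr 1; ring
  · gcongr
    refine (card_le_of_separated _ (fun s : ℤ => (s : ℝ) - t) (ρ := W) one_pos hW ?_ ?_).trans
      (by apply le_of_eq; ring)
    · intro s hs
      obtain ⟨p, hp, rfl⟩ := Finset.mem_image.1 hs
      push_cast
      exact (hF p hp).2
    · intro s _ s' _ hne
      have : (1 : ℤ) ≤ |s - s'| := Int.one_le_abs (sub_ne_zero.2 hne)
      have h' : (1 : ℝ) ≤ |(s : ℝ) - s'| := by exact_mod_cast this
      calc (1 : ℝ) ≤ _ := h'
        _ = _ := by congr 1; ring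

lemma card_range_dvd_le (g : ℕ) (hg : 0 < g) (x : ℤ) (n : ℕ) :
    (((Finset.range n).filter (fun k : ℕ => (g : ℤ) ∣ x + (k : ℤ))).card : ℝ) ≤ n / g + 1 := by
  have hg' : (0 : ℝ) < g := by exact_mod_cast hg
  refine (card_le_of_separated _ (fun k : ℕ => (k : ℝ) - n / 2) (ρ := n / 2) hg'
    (by positivity) ?_ ?_).trans (by apply le_of_eq; ring)
  · intro k hk
    have := Finset.mem_range.1 (Finset.mem_filter.1 hk).1
    have h1 : (k : ℝ) < n := by exact_mod_cast this
    have h2 : (0 : ℝ) ≤ k := k.cast_nonneg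
    rw [abs_le]
    constructor <;> linarith
  · intro k hk k' hk' hne
    have h := dvd_sub (Finset.mem_filter.1 hk).2 (Finset.mem_filter.1 hk').2
    rw [add_sub_add_left_eq_sub] at h
    have h0 : (k : ℤ) - k' ≠ 0 := by omega
    have := Int.le_of_dvd (abs_pos.2 h0) ((dvd_abs _ _).2 h)
    have h' : (g : ℝ) ≤ |(k : ℝ) - k'| := by exact_mod_cast this
    calc (g : ℝ) ≤ _ := h'
      _ = _ := by congr 1; ring

lemma sum_inv_sq_le (B : ℕ) : ∑ g ∈ Finset.Icc 2 B, 1 / (g : ℝ) ^ 2 ≤ 3 / 4 := by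
  rcases lt_or_ge B 2 with h | h
  · rw [Finset.Icc_eq_empty (by omega)]
    norm_num
  · have : ∑ g ∈ Finset.Icc 2 B, 1 / (g : ℝ) ^ 2 ≤ 3 / 4 - 1 / (B : ℝ) := by
      induction B, h using Nat.le_induction with
      | base => norm_num
      | succ B hB ih =>
        rw [Finset.sum_Icc_succ_top (by omega)]
        have hB0 : (0 : ℝ) < B := by exact_mod_cast (by omega : 0 < B)
        have : 1 / ((B : ℝ) + 1) ^ 2 ≤ 1 / (B : ℝ) - 1 / ((B : ℝ) + 1) := by
          rw [div_sub_div _ _ hB0.ne' (by positivity), div_le_div_iff₀ (by positivity)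
            (by positivity)]
          nlinarith
        push_cast
        linarith
    have : (0 : ℝ) ≤ 1 / (B : ℝ) := by positivity
    linarith

lemma sum_inv_le_log (B : ℕ) : ∑ g ∈ Finset.Icc 2 B, 1 / (g : ℝ) ≤ 1 + Real.log B := by
  refine le_trans ?_ (harmonic_le_one_add_log B)
  rw [harmonic_eq_sum_Icc]
  push_cast
  simp only [one_div]
  exact Finset.sum_le_sum_of_subset_of_nonneg (Finset.Icc_subset_Icc_left (by norm_num))
    fun _ _ _ => by positivity

/-- Most pairs in a union of long intervals are coprime, up to a constant factor. -/
lemma card_not_coprime_le (nᵢ nⱼ B : ℕ) (i₀ : ℤ) (j₀ : ℕ → ℤ)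
    (hB : ∀ i < nᵢ, |i₀ + (i : ℤ)| ≤ B) :
    (((Finset.range nᵢ ×ˢ Finset.range nⱼ).filter
      (fun p => ¬ IsCoprime (i₀ + (p.1 : ℤ)) (j₀ p.1 + (p.2 : ℤ)))).card : ℝ) ≤
      3 / 4 * (nᵢ * nⱼ) + ((nᵢ + nⱼ) * (1 + Real.log B) + B + nⱼ) := by
  set K := Finset.range nᵢ ×ˢ Finset.range nⱼ
  let Z := K.filter (fun p => i₀ + (p.1 : ℤ) = 0)
  let D : ℕ → Finset (ℕ × ℕ) := fun g =>
    K.filter (fun p => (g : ℤ) ∣ i₀ + (p.1 : ℤ) ∧ (g : ℤ) ∣ j₀ p.1 + (p.2 : ℤ))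
  have hsub : K.filter (fun p => ¬ IsCoprime (i₀ + (p.1 : ℤ)) (j₀ p.1 + (p.2 : ℤ))) ⊆
      Z ∪ (Finset.Icc 2 B).biUnion D := by
    intro p hp
    obtain ⟨hpK, hnc⟩ := Finset.mem_filter.1 hp
    rw [Finset.mem_union]
    by_cases h0 : i₀ + (p.1 : ℤ) = 0
    · exact Or.inl (Finset.mem_filter.2 ⟨hpK, h0⟩)
    · refine Or.inr (Finset.mem_biUnion.2 ⟨Int.gcd (i₀ + (p.1 : ℤ)) (j₀ p.1 + (p.2 : ℤ)), ?_,
        Finset.mem_filter.2 ⟨hpK, Int.gcd_dvd_left _ _, Int.gcd_dvd_right _ _⟩⟩)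
      rw [Int.isCoprime_iff_gcd_eq_one] at hnc
      have h1 : Int.gcd (i₀ + (p.1 : ℤ)) (j₀ p.1 + (p.2 : ℤ)) ≠ 0 := by
        rw [Ne, Int.gcd_eq_zero_iff]
        tauto
      have h2 := Int.le_of_dvd (abs_pos.2 h0) ((dvd_abs _ _).2
        (Int.gcd_dvd_left (i₀ + (p.1 : ℤ)) (j₀ p.1 + (p.2 : ℤ))))
      have h3 := hB p.1 (Finset.mem_range.1 (Finset.mem_product.1 hpK).1)
      rw [Finset.mem_Icc]
      omega
  have hZ : (Z.card : ℝ) ≤ nⱼ := by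
    have : Z.card ≤ (Finset.range nⱼ).card := by
      refine Finset.card_le_card_of_injOn Prod.snd ?_ ?_
      · intro p hp
        exact (Finset.mem_product.1 (Finset.mem_filter.1 hp).1).2
      · intro p hp p' hp' h
        have e1 := (Finset.mem_filter.1 hp).2
        have e2 := (Finset.mem_filter.1 hp').2
        exact Prod.ext (by omega) h
    rw [Finset.card_range] at this
    exact_mod_cast this
  have hD : ∀ g ∈ Finset.Icc 2 B, ((D g).card : ℝ) ≤ (nᵢ / g + 1) * (nⱼ / g + 1) := by
    intro g hg
    have hg0 : 0 < g := by have := (Finset.mem_Icc.1 hg).1; omega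
    refine (card_le_card_image_mul (D g) Prod.fst (c := nⱼ / g + 1) ?_).trans ?_
    · intro i _
      refine le_trans ?_ (card_range_dvd_le g hg0 (j₀ i) nⱼ)
      refine Nat.cast_le.2 ?_
      refine Finset.card_le_card_of_injOn Prod.snd ?_ ?_
      · intro p hp
        obtain ⟨hp1, hp2⟩ := Finset.mem_filter.1 hp
        obtain ⟨hp3, hp4, hp5⟩ := Finset.mem_filter.1 hp1
        rw [hp2] at hp5
        exact Finset.mem_filter.2 ⟨(Finset.mem_product.1 hp3).2, hp5⟩
      · intro p hp p' hp' h
        exact Prod.ext ((Finset.mem_filter.1 hp).2.trans (Finset.mem_filter.1 hp').2.symm) h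
    · gcongr
      refine le_trans ?_ (card_range_dvd_le g hg0 i₀ nᵢ)
      refine Nat.cast_le.2 ?_
      refine Finset.card_le_card ?_
      intro i hi
      obtain ⟨p, hp, rfl⟩ := Finset.mem_image.1 hi
      obtain ⟨hp3, hp4, hp5⟩ := Finset.mem_filter.1 hp
      exact Finset.mem_filter.2 ⟨(Finset.mem_product.1 hp3).1, hp4⟩
  have hsum : ∑ g ∈ Finset.Icc 2 B, ((nᵢ : ℝ) / g + 1) * (nⱼ / g + 1) ≤
      3 / 4 * (nᵢ * nⱼ) + ((nᵢ + nⱼ) * (1 + Real.log B) + B) := by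
    have : ∀ g ∈ Finset.Icc 2 B, ((nᵢ : ℝ) / g + 1) * (nⱼ / g + 1) =
        nᵢ * nⱼ * (1 / (g : ℝ) ^ 2) + (nᵢ + nⱼ) * (1 / (g : ℝ)) + 1 := by
      intro g _
      ring
    rw [Finset.sum_congr rfl this, Finset.sum_add_distrib, Finset.sum_add_distrib,
      ← Finset.mul_sum, ← Finset.mul_sum, Finset.sum_const, Nat.card_Icc, nsmul_eq_mul, mul_one]
    have h1 : ((B + 1 - 2 : ℕ) : ℝ) ≤ B := by exact_mod_cast (by omega)
    have h2 := mul_le_mul_of_nonneg_left (sum_inv_sq_le B) (show (0 : ℝ) ≤ nᵢ * nⱼ by positivity)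
    have h3 := mul_le_mul_of_nonneg_left (sum_inv_le_log B) (show (0 : ℝ) ≤ nᵢ + nⱼ by positivity)
    linarith
  calc _ ≤ ((Z ∪ (Finset.Icc 2 B).biUnion D).card : ℝ) := by
        exact_mod_cast Finset.card_le_card hsub
    _ ≤ Z.card + ∑ g ∈ Finset.Icc 2 B, ((D g).card : ℝ) := by
        exact_mod_cast (Finset.card_union_le _ _).trans
          (Nat.add_le_add_left Finset.card_biUnion_le _)
    _ ≤ nⱼ + (3 / 4 * (nᵢ * nⱼ) + ((nᵢ + nⱼ) * (1 + Real.log B) + B)) :=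
        add_le_add hZ ((Finset.sum_le_sum hD).trans hsum)
    _ = _ := by ring

/-- Points `(j, a)` lying in a union of strips with primitive directions of small size. -/
lemma card_strips_le (nⱼ nₐ : ℕ) (j₀ : ℤ) (a₀ : ℕ → ℤ) (κ μ : ℝ) {W A : ℝ} (hW : 0 ≤ W)
    (hA : 0 ≤ A) (F : Finset (ℕ × ℕ)) (hF : F ⊆ Finset.range nⱼ ×ˢ Finset.range nₐ)
    (h : ∀ p ∈ F, ∃ m Δ : ℤ, 0 < m ∧ m < nⱼ ∧ |(Δ : ℝ)| ≤ A * m ∧ IsCoprime m Δ ∧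
      |m * (((a₀ p.1 + (p.2 : ℤ) : ℤ) : ℝ) - κ) - Δ * (((j₀ + (p.1 : ℤ) : ℤ) : ℝ) - μ)| ≤ W) :
    (F.card : ℝ) ≤ (2 * A + 1) * (2 * W + 1) * 2 * nⱼ * nⱼ := by
  classical
  let D : ℕ → ℤ → Finset (ℕ × ℕ) := fun m Δ => F.filter (fun p => IsCoprime (m : ℤ) Δ ∧
    |m * (((a₀ p.1 + (p.2 : ℤ) : ℤ) : ℝ) - κ) - Δ * (((j₀ + (p.1 : ℤ) : ℤ) : ℝ) - μ)| ≤ W)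
  let I : ℕ → Finset ℤ := fun m => Finset.Icc (-⌊A * m⌋) ⌊A * m⌋
  have hsub : F ⊆ (Finset.Ico 1 nⱼ).biUnion fun m => (I m).biUnion fun Δ => D m Δ := by
    intro p hp
    obtain ⟨m, Δ, hm, hmn, hΔ, hc, hle⟩ := h p hp
    lift m to ℕ using hm.le
    simp only [Finset.mem_biUnion]
    refine ⟨m, Finset.mem_Ico.2 ⟨by omega, by omega⟩, Δ, Finset.mem_Icc.2 ?_,
      Finset.mem_filter.2 ⟨hp, hc, by exact_mod_cast hle⟩⟩
    rw [← abs_le, Int.le_floor]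
    exact_mod_cast hΔ
  have hD : ∀ m ∈ Finset.Ico 1 nⱼ, ∀ Δ ∈ I m, ((D m Δ).card : ℝ) ≤ (2 * W + 1) * (2 * nⱼ / m) := by
    intro m hm Δ _
    obtain ⟨hm1, hm2⟩ := Finset.mem_Ico.1 hm
    have hm0 : (0 : ℝ) < m := by exact_mod_cast hm1
    have hmn : (m : ℝ) ≤ nⱼ := by exact_mod_cast hm2.le
    by_cases hc : IsCoprime (m : ℤ) Δ
    · let φ : ℕ × ℕ → ℤ × ℤ := fun p => (j₀ + (p.1 : ℤ), a₀ p.1 + (p.2 : ℤ))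
      have hφ : Function.Injective φ := by
        intro p p' hpp
        obtain ⟨e1, e2⟩ := Prod.ext_iff.1 hpp
        simp only [φ] at e1 e2
        have e3 : p.1 = p'.1 := by omega
        rw [e3] at e2
        exact Prod.ext e3 (by omega)
      have := card_strip_le m Δ (by exact_mod_cast hm1) hc (m * κ - Δ * μ) hW j₀ nⱼ
        ((D m Δ).image φ) ?_
      · rw [Finset.card_image_of_injective _ hφ] at this
        refine this.trans ?_
        have h1 : 1 ≤ (nⱼ : ℝ) / m := (one_le_div hm0).2 hmn
        have h2 : 2 * (nⱼ : ℝ) / m = nⱼ / m + nⱼ / m := by ring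
        rw [h2]
        push_cast
        gcongr
      · intro q hq
        obtain ⟨p, hp, rfl⟩ := Finset.mem_image.1 hq
        obtain ⟨hpF, -, hle⟩ := Finset.mem_filter.1 hp
        have := Finset.mem_range.1 (Finset.mem_product.1 (hF hpF)).1
        refine ⟨⟨by simp [φ], by simp [φ, this]⟩, ?_⟩
        simp only [φ]
        refine le_trans (le_of_eq ?_) hle
        push_cast
        congr 1
        ring
    · have : D m Δ = ∅ := Finset.filter_eq_empty_iff.2 fun p _ hp => hc hp.1
      rw [this, Finset.card_empty, Nat.cast_zero]
      positivity
  have hI : ∀ m ∈ Finset.Ico 1 nⱼ, ((I m).card : ℝ) ≤ (2 * A + 1) * m := by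
    intro m hm
    have hm1 : (1 : ℝ) ≤ m := by exact_mod_cast (Finset.mem_Ico.1 hm).1
    have hfl : 0 ≤ ⌊A * m⌋ := Int.floor_nonneg.2 (by positivity)
    have e : ((I m).card : ℤ) = 2 * ⌊A * m⌋ + 1 := by
      simp only [I, Int.card_Icc]
      omega
    have e' : ((I m).card : ℝ) = 2 * (⌊A * m⌋ : ℝ) + 1 := by exact_mod_cast e
    rw [e']
    have := Int.floor_le (A * m)
    linarith
  calc (F.card : ℝ) ≤ ∑ m ∈ Finset.Ico 1 nⱼ, ∑ Δ ∈ I m, ((D m Δ).card : ℝ) := by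
        exact_mod_cast (Finset.card_le_card hsub).trans (Finset.card_biUnion_le.trans
          (Finset.sum_le_sum fun m _ => Finset.card_biUnion_le))
    _ ≤ ∑ m ∈ Finset.Ico 1 nⱼ, (2 * A + 1) * (2 * W + 1) * 2 * nⱼ := by
        refine Finset.sum_le_sum fun m hm => ?_
        have hm0 : (0 : ℝ) < m := by exact_mod_cast (Finset.mem_Ico.1 hm).1
        calc _ ≤ ∑ Δ ∈ I m, (2 * W + 1) * (2 * nⱼ / m) := Finset.sum_le_sum (hD m hm)
          _ = (I m).card * ((2 * W + 1) * (2 * nⱼ / m)) := by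
              rw [Finset.sum_const, nsmul_eq_mul]
          _ ≤ (2 * A + 1) * m * ((2 * W + 1) * (2 * nⱼ / m)) := by gcongr; exact hI m hm
          _ = _ := by field_simp
    _ = ((nⱼ - 1 : ℕ) : ℝ) * ((2 * A + 1) * (2 * W + 1) * 2 * nⱼ) := by
        rw [Finset.sum_const, nsmul_eq_mul, Nat.card_Ico]
    _ ≤ (nⱼ : ℝ) * ((2 * A + 1) * (2 * W + 1) * 2 * nⱼ) := by
        gcongr
        omega
    _ = _ := by ring

/-- A large family of triples `(i, j, a)` with `i` and `j` coprime, for which the shifted slope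
`(a - iκ) / (j - iμ)` is badly approximated by rationals of small height. -/
lemma exists_good_family (nᵢ nⱼ nₐ B : ℕ) (i₀ : ℤ) (j₀ : ℕ → ℤ) (a₀ : ℕ → ℕ → ℤ) (κ μ : ℝ)
    {W A : ℝ} (hW : 0 ≤ W) (hA : 0 ≤ A) (hB : ∀ i < nᵢ, |i₀ + (i : ℤ)| ≤ B)
    (hcop : ((nᵢ : ℝ) + nⱼ) * (1 + Real.log B) + B + nⱼ ≤ nᵢ * nⱼ / 8)
    (hstr : (2 * A + 1) * (2 * W + 1) * 2 * nⱼ ≤ nₐ / 16) :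
    ∃ G ⊆ Finset.range nᵢ ×ˢ Finset.range nⱼ ×ˢ Finset.range nₐ,
      (nᵢ * nⱼ * nₐ / 16 : ℝ) ≤ G.card ∧ ∀ p ∈ G,
        IsCoprime (i₀ + (p.1 : ℤ)) (j₀ p.1 + (p.2.1 : ℤ)) ∧
        ∀ m Δ : ℤ, 0 < m → m < nⱼ → |(Δ : ℝ)| ≤ A * m → IsCoprime m Δ →
          W < |m * (((a₀ p.1 p.2.1 + (p.2.2 : ℤ) : ℤ) : ℝ) - ((i₀ + (p.1 : ℤ) : ℤ) : ℝ) * κ) -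
            Δ * (((j₀ p.1 + (p.2.1 : ℤ) : ℤ) : ℝ) - ((i₀ + (p.1 : ℤ) : ℤ) : ℝ) * μ)| := by
  classical
  set K := Finset.range nᵢ ×ˢ Finset.range nⱼ ×ˢ Finset.range nₐ with hK
  let P : ℕ × ℕ × ℕ → Prop := fun p => IsCoprime (i₀ + (p.1 : ℤ)) (j₀ p.1 + (p.2.1 : ℤ))
  let R : ℕ × ℕ × ℕ → Prop := fun p =>
    ∃ m Δ : ℤ, 0 < m ∧ m < nⱼ ∧ |(Δ : ℝ)| ≤ A * m ∧ IsCoprime m Δ ∧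
      |m * (((a₀ p.1 p.2.1 + (p.2.2 : ℤ) : ℤ) : ℝ) - ((i₀ + (p.1 : ℤ) : ℤ) : ℝ) * κ) -
            Δ * (((j₀ p.1 + (p.2.1 : ℤ) : ℤ) : ℝ) - ((i₀ + (p.1 : ℤ) : ℤ) : ℝ) * μ)| ≤ W
  refine ⟨K.filter (fun p => P p ∧ ¬ R p), Finset.filter_subset _ _, ?_, fun p hp => ?_⟩
  · have hcard : (K.card : ℝ) = nᵢ * nⱼ * nₐ := by
      simp [hK, mul_assoc]
    have hsub : K ⊆ K.filter (fun p => P p ∧ ¬ R p) ∪ (K.filter (fun p => ¬ P p) ∪ K.filter R) := by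
      intro p hp
      simp only [Finset.mem_union, Finset.mem_filter]
      tauto
    have h1 : ((K.filter (fun p => ¬ P p)).card : ℝ) ≤ (7 / 8 * (nᵢ * nⱼ)) * nₐ := by
      have := card_not_coprime_le nᵢ nⱼ B i₀ j₀ hB
      have h2 : (K.filter (fun p => ¬ P p)).card ≤ (((Finset.range nᵢ ×ˢ Finset.range nⱼ).filter
          (fun p => ¬ IsCoprime (i₀ + (p.1 : ℤ)) (j₀ p.1 + (p.2 : ℤ)))) ×ˢ
          Finset.range nₐ).card := by
        refine Finset.card_le_card_of_injOn (fun p => ((p.1, p.2.1), p.2.2)) ?_ ?_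
        · intro p hp
          obtain ⟨hpK, hpP⟩ := Finset.mem_filter.1 hp
          obtain ⟨k1, k2⟩ := Finset.mem_product.1 hpK
          obtain ⟨k2, k3⟩ := Finset.mem_product.1 k2
          exact Finset.mem_product.2 ⟨Finset.mem_filter.2 ⟨Finset.mem_product.2 ⟨k1, k2⟩, hpP⟩, k3⟩
        · intro p _ p' _ hpp
          simp only [Prod.mk.injEq] at hpp
          exact Prod.ext hpp.1.1 (Prod.ext hpp.1.2 hpp.2)
      rw [Finset.card_product, Finset.card_range] at h2
      refine (Nat.cast_le.2 h2).trans ?_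
      rw [Nat.cast_mul]
      refine mul_le_mul_of_nonneg_right (this.trans ?_) nₐ.cast_nonneg
      linarith
    have h2 : ((K.filter R).card : ℝ) ≤ nᵢ * (nⱼ * nₐ / 16) := by
      refine (card_le_card_image_mul _ Prod.fst (c := nⱼ * nₐ / 16) ?_).trans ?_
      · intro i _
        have hinj : Set.InjOn Prod.snd (((K.filter R).filter (fun p => p.1 = i) :
            Finset (ℕ × ℕ × ℕ)) : Set (ℕ × ℕ × ℕ)) := by
          intro p hp p' hp' hpp
          exact Prod.ext ((Finset.mem_filter.1 hp).2.trans (Finset.mem_filter.1 hp').2.symm) hpp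
        rw [← Finset.card_image_of_injOn hinj]
        refine (card_strips_le nⱼ nₐ (j₀ i) (a₀ i) (((i₀ + (i : ℤ) : ℤ) : ℝ) * κ)
          (((i₀ + (i : ℤ) : ℤ) : ℝ) * μ) hW hA _ ?_ ?_).trans ?_
        · intro q hq
          obtain ⟨p, hp, rfl⟩ := Finset.mem_image.1 hq
          exact (Finset.mem_product.1 (Finset.mem_filter.1 (Finset.mem_filter.1 hp).1).1).2
        · intro q hq
          obtain ⟨p, hp, rfl⟩ := Finset.mem_image.1 hq
          obtain ⟨hp1, rfl⟩ := Finset.mem_filter.1 hp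
          exact (Finset.mem_filter.1 hp1).2
        · have := mul_le_mul_of_nonneg_right hstr (Nat.cast_nonneg (α := ℝ) nⱼ)
          linarith
      · gcongr
        rw [← Finset.card_range nᵢ]
        refine Finset.card_le_card fun i hi => ?_
        obtain ⟨p, hp, rfl⟩ := Finset.mem_image.1 hi
        exact (Finset.mem_product.1 (Finset.mem_filter.1 hp).1).1
    have h3 : (K.card : ℝ) ≤ (K.filter (fun p => P p ∧ ¬ R p)).card +
        ((K.filter (fun p => ¬ P p)).card + (K.filter R).card) := by
      exact_mod_cast (Finset.card_le_card hsub).trans ((Finset.card_union_le _ _).trans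
        (Nat.add_le_add_left (Finset.card_union_le _ _) _))
    rw [hcard] at h3
    linarith
  · obtain ⟨-, hP, hR⟩ := Finset.mem_filter.1 hp
    refine ⟨hP, fun m Δ h1 h2 h3 h4 => ?_⟩
    by_contra hcon
    exact hR ⟨m, Δ, h1, h2, h3, h4, not_lt.1 hcon⟩

/-- A basis `(u, v, w)` of `ℤ³`, where `u` represents a rational point. -/
abbrev Basis3 := (ℤ × ℤ × ℤ) × (ℤ × ℤ × ℤ) × (ℤ × ℤ × ℤ)

namespace Basis3

/-- The denominator of the rational point of a basis. -/
def den (p : Basis3) : ℤ := p.1.2.2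

/-- The rational point of a basis. -/
noncomputable def center (p : Basis3) : ℝ × ℝ := (p.1.1 / p.den, p.1.2.1 / p.den)

/-- The covector `v × u`. -/
def cov (p : Basis3) : ℤ × ℤ × ℤ := cr p.2.1 p.1

/-- The covector `u × w`. -/
def cov' (p : Basis3) : ℤ × ℤ × ℤ := cr p.1 p.2.2

/-- The basis with first two vectors `a u - j v - i w` and `u`. -/
def next (p : Basis3) (i j a s t : ℤ) : Basis3 :=
  (a • p.1 - j • p.2.1 - i • p.2.2, p.1, s • p.2.1 + t • p.2.2)

/-- The basis is unimodular and the sizes of its entries are controlled by `Q`, `Z`, `z`. -/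
structure IsNode (Q Z z : ℝ) (p : Basis3) : Prop where
  det : p.cov.1 * p.2.2.1 + p.cov.2.1 * p.2.2.2.1 + p.cov.2.2 * p.2.2.2.2 = 1
  le_den : Q ≤ p.den
  den_lt : p.den < 2 * Q
  abs_le_den : |(p.2.1.2.2 : ℝ)| ≤ p.den
  le_fst : Z / 2 ≤ p.cov.1
  fst_le : p.cov.1 ≤ Z
  le_snd : 7 / 8 * z ≤ p.cov.2.1
  snd_le : p.cov.2.1 ≤ z

variable {Q Z z Q' Z' z' Q'' Z'' : ℝ} {p p' : Basis3}

lemma cov_next (p : Basis3) (i j a s t : ℤ) :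
    (p.next i j a s t).cov = j • p.cov - i • p.cov' := by
  ext <;> simp [cov, cov', next, cr] <;> ring

lemma det_next {i j a s t : ℤ}
    (h : p.cov.1 * p.2.2.1 + p.cov.2.1 * p.2.2.2.1 + p.cov.2.2 * p.2.2.2.2 = 1)
    (hst : j * t - i * s = 1) :
    (p.next i j a s t).cov.1 * (p.next i j a s t).2.2.1 +
      (p.next i j a s t).cov.2.1 * (p.next i j a s t).2.2.2.1 +
      (p.next i j a s t).cov.2.2 * (p.next i j a s t).2.2.2.2 = 1 := by
  rw [cov_next]
  simp only [cov, cov', next, cr, Prod.fst_add, Prod.snd_add, Prod.fst_sub, Prod.snd_sub,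
    Prod.smul_fst, Prod.smul_snd, smul_eq_mul] at h ⊢
  linear_combination (j * t - i * s) * h + hst

lemma cov_mul_sub_eq_den
    (h : p.cov.1 * p.2.2.1 + p.cov.2.1 * p.2.2.2.1 + p.cov.2.2 * p.2.2.2.2 = 1) :
    p.cov.1 * p.cov'.2.1 - p.cov.2.1 * p.cov'.1 = p.den := by
  simp only [cov, cov', den, cr] at h ⊢
  linear_combination p.1.2.2 * h

lemma center_next_fst (p : Basis3) (i j a s t : ℤ) (hd : p.den ≠ 0)
    (hd' : (p.next i j a s t).den ≠ 0) :
    (p.next i j a s t).center.1 - p.center.1 =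
      (p.next i j a s t).cov.2.1 / (p.den * (p.next i j a s t).den) := by
  have h1 : (p.den : ℝ) ≠ 0 := by exact_mod_cast hd
  have h2 : ((p.next i j a s t).den : ℝ) ≠ 0 := by exact_mod_cast hd'
  simp only [center]
  rw [div_sub_div _ _ h2 h1, mul_comm (p.den : ℝ)]
  congr 1
  simp only [cov, cr, next, den]
  push_cast
  ring

lemma center_next_snd (p : Basis3) (i j a s t : ℤ) (hd : p.den ≠ 0)
    (hd' : (p.next i j a s t).den ≠ 0) :
    (p.next i j a s t).center.2 - p.center.2 =
      -((p.next i j a s t).cov.1 / (p.den * (p.next i j a s t).den)) := by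
  have h1 : (p.den : ℝ) ≠ 0 := by exact_mod_cast hd
  have h2 : ((p.next i j a s t).den : ℝ) ≠ 0 := by exact_mod_cast hd'
  simp only [center]
  rw [div_sub_div _ _ h2 h1, mul_comm (p.den : ℝ), ← neg_div]
  congr 1
  simp only [cov, cr, next, den]
  push_cast
  ring

/-- Different nodes of the same level have well separated centres. -/
lemma IsNode.fst_eq_of_near (h : IsNode Q Z z p) (h' : IsNode Q Z z p') (hQ : 0 < Q)
    (hQ' : 0 < Q') (hz' : 0 ≤ z') (hZ' : 0 ≤ Z')
    (h1 : 24 * (z' * Z + Z' * z) < Q') (h2 : 48 * Z' * Q < Z * Q')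
    (hx : |p.center.1 - p'.center.1| ≤ 3 * (2 * z' / (Q' * Q)))
    (hy : |p.center.2 - p'.center.2| ≤ 3 * (2 * Z' / (Q' * Q))) : p.1 = p'.1 := by
  have hq : (0 : ℝ) < p.den := hQ.trans_le h.le_den
  have hq' : (0 : ℝ) < p'.den := hQ.trans_le h'.le_den
  set D := cr p.1 p'.1 with hD
  have hqq : (p.den : ℝ) * p'.den ≤ 4 * Q ^ 2 := by
    nlinarith [h.den_lt, h'.den_lt, h.le_den, h'.le_den]
  have key : ∀ {c c' y : ℝ}, 0 ≤ y → |c / p.den - c' / p'.den| ≤ 3 * (2 * y / (Q' * Q)) →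
      |c * p'.den - p.den * c'| ≤ 24 * y * Q / Q' := by
    intro c c' y hy0 hc
    rw [div_sub_div _ _ hq.ne' hq'.ne', abs_div, abs_of_pos (mul_pos hq hq'),
      div_le_iff₀ (mul_pos hq hq')] at hc
    calc _ ≤ _ := hc
      _ ≤ 3 * (2 * y / (Q' * Q)) * (4 * Q ^ 2) := by gcongr
      _ = _ := by field_simp; ring
  have hD2 : |(D.2.1 : ℝ)| ≤ 24 * z' * Q / Q' := by
    have := key hz' hx
    rw [abs_sub_comm] at this
    simpa [hD, cr, den] using this
  have hD1 : |(D.1 : ℝ)| ≤ 24 * Z' * Q / Q' := by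
    have := key hZ' hy
    simpa [hD, cr, den] using this
  have hZ0 : 0 ≤ Z := by
    have := mul_nonneg (mul_nonneg (by norm_num : (0 : ℝ) ≤ 48) hZ') hQ.le
    by_contra hcon
    nlinarith
  have hd1 : (0 : ℝ) ≤ p.cov.1 := le_trans (by linarith) h.le_fst
  set β := D.1 * p.2.1.1 + D.2.1 * p.2.1.2.1 + D.2.2 * p.2.1.2.2 with hβ
  set τ := D.1 * p.2.2.1 + D.2.1 * p.2.2.2.1 + D.2.2 * p.2.2.2.2 with hτ
  have hdet := h.det
  have e1 : D.2.1 * p.cov.1 - D.1 * p.cov.2.1 = β * p.den := by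
    simp only [hβ, hD, cov, cr, den]
    ring
  have hβ0 : β = 0 := by
    by_contra hne
    have hβ1 : (1 : ℝ) ≤ |(β : ℝ)| := by exact_mod_cast Int.one_le_abs hne
    have e1' : (D.2.1 : ℝ) * p.cov.1 - D.1 * p.cov.2.1 = β * p.den := by exact_mod_cast e1
    have hd2 : |(p.cov.2.1 : ℝ)| ≤ z := by
      have h0 : (0 : ℝ) ≤ z := by
        have := h.le_snd
        have := h.snd_le
        linarith
      rw [abs_of_nonneg (le_trans (by linarith) h.le_snd)]
      exact h.snd_le
    have : (p.den : ℝ) ≤ 24 * z' * Q / Q' * Z + 24 * Z' * Q / Q' * z := by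
      calc (p.den : ℝ) ≤ |(β : ℝ)| * p.den := le_mul_of_one_le_left hq.le hβ1
        _ = |(D.2.1 : ℝ) * p.cov.1 - D.1 * p.cov.2.1| := by
            rw [e1', abs_mul, abs_of_pos hq]
        _ ≤ |(D.2.1 : ℝ)| * |(p.cov.1 : ℝ)| + |(D.1 : ℝ)| * |(p.cov.2.1 : ℝ)| := by
            rw [← abs_mul, ← abs_mul]
            exact abs_sub _ _
        _ ≤ _ := by
            rw [abs_of_nonneg hd1]
            gcongr
            exact h.fst_le
    have e : 24 * z' * Q / Q' * Z + 24 * Z' * Q / Q' * z = 24 * (z' * Z + Z' * z) / Q' * Q := by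
      field_simp
    have : 24 * (z' * Z + Z' * z) / Q' * Q < 1 * Q := by
      gcongr
      rwa [div_lt_one hQ']
    linarith [h.le_den]
  have e2 : D.1 = τ * p.cov.1 := by
    have : D.1 * (p.cov.1 * p.2.2.1 + p.cov.2.1 * p.2.2.2.1 + p.cov.2.2 * p.2.2.2.2) =
        τ * p.cov.1 + β * p.cov'.1 := by
      simp only [hβ, hτ, hD, cov, cov', cr]
      ring
    rw [hdet, hβ0] at this
    linarith
  have hτ0 : τ = 0 := by
    by_contra hne
    have hτ1 : (1 : ℝ) ≤ |(τ : ℝ)| := by exact_mod_cast Int.one_le_abs hne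
    have e2' : (D.1 : ℝ) = τ * p.cov.1 := by exact_mod_cast e2
    have h3 : (p.cov.1 : ℝ) ≤ |(D.1 : ℝ)| := by
      rw [e2', abs_mul, abs_of_nonneg hd1]
      exact le_mul_of_one_le_left hd1 hτ1
    have h4 : 24 * Z' * Q / Q' < Z / 2 := by
      rw [div_lt_div_iff₀ hQ' two_pos]
      linarith
    linarith [h.le_fst]
  have hD0 : D = 0 := by
    have a1 : D.1 * (p.cov.1 * p.2.2.1 + p.cov.2.1 * p.2.2.2.1 + p.cov.2.2 * p.2.2.2.2) =
        τ * p.cov.1 + β * p.cov'.1 := by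
      simp only [hβ, hτ, hD, cov, cov', cr]
      ring
    have a2 : D.2.1 * (p.cov.1 * p.2.2.1 + p.cov.2.1 * p.2.2.2.1 + p.cov.2.2 * p.2.2.2.2) =
        τ * p.cov.2.1 + β * p.cov'.2.1 := by
      simp only [hβ, hτ, hD, cov, cov', cr]
      ring
    have a3 : D.2.2 * (p.cov.1 * p.2.2.1 + p.cov.2.1 * p.2.2.2.1 + p.cov.2.2 * p.2.2.2.2) =
        τ * p.cov.2.2 + β * p.cov'.2.2 := by
      simp only [hβ, hτ, hD, cov, cov', cr]
      ring
    rw [hdet, hβ0, hτ0] at a1 a2 a3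
    refine Prod.ext ?_ (Prod.ext ?_ ?_) <;> simp only [Prod.fst_zero, Prod.snd_zero] <;> linarith
  have prim : ∀ {p p' : Basis3},
      p.cov.1 * p.2.2.1 + p.cov.2.1 * p.2.2.2.1 + p.cov.2.2 * p.2.2.2.2 = 1 →
      cr p.1 p'.1 = 0 → p.den ∣ p'.den := by
    intro p p' hdet h0
    simp only [cr, Prod.mk_eq_zero] at h0
    obtain ⟨a1, a2, a3⟩ := h0
    refine ⟨(p.2.2.2.1 * p.2.1.2.2 - p.2.2.2.2 * p.2.1.2.1) * p'.1.1 +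
      (p.2.2.2.2 * p.2.1.1 - p.2.2.1 * p.2.1.2.2) * p'.1.2.1 +
      (p.2.2.1 * p.2.1.2.1 - p.2.2.2.1 * p.2.1.1) * p'.1.2.2, ?_⟩
    simp only [cov, cr, den] at hdet ⊢
    linear_combination (-p'.1.2.2) * hdet -
      (p.2.2.2.1 * p.2.1.2.2 - p.2.2.2.2 * p.2.1.2.1) * a2 +
      (p.2.2.2.2 * p.2.1.1 - p.2.2.1 * p.2.1.2.2) * a1
  have hcr' : cr p'.1 p.1 = 0 := by
    have : cr p'.1 p.1 = -D := by
      ext <;> simp [hD, cr] <;> ring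
    rw [this, hD0, neg_zero]
  have hqi : 0 < p.den := by exact_mod_cast hq
  have hqi' : 0 < p'.den := by exact_mod_cast hq'
  have heq : p.den = p'.den :=
    Int.dvd_antisymm hqi.le hqi'.le (prim hdet hD0) (prim h'.det hcr')
  simp only [hD, cr, Prod.mk_eq_zero] at hD0
  simp only [den] at heq hqi
  obtain ⟨a1, a2, -⟩ := hD0
  rw [← heq] at a1 a2
  refine Prod.ext (mul_left_cancel₀ hqi.ne' ?_) (Prod.ext (mul_left_cancel₀ hqi.ne' ?_) heq)
  · linarith
  · linarith

/-- The good triples of `exists_good_family` admit no small nontrivial linear form. -/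
lemma eq_zero_of_abs_sub_le {X Y W A : ℝ} {n : ℕ}
    (hgood : ∀ m Δ : ℤ, 0 < m → m < n → |(Δ : ℝ)| ≤ A * m → IsCoprime m Δ →
      W < |m * X - Δ * Y|) (hW : W < Y) (hA : W + |X| ≤ A * Y) (hW0 : 0 ≤ W) {m Δ : ℤ}
    (hm : |m| < n) (h : |m * X - Δ * Y| ≤ W) : m = 0 ∧ Δ = 0 := by
  have hY : 0 < Y := hW0.trans_lt hW
  have main : ∀ m Δ : ℤ, 0 < m → m < n → |m * X - Δ * Y| ≤ W → False := by
    intro m Δ hm hmn h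
    have hmR : (1 : ℝ) ≤ m := by exact_mod_cast hm
    have hΔ : |(Δ : ℝ)| ≤ A * m := by
      refine le_of_mul_le_mul_right ?_ hY
      calc |(Δ : ℝ)| * Y = |(Δ : ℝ) * Y| := by rw [abs_mul, abs_of_pos hY]
        _ = |m * X - (m * X - Δ * Y)| := by ring_nf
        _ ≤ |m * X| + |m * X - Δ * Y| := abs_sub _ _
        _ ≤ m * |X| + W := by
            rw [abs_mul, abs_of_pos (by linarith : (0 : ℝ) < m)]
            gcongr
        _ ≤ m * (W + |X|) := by nlinarith
        _ ≤ m * (A * Y) := by gcongr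
        _ = A * m * Y := by ring
    obtain ⟨m', Δ', hcop, hm', hΔ'⟩ : ∃ m' Δ' : ℤ, IsCoprime m' Δ' ∧
        m = m' * (Int.gcd m Δ : ℤ) ∧ Δ = Δ' * (Int.gcd m Δ : ℤ) := by
      have hg : 0 < Int.gcd m Δ := Int.gcd_pos_of_ne_zero_left _ hm.ne'
      obtain ⟨m', Δ', hc, h1, h2⟩ := Int.exists_gcd_one hg
      exact ⟨m', Δ', Int.isCoprime_iff_gcd_eq_one.2 hc, h1, h2⟩
    have hg : 0 < (Int.gcd m Δ : ℤ) := by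
      exact_mod_cast Int.gcd_pos_of_ne_zero_left _ hm.ne'
    set g : ℤ := (Int.gcd m Δ : ℤ)
    have hgR : (1 : ℝ) ≤ g := by exact_mod_cast hg
    have hm'0 : 0 < m' := by
      by_contra hcon
      nlinarith
    have hm'n : m' < n := by nlinarith
    have e1 : (m : ℝ) = m' * g := by exact_mod_cast hm'
    have e2 : (Δ : ℝ) = Δ' * g := by exact_mod_cast hΔ'
    have hlt := hgood m' Δ' hm'0 hm'n ?_ hcop
    · have e3 : m * X - Δ * Y = g * (m' * X - Δ' * Y) := by rw [e1, e2]; ring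
      rw [e3, abs_mul, abs_of_pos (by linarith : (0 : ℝ) < g)] at h
      nlinarith [abs_nonneg ((m' : ℝ) * X - Δ' * Y)]
    · rw [e1, e2, abs_mul, abs_of_pos (by linarith : (0 : ℝ) < g), ← mul_assoc] at hΔ
      exact le_of_mul_le_mul_right hΔ (by linarith)
  rcases lt_trichotomy m 0 with hm0 | hm0 | hm0
  · refine (main (-m) (-Δ) (by omega) ?_ ?_).elim
    · rwa [abs_of_neg hm0] at hm
    · push_cast
      rw [show -(m : ℝ) * X - -(Δ : ℝ) * Y = -(m * X - Δ * Y) by ring, abs_neg]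
      exact h
  · refine ⟨hm0, ?_⟩
    by_contra hne
    have : (1 : ℝ) ≤ |(Δ : ℝ)| := by exact_mod_cast Int.one_le_abs hne
    rw [hm0, Int.cast_zero, zero_mul, zero_sub, abs_neg, abs_mul, abs_of_pos hY] at h
    nlinarith
  · refine (main m Δ hm0 ?_ h).elim
    rwa [abs_of_pos hm0] at hm

lemma den_next (p : Basis3) (i j a s t : ℤ) :
    (p.next i j a s t).den = a * p.den - j * p.2.1.2.2 - i * p.2.2.2.2 := by
  simp [next, den]

/-- Two children with the same first index and nearby second coordinates of the centres agree. -/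
lemma IsNode.eq_of_near_snd (h : IsNode Q Z z p) (hQ : 0 < Q) (hZ : 0 < Z) (hQ' : 0 < Q')
    (hQ'' : 0 < Q'') (hZ'' : 0 ≤ Z'') {i j a s t j₂ a₂ s₂ t₂ : ℤ}
    (hc : IsNode Q' Z' z' (p.next i j a s t)) (hc₂ : IsNode Q' Z' z' (p.next i j₂ a₂ s₂ t₂))
    {W A : ℝ} {n : ℕ} (hW0 : 0 ≤ W) (hA1 : 1 ≤ A) (hW : W < Z' / (2 * Z))
    (hWZ : 48 * Z'' * Q' ≤ W * Z * Q'') (hA : W + 2 * Q' / Q ≤ (A - 1) * (Z' / (2 * Z)))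
    (hgood : ∀ m Δ : ℤ, 0 < m → m < n → |(Δ : ℝ)| ≤ A * m → IsCoprime m Δ →
      W < |m * ((a : ℝ) - i * ((p.2.2.2.2 + p.2.1.2.2 * (p.cov'.1 / p.cov.1)) / p.den)) -
        Δ * ((j : ℝ) - i * (p.cov'.1 / p.cov.1))|)
    (hj : |j₂ - j| < n)
    (hy : |(p.next i j a s t).center.2 - (p.next i j₂ a₂ s₂ t₂).center.2| ≤
      3 * (2 * Z'' / (Q'' * Q'))) : j₂ = j ∧ a₂ = a := by
  have hq : (0 : ℝ) < p.den := hQ.trans_le h.le_den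
  have hd : (0 : ℝ) < p.cov.1 := lt_of_lt_of_le (by linarith) h.le_fst
  have hq1 : (0 : ℝ) < (p.next i j a s t).den := hQ'.trans_le hc.le_den
  have hq2 : (0 : ℝ) < (p.next i j₂ a₂ s₂ t₂).den := hQ'.trans_le hc₂.le_den
  set X : ℝ := (a : ℝ) - i * ((p.2.2.2.2 + p.2.1.2.2 * (p.cov'.1 / p.cov.1)) / p.den) with hX
  set Y : ℝ := (j : ℝ) - i * (p.cov'.1 / p.cov.1) with hY
  have hd1 : ((p.next i j a s t).cov.1 : ℝ) = p.cov.1 * Y := by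
    rw [cov_next, hY]
    simp
    field_simp
  have hd2 : ((p.next i j₂ a₂ s₂ t₂).cov.1 : ℝ) = p.cov.1 * Y + (j₂ - j) * p.cov.1 := by
    rw [cov_next, hY]
    simp
    field_simp
    ring
  have hden1 : ((p.next i j a s t).den : ℝ) = p.den * X - p.2.1.2.2 * Y := by
    rw [den_next, hX, hY]
    push_cast
    field_simp
    ring
  have hden2 : ((p.next i j₂ a₂ s₂ t₂).den : ℝ) =
      p.den * X - p.2.1.2.2 * Y + (a₂ - a) * p.den - (j₂ - j) * p.2.1.2.2 := by
    rw [← hden1, den_next, den_next]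
    push_cast
    ring
  have hYlow : Z' / (2 * Z) ≤ Y := by
    have h1 := hc.le_fst
    rw [hd1] at h1
    have h2 : 0 ≤ Y := by
      by_contra hcon
      have h3 : 0 < Z' / (2 * Z) := hW0.trans_lt hW
      have h4 : 0 < Z' := by
        by_contra h5
        exact absurd h3 (not_lt.2 (div_nonpos_of_nonpos_of_nonneg (by linarith) (by linarith)))
      nlinarith
    rw [div_le_iff₀ (by linarith)]
    nlinarith [h.fst_le]
  have hXabs : |X| ≤ 2 * Q' / Q + Y := by
    have h0 : 0 ≤ Y := (hW0.trans hW.le).trans hYlow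
    have e : X = ((p.next i j a s t).den + p.2.1.2.2 * Y) / p.den := by
      rw [hden1]
      field_simp
      ring
    rw [e, abs_div, abs_of_pos hq, div_le_iff₀ hq]
    calc _ ≤ |((p.next i j a s t).den : ℝ)| + |(p.2.1.2.2 : ℝ) * Y| := abs_add_le _ _
      _ ≤ 2 * Q' + p.den * Y := by
          rw [abs_of_pos hq1, abs_mul, abs_of_nonneg h0]
          gcongr
          · exact hc.den_lt.le
          · exact h.abs_le_den
      _ ≤ 2 * Q' / Q * p.den + p.den * Y := by
          have : 2 * Q' ≤ 2 * Q' / Q * p.den := by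
            rw [div_mul_eq_mul_div, le_div_iff₀ hQ]
            gcongr
            exact h.le_den
          linarith
      _ = _ := by ring
  have hlin : |((j₂ - j : ℤ) : ℝ) * X - ((a₂ - a : ℤ) : ℝ) * Y| ≤ W := by
    have hcen : (p.next i j a s t).center.2 - (p.next i j₂ a₂ s₂ t₂).center.2 =
        (p.cov.1 * (((j₂ - j : ℤ) : ℝ) * X - ((a₂ - a : ℤ) : ℝ) * Y)) /
          ((p.next i j a s t).den * (p.next i j₂ a₂ s₂ t₂).den) := by
      have hdz : p.den ≠ 0 := by exact_mod_cast hq.ne'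
      have e1 := center_next_snd p i j a s t hdz (by exact_mod_cast hq1.ne')
      have e2 := center_next_snd p i j₂ a₂ s₂ t₂ hdz (by exact_mod_cast hq2.ne')
      rw [show (p.next i j a s t).center.2 - (p.next i j₂ a₂ s₂ t₂).center.2 =
        ((p.next i j a s t).center.2 - p.center.2) -
          ((p.next i j₂ a₂ s₂ t₂).center.2 - p.center.2) by ring, e1, e2, neg_sub_neg,
        div_sub_div _ _ (by positivity) (by positivity),
        div_eq_div_iff (by positivity) (by positivity), hd1, hd2]
      push_cast
      have e3 : (p.cov.1 * Y + (j₂ - j) * p.cov.1) * ((p.next i j a s t).den : ℝ) -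
          (p.next i j₂ a₂ s₂ t₂).den * (p.cov.1 * Y) =
          p.den * (p.cov.1 * ((j₂ - j) * X - (a₂ - a) * Y)) := by
        rw [hden1, hden2]
        ring
      linear_combination (p.den * (p.next i j a s t).den * (p.next i j₂ a₂ s₂ t₂).den : ℝ) * e3
    rw [hcen, abs_div, abs_mul, abs_of_pos hd, abs_of_pos (mul_pos hq1 hq2),
      div_le_iff₀ (mul_pos hq1 hq2)] at hy
    have hqq : ((p.next i j a s t).den : ℝ) * (p.next i j₂ a₂ s₂ t₂).den ≤ 4 * Q' ^ 2 := by
      nlinarith [hc.den_lt, hc₂.den_lt]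
    set L := |((j₂ - j : ℤ) : ℝ) * X - ((a₂ - a : ℤ) : ℝ) * Y| with hL
    have h5 : Z / 2 * L ≤ 24 * Z'' * Q' / Q'' := by
      calc Z / 2 * L ≤ p.cov.1 * L := by
            gcongr
            exact h.le_fst
        _ ≤ _ := hy
        _ ≤ 3 * (2 * Z'' / (Q'' * Q')) * (4 * Q' ^ 2) := by gcongr
        _ = _ := by field_simp; ring
    rw [le_div_iff₀ hQ''] at h5
    have h6 : L * (Z * Q'') ≤ W * (Z * Q'') := by linarith
    exact le_of_mul_le_mul_right h6 (by positivity)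
  have := eq_zero_of_abs_sub_le hgood (hW.trans_le hYlow) ?_ hW0 hj hlin
  · omega
  · have : (A - 1) * (Z' / (2 * Z)) ≤ (A - 1) * Y :=
      mul_le_mul_of_nonneg_left hYlow (by linarith)
    linarith

end Basis3

namespace Basis3

variable {Q Z z Q' Z' z' Q'' Z'' : ℝ} {p p' : Basis3}

lemma cov_next_fst_mul
    (h : p.cov.1 * p.2.2.1 + p.cov.2.1 * p.2.2.2.1 + p.cov.2.2 * p.2.2.2.2 = 1)
    (i j a s t : ℤ) :
    ((p.next i j a s t).cov.1 : ℝ) * p.cov.2.1 =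
      p.cov.1 * (p.next i j a s t).cov.2.1 + i * p.den := by
  have := cov_mul_sub_eq_den h
  have e : (p.next i j a s t).cov.1 * p.cov.2.1 =
      p.cov.1 * (p.next i j a s t).cov.2.1 + i * p.den := by
    rw [cov_next]
    simp
    linear_combination i * this
  exact_mod_cast e

lemma eq_of_next_fst_eq
    (h : p.cov.1 * p.2.2.1 + p.cov.2.1 * p.2.2.2.1 + p.cov.2.2 * p.2.2.2.2 = 1)
    {i j a s t i₂ j₂ a₂ s₂ t₂ : ℤ}
    (he : (p.next i j a s t).1 = (p.next i₂ j₂ a₂ s₂ t₂).1) : i = i₂ := by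
  have key : ∀ i j a s t : ℤ, p.cov.1 * (p.next i j a s t).1.1 +
      p.cov.2.1 * (p.next i j a s t).1.2.1 + p.cov.2.2 * (p.next i j a s t).1.2.2 = -i := by
    intro i j a s t
    simp only [cov, next, cr, Prod.fst_sub, Prod.snd_sub,
      Prod.smul_fst, Prod.smul_snd, smul_eq_mul] at h ⊢
    linear_combination (-i) * h
  have h1 := key i j a s t
  have h2 := key i₂ j₂ a₂ s₂ t₂
  rw [he] at h1
  linarith

lemma le_ceil_add_mul {x q : ℝ} (hq : 0 < q) (k : ℕ) :
    x ≤ ((⌈x / q⌉ + (k : ℤ) : ℤ) : ℝ) * q := by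
  rw [← div_le_iff₀ hq]
  refine (Int.le_ceil _).trans ?_
  push_cast
  exact le_add_of_nonneg_right (Nat.cast_nonneg k)

lemma ceil_add_mul_lt {x q c : ℝ} (hq : 0 < q) {k n : ℕ} (hk : k < n) (hn : n * q ≤ c) :
    ((⌈x / q⌉ + (k : ℤ) : ℤ) : ℝ) * q < x + c := by
  have h1 : (k : ℝ) + 1 ≤ n := by exact_mod_cast hk
  have h2 := Int.ceil_lt_add_one (x / q)
  calc ((⌈x / q⌉ + (k : ℤ) : ℤ) : ℝ) * q < (x / q + n) * q := by
        refine mul_lt_mul_of_pos_right ?_ hq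
        push_cast
        linarith
    _ = x + n * q := by field_simp
    _ ≤ x + c := by linarith

lemma IsNode.next (h : IsNode Q Z z p) (hQ : 0 < Q) (hZ : 0 < Z) (hz : 0 < z)
    (hZ' : 0 < Z') (hz' : 0 < z') (hQQ' : 2 * Q ≤ Q') (hzZ : Z * z' ≤ Z' * z) {i j a s t : ℤ}
    (hst : j * t - i * s = 1)
    (hi1 : 1 / 2 * Z' * p.cov.2.1 - 7 / 8 * p.cov.1 * z' ≤ i * p.den)
    (hi2 : i * p.den ≤ 1 / 2 * Z' * p.cov.2.1 - 7 / 8 * p.cov.1 * z' + Z' * z / 8)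
    (hj1 : 7 / 8 * z' + i * p.cov'.2.1 ≤ j * p.cov.2.1)
    (hj2 : j * p.cov.2.1 ≤ 7 / 8 * z' + i * p.cov'.2.1 + z' / 8)
    (ha1 : Q' + j * p.2.1.2.2 + i * p.2.2.2.2 ≤ a * p.den)
    (ha2 : a * p.den < Q' + j * p.2.1.2.2 + i * p.2.2.2.2 + Q') :
    IsNode Q' Z' z' (p.next i j a s t) := by
  have hq : (0 : ℝ) < p.den := hQ.trans_le h.le_den
  have hd1 : (0 : ℝ) < p.cov.1 := lt_of_lt_of_le (by linarith) h.le_fst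
  have hd2 : (0 : ℝ) < p.cov.2.1 := lt_of_lt_of_le (by linarith) h.le_snd
  have hdz : (p.cov.1 : ℝ) * z' ≤ Z' * z := (mul_le_mul_of_nonneg_right h.fst_le hz'.le).trans hzZ
  have hZd' : Z' * (7 / 8 * z) ≤ Z' * p.cov.2.1 := mul_le_mul_of_nonneg_left h.le_snd hZ'.le
  have hZz : 0 < Z' * z := mul_pos hZ' hz
  have hcov2 : ((p.next i j a s t).cov.2.1 : ℝ) = j * p.cov.2.1 - i * p.cov'.2.1 := by
    rw [cov_next]
    simp
  have hmul := cov_next_fst_mul h.det i j a s t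
  have hden : ((p.next i j a s t).den : ℝ) = a * p.den - j * p.2.1.2.2 - i * p.2.2.2.2 := by
    rw [den_next]
    push_cast
    rfl
  have hs1 : 7 / 8 * z' ≤ (p.next i j a s t).cov.2.1 := by linarith
  have hs2 : ((p.next i j a s t).cov.2.1 : ℝ) ≤ z' := by linarith
  refine ⟨det_next h.det hst, by linarith, by linarith, ?_, ?_, ?_, hs1, hs2⟩
  · change |(p.den : ℝ)| ≤ _
    rw [abs_of_pos hq]
    linarith [h.den_lt]
  · refine le_of_mul_le_mul_right ?_ hd2
    have := mul_le_mul_of_nonneg_left hs1 hd1.le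
    linarith
  · refine le_of_mul_le_mul_right ?_ hd2
    have := mul_le_mul_of_nonneg_left hs2 hd1.le
    linarith

/-- A node has many children, with well distributed centres. -/
lemma IsNode.exists_children (h : IsNode Q Z z p) (hQ : 0 < Q) (hZ : 0 < Z) (hz : 0 < z)
    (hZ' : 0 < Z') (hz' : 0 < z') (hQ'' : 0 < Q'') (hZ'' : 0 ≤ Z'') (hQQ' : 2 * Q ≤ Q')
    {W A : ℝ} {nᵢ nⱼ nₐ B N : ℕ} (hW0 : 0 ≤ W) (hA1 : 1 ≤ A) (hW : W < Z' / (2 * Z))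
    (hWZ : 48 * Z'' * Q' ≤ W * Z * Q'') (hA : W + 2 * Q' / Q ≤ (A - 1) * (Z' / (2 * Z)))
    (hnj : nⱼ * z ≤ z' / 8) (hni : nᵢ ≤ Z' * z / (16 * Q)) (hna : nₐ ≤ Q' / (2 * Q))
    (hzZ : Z * z' ≤ Z' * z) (hB : Z' * z / Q ≤ B)
    (hcop : ((nᵢ : ℝ) + nⱼ) * (1 + Real.log B) + B + nⱼ ≤ nᵢ * nⱼ / 8)
    (hstr : (2 * A + 1) * (2 * W + 1) * 2 * nⱼ ≤ nₐ / 16)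
    (hN : (N + 1 : ℝ) ≤ nᵢ * nⱼ * nₐ / 16) :
    ∃ (f : Fin (N + 1) → Basis3) (l : Fin (N + 1) → ℕ),
      (∀ c, l c < nᵢ) ∧ (∀ c, IsNode Q' Z' z' (f c)) ∧
      (∀ c, |(f c).center.1 - p.center.1| ≤ z' / (Q' * Q)) ∧
      (∀ c, |(f c).center.2 - p.center.2| ≤ Z' / (Q' * Q)) ∧
      (∀ c c', (f c).1 = (f c').1 → l c = l c') ∧
      ∀ c c', l c = l c' →
        |(f c).center.2 - (f c').center.2| ≤ 3 * (2 * Z'' / (Q'' * Q')) → c = c' := by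
  have hQ' : 0 < Q' := by linarith
  have hq : (0 : ℝ) < p.den := hQ.trans_le h.le_den
  have hd1 : (0 : ℝ) < p.cov.1 := lt_of_lt_of_le (by linarith) h.le_fst
  have hd2 : (0 : ℝ) < p.cov.2.1 := lt_of_lt_of_le (by linarith) h.le_snd
  set i₀ : ℤ := ⌈(1 / 2 * Z' * p.cov.2.1 - 7 / 8 * p.cov.1 * z') / p.den⌉ with hi₀
  set j₀ : ℕ → ℤ := fun i => ⌈(7 / 8 * z' + (i₀ + (i : ℤ) : ℤ) * p.cov'.2.1) / p.cov.2.1⌉ with hj₀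
  set a₀ : ℕ → ℕ → ℤ := fun i j => ⌈(Q' + (j₀ i + (j : ℤ) : ℤ) * p.2.1.2.2 +
    (i₀ + (i : ℤ) : ℤ) * p.2.2.2.2) / p.den⌉ with ha₀
  have hni' : (nᵢ : ℝ) * p.den ≤ Z' * z / 8 := by
    rw [le_div_iff₀ (by positivity)] at hni
    nlinarith [h.den_lt, (Nat.cast_nonneg nᵢ : (0 : ℝ) ≤ nᵢ)]
  have hna' : (nₐ : ℝ) * p.den ≤ Q' := by
    rw [le_div_iff₀ (by positivity)] at hna
    nlinarith [h.den_lt, (Nat.cast_nonneg nₐ : (0 : ℝ) ≤ nₐ)]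
  have hnj' : (nⱼ : ℝ) * p.cov.2.1 ≤ z' / 8 := le_trans (by gcongr; exact h.snd_le) hnj
  have hilow : ∀ i : ℕ, 1 / 2 * Z' * p.cov.2.1 - 7 / 8 * p.cov.1 * z' ≤
      ((i₀ + (i : ℤ) : ℤ) : ℝ) * p.den := fun i => le_ceil_add_mul hq i
  have hiup : ∀ i : ℕ, i < nᵢ → ((i₀ + (i : ℤ) : ℤ) : ℝ) * p.den ≤
      1 / 2 * Z' * p.cov.2.1 - 7 / 8 * p.cov.1 * z' + Z' * z / 8 :=
    fun i hi => (ceil_add_mul_lt hq hi hni').le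
  have hdz : (p.cov.1 : ℝ) * z' ≤ Z' * z := (mul_le_mul_of_nonneg_right h.fst_le hz'.le).trans hzZ
  have hZd : Z' * p.cov.2.1 ≤ Z' * z := mul_le_mul_of_nonneg_left h.snd_le hZ'.le
  have hZd' : Z' * (7 / 8 * z) ≤ Z' * p.cov.2.1 := mul_le_mul_of_nonneg_left h.le_snd hZ'.le
  have hZz : 0 < Z' * z := mul_pos hZ' hz
  have hdz0 : 0 < (p.cov.1 : ℝ) * z' := mul_pos hd1 hz'
  have hB' : ∀ i < nᵢ, |i₀ + (i : ℤ)| ≤ B := by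
    intro i hi
    have h1 := hilow i
    have h2 := hiup i hi
    have h3 : |((i₀ + (i : ℤ) : ℤ) : ℝ)| * Q ≤ Z' * z := by
      calc |((i₀ + (i : ℤ) : ℤ) : ℝ)| * Q ≤ |((i₀ + (i : ℤ) : ℤ) : ℝ)| * p.den := by
            gcongr
            exact h.le_den
        _ = |((i₀ + (i : ℤ) : ℤ) : ℝ) * p.den| := by rw [abs_mul, abs_of_pos hq]
        _ ≤ Z' * z := by
            rw [abs_le]
            constructor <;> linarith
    have h4 : |((i₀ + (i : ℤ) : ℤ) : ℝ)| ≤ B := by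
      refine le_trans ?_ hB
      rwa [le_div_iff₀ hQ]
    exact_mod_cast h4
  obtain ⟨G, hGsub, hGcard, hG⟩ := exists_good_family nᵢ nⱼ nₐ B i₀ j₀ a₀
    ((p.2.2.2.2 + p.2.1.2.2 * (p.cov'.1 / p.cov.1)) / p.den) (p.cov'.1 / p.cov.1)
    hW0 (by linarith) hB' hcop hstr
  have hcard : Fintype.card (Fin (N + 1)) ≤ Fintype.card G := by
    rw [Fintype.card_fin, Fintype.card_coe]
    have : ((N + 1 : ℕ) : ℝ) ≤ G.card := by
      push_cast
      exact hN.trans hGcard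
    exact_mod_cast this
  obtain ⟨φ⟩ := Function.Embedding.nonempty_of_card_le hcard
  have hst : ∀ c : Fin (N + 1), ∃ s t : ℤ,
      (j₀ (φ c).1.1 + ((φ c).1.2.1 : ℤ)) * t - (i₀ + ((φ c).1.1 : ℤ)) * s = 1 := by
    intro c
    obtain ⟨x, y, hxy⟩ := (hG _ (φ c).2).1
    exact ⟨-x, y, by linarith⟩
  choose s t hst using hst
  have hmem : ∀ c : Fin (N + 1), (φ c).1.1 < nᵢ ∧ (φ c).1.2.1 < nⱼ ∧ (φ c).1.2.2 < nₐ := by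
    intro c
    simpa using hGsub (φ c).2
  set f : Fin (N + 1) → Basis3 := fun c => p.next (i₀ + ((φ c).1.1 : ℤ))
    (j₀ (φ c).1.1 + ((φ c).1.2.1 : ℤ)) (a₀ (φ c).1.1 (φ c).1.2.1 + ((φ c).1.2.2 : ℤ)) (s c) (t c)
    with hf
  have hnode : ∀ c, IsNode Q' Z' z' (f c) := by
    intro c
    obtain ⟨h1, h2, h3⟩ := hmem c
    exact h.next hQ hZ hz hZ' hz' hQQ' hzZ (hst c) (hilow _) (hiup _ h1) (le_ceil_add_mul hd2 _)
      (ceil_add_mul_lt hd2 h2 hnj').le (le_ceil_add_mul hq _)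
      (ceil_add_mul_lt hq h3 hna')
  refine ⟨f, fun c => (φ c).1.1, fun c => (hmem c).1, hnode, ?_, ?_, ?_, ?_⟩
  · intro c
    have hq1 := hQ'.trans_le (hnode c).le_den
    rw [center_next_fst _ _ _ _ _ _ (by exact_mod_cast hq.ne') (by exact_mod_cast hq1.ne')]
    change |((f c).cov.2.1 : ℝ) / (p.den * (f c).den)| ≤ _
    rw [abs_div, abs_of_pos (mul_pos hq hq1), mul_comm Q',
      abs_of_nonneg (le_trans (by positivity) (hnode c).le_snd)]
    gcongr
    · exact (hnode c).snd_le
    · exact h.le_den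
    · exact (hnode c).le_den
  · intro c
    have hq1 := hQ'.trans_le (hnode c).le_den
    rw [center_next_snd _ _ _ _ _ _ (by exact_mod_cast hq.ne') (by exact_mod_cast hq1.ne')]
    change |-(((f c).cov.1 : ℝ) / (p.den * (f c).den))| ≤ _
    rw [abs_neg, abs_div, abs_of_pos (mul_pos hq hq1), mul_comm Q',
      abs_of_nonneg (le_trans (by positivity) (hnode c).le_fst)]
    gcongr
    · exact (hnode c).fst_le
    · exact h.le_den
    · exact (hnode c).le_den
  · intro c c' hcc
    have := eq_of_next_fst_eq h.det hcc
    simpa using this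
  · intro c c' hl hcc
    simp only at hl
    have hc := hnode c
    have hc' := hnode c'
    have hg := (hG _ (φ c).2).2
    simp only [hf] at hcc hc hc'
    rw [← hl] at hcc hc'
    have hjj : |j₀ (φ c).1.1 + ((φ c').1.2.1 : ℤ) - (j₀ (φ c).1.1 + ((φ c).1.2.1 : ℤ))| < nⱼ := by
      have := (hmem c).2.1
      have := (hmem c').2.1
      rw [abs_lt]
      constructor <;> omega
    obtain ⟨h1, h2⟩ := h.eq_of_near_snd hQ hZ hQ' hQ'' hZ'' hc hc' hW0 hA1 hW hWZ hA hg hjj hcc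
    have h3 : (φ c').1.2.1 = (φ c).1.2.1 := by omega
    rw [h3] at h2
    have h4 : (φ c').1.2.2 = (φ c).1.2.2 := by omega
    refine φ.injective (Subtype.ext (Prod.ext hl (Prod.ext h3.symm h4.symm)))

end Basis3

/-- Sequences of choices in a tree with `N k + 1` branches at level `k`. -/
abbrev Choices (N : ℕ → ℕ) := ∀ k, Fin (N k + 1)

/-- The uniform measure on sequences of choices. -/
noncomputable def choiceMeasure (N : ℕ → ℕ) : Measure (Choices N) :=
  Measure.infinitePi fun k => (PMF.uniformOfFintype (Fin (N k + 1))).toMeasure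

instance (N : ℕ → ℕ) : IsProbabilityMeasure (choiceMeasure N) := by
  unfold choiceMeasure
  infer_instance

lemma choiceMeasure_cylinder {N : ℕ → ℕ} (ω : Choices N) (n : ℕ) :
    choiceMeasure N {ω' | ∀ k < n, ω' k = ω k} =
      ENNReal.ofReal (∏ k ∈ Finset.range n, 1 / ((N k : ℝ) + 1)) := by
  have e : {ω' : Choices N | ∀ k < n, ω' k = ω k} =
      (Finset.range n : Set ℕ).pi fun k => {ω k} := by
    ext ω'
    simp [Set.mem_pi]
  rw [e, choiceMeasure, Measure.infinitePi_pi _ fun i _ => MeasurableSet.singleton _,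
    ENNReal.ofReal_prod_of_nonneg fun i _ => by positivity]
  refine Finset.prod_congr rfl fun k _ => ?_
  rw [PMF.toMeasure_apply_singleton _ _ (MeasurableSet.singleton _), PMF.uniformOfFintype_apply,
    Fintype.card_fin, one_div, ENNReal.ofReal_inv_of_pos (by positivity)]
  congr 1
  rw [← Nat.cast_succ, ENNReal.ofReal_natCast]

lemma exists_prefixes {N m : ℕ → ℕ} (A : Set (Choices N))
    (hm : ∀ ω ∈ A, ∀ n, {a | ∃ ω' ∈ A, (∀ k < n, ω' k = ω k) ∧ ω' n = a}.ncard ≤ m n) (n : ℕ) :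
    ∃ F : Finset (Choices N), (↑F ⊆ A) ∧ F.card ≤ ∏ k ∈ Finset.range n, m k ∧
      ∀ ω ∈ A, ∃ ω' ∈ F, ∀ k < n, ω k = ω' k := by
  classical
  induction n with
  | zero =>
    rcases A.eq_empty_or_nonempty with rfl | ⟨ω, hω⟩
    · exact ⟨∅, by simp⟩
    · exact ⟨{ω}, by simpa using hω, by simp, fun ω' _ => ⟨ω, by simp⟩⟩
  | succ n ih =>
    obtain ⟨F, hFA, hF, hcov⟩ := ih
    set S : Choices N → Set (Fin (N n + 1)) :=
      fun p => {a | ∃ ω' ∈ A, (∀ k < n, ω' k = p k) ∧ ω' n = a} with hS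
    have hrep : ∀ p (a : Fin (N n + 1)), ∃ ω' : Choices N, a ∈ S p →
        (ω' ∈ A ∧ (∀ k < n, ω' k = p k) ∧ ω' n = a) := by
      intro p a
      by_cases h : a ∈ S p
      · obtain ⟨ω', h1, h2, h3⟩ := h
        exact ⟨ω', fun _ => ⟨h1, h2, h3⟩⟩
      · exact ⟨p, fun h' => absurd h' h⟩
    choose rep hrep using hrep
    refine ⟨F.biUnion fun p => (S p).toFinset.image (rep p), ?_, ?_, ?_⟩
    · intro ω hω
      simp only [Finset.coe_biUnion, Finset.coe_image, Set.coe_toFinset, Set.mem_iUnion,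
        Set.mem_image] at hω
      obtain ⟨p, -, a, ha, rfl⟩ := hω
      exact (hrep p a ha).1
    · rw [Finset.prod_range_succ]
      refine (Finset.card_biUnion_le_card_mul _ _ (m n) fun p hp => ?_).trans
        (Nat.mul_le_mul_right _ hF)
      refine Finset.card_image_le.trans ?_
      rw [← Set.ncard_eq_toFinset_card']
      exact hm p (hFA hp) n
    · intro ω hω
      obtain ⟨p, hp, hpω⟩ := hcov ω hω
      have ha : ω n ∈ S p := ⟨ω, hω, hpω, rfl⟩
      obtain ⟨h1, h2, h3⟩ := hrep p (ω n) ha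
      refine ⟨rep p (ω n), ?_, fun k hk => ?_⟩
      · simp only [Finset.mem_biUnion, Finset.mem_image, Set.mem_toFinset]
        exact ⟨p, hp, _, ha, rfl⟩
      · rcases Nat.lt_succ_iff_lt_or_eq.1 hk with hk | rfl
        · rw [h2 k hk, hpω k hk]
        · exact h3.symm

lemma choiceMeasure_le {N m : ℕ → ℕ} (A : Set (Choices N))
    (hm : ∀ ω ∈ A, ∀ n, {a | ∃ ω' ∈ A, (∀ k < n, ω' k = ω k) ∧ ω' n = a}.ncard ≤ m n) (n : ℕ) :
    choiceMeasure N A ≤ ENNReal.ofReal (∏ k ∈ Finset.range n, (m k : ℝ) / ((N k : ℝ) + 1)) := by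
  obtain ⟨F, -, hF, hcov⟩ := exists_prefixes A hm n
  have hsub : A ⊆ ⋃ ω ∈ F, {ω' | ∀ k < n, ω' k = ω k} := by
    intro ω hω
    obtain ⟨p, hp, hpω⟩ := hcov ω hω
    exact Set.mem_biUnion hp hpω
  have hFR : (F.card : ℝ) ≤ ∏ k ∈ Finset.range n, (m k : ℝ) := by exact_mod_cast hF
  calc choiceMeasure N A ≤ _ := measure_mono hsub
    _ ≤ ∑ ω ∈ F, choiceMeasure N {ω' | ∀ k < n, ω' k = ω k} := measure_biUnion_finset_le _ _
    _ = ∑ ω ∈ F, ENNReal.ofReal (∏ k ∈ Finset.range n, 1 / ((N k : ℝ) + 1)) :=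
        Finset.sum_congr rfl fun ω _ => choiceMeasure_cylinder ω n
    _ = ENNReal.ofReal (F.card * ∏ k ∈ Finset.range n, 1 / ((N k : ℝ) + 1)) := by
        rw [Finset.sum_const, nsmul_eq_mul, ENNReal.ofReal_mul (Nat.cast_nonneg _),
          ENNReal.ofReal_natCast]
    _ ≤ _ := by
        refine ENNReal.ofReal_le_ofReal ?_
        calc _ ≤ (∏ k ∈ Finset.range n, (m k : ℝ)) *
              ∏ k ∈ Finset.range n, 1 / ((N k : ℝ) + 1) :=
              mul_le_mul_of_nonneg_right hFR (Finset.prod_nonneg fun i _ => by positivity)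
          _ = _ := by
              rw [← Finset.prod_mul_distrib]
              exact Finset.prod_congr rfl fun k _ => by ring

lemma exists_limit_of_halving {c ρ : ℕ → ℝ} (hc : ∀ n, |c (n + 1) - c n| ≤ ρ n / 2)
    (hρ : ∀ n, ρ (n + 1) ≤ ρ n / 2) :
    ∃ x, Filter.Tendsto c Filter.atTop (nhds x) ∧ ∀ n, |x - c n| ≤ ρ n := by
  have hgeom : ∀ n p, ρ (n + p) ≤ ρ n / 2 ^ p := by
    intro n p
    induction p with
    | zero => simp
    | succ p ih =>
      rw [← add_assoc, pow_succ, ← div_div]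
      linarith [hρ (n + p)]
  have hd : ∀ n p, dist (c (n + p)) (c (n + p + 1)) ≤ ρ n / 2 / 2 ^ p := by
    intro n p
    rw [dist_comm, Real.dist_eq, div_right_comm]
    linarith [hc (n + p), hgeom n p]
  obtain ⟨x, hx⟩ := cauchySeq_tendsto_of_complete
    (cauchySeq_of_le_geometric_two (C := ρ 0) fun n => by simpa using hd 0 n)
  refine ⟨x, hx, fun n => ?_⟩
  have h1 : Filter.Tendsto (fun p => c (n + p)) Filter.atTop (nhds x) := by
    simpa only [add_comm n] using (Filter.tendsto_add_atTop_iff_nat n).2 hx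
  have := dist_le_of_le_geometric_two_of_tendsto₀ (f := fun p => c (n + p)) (hd n) h1
  rwa [dist_comm, Real.dist_eq] at this

section Tree

variable {𝒩 : ℕ → Type*} {N M : ℕ → ℕ} (child : ∀ k, 𝒩 k → Fin (N k + 1) → 𝒩 (k + 1))
  (root : 𝒩 0)

/-- The node of level `n` reached by a sequence of choices. -/
def branch (ω : Choices N) : ∀ n, 𝒩 n
  | 0 => root
  | n + 1 => child n (branch ω n) (ω n)

lemma branch_congr {ω ω' : Choices N} {n : ℕ} (h : ∀ k < n, ω k = ω' k) :
    branch child root ω n = branch child root ω' n := by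
  induction n with
  | zero => rfl
  | succ n ih => rw [branch, branch, ih fun k hk => h k (by omega), h n (by omega)]

lemma measurable_comp_branch [∀ n, Countable (𝒩 n)] (n : ℕ) (g : 𝒩 n → ℝ) :
    Measurable fun ω => g (branch child root ω n) := by
  let _ : ∀ n, MeasurableSpace (𝒩 n) := fun _ => ⊤
  have : ∀ n, DiscreteMeasurableSpace (𝒩 n) := fun _ => ⟨fun _ => trivial⟩
  have hb : Measurable fun ω => branch child root ω n := by
    induction n with
    | zero => exact measurable_const
    | succ n ih =>
      have : Measurable (Function.uncurry (child n)) := Measurable.of_discrete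
      exact this.comp ((ih fun _ => 0).prodMk (measurable_pi_apply n))
  exact Measurable.of_discrete.comp hb

/-- A lower bound for the Hausdorff dimension of the limit set of a tree of rectangles. -/
theorem le_dimH_of_tree [∀ n, Countable (𝒩 n)] (lab : ∀ k, 𝒩 k → Fin (N k + 1) → ℕ)
    (center : ∀ k, 𝒩 k → ℝ × ℝ) {ρ₁ ρ₂ : ℕ → ℝ}
    (hlab : ∀ k p c, lab k p c < M k)
    (hoff₁ : ∀ k p c, |(center (k + 1) (child k p c)).1 - (center k p).1| ≤ ρ₁ k / 2)
    (hoff₂ : ∀ k p c, |(center (k + 1) (child k p c)).2 - (center k p).2| ≤ ρ₂ k / 2)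
    (hρ₁ : ∀ k, ρ₁ (k + 1) ≤ ρ₁ k / 2) (hρ₂ : ∀ k, ρ₂ (k + 1) ≤ ρ₂ k / 2)
    (hsep : ∀ k p c c',
      |(center (k + 1) (child k p c)).1 - (center (k + 1) (child k p c')).1| ≤ 3 * ρ₁ (k + 1) →
      |(center (k + 1) (child k p c)).2 - (center (k + 1) (child k p c')).2| ≤ 3 * ρ₂ (k + 1) →
      c = c')
    (hslab : ∀ k p c c', lab k p c = lab k p c' →
      |(center (k + 1) (child k p c)).2 - (center (k + 1) (child k p c')).2| ≤ 3 * ρ₂ (k + 1) →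
      c = c')
    {σ r₀ : ℝ} (hσ : 0 < σ) (hr₀ : 0 < r₀)
    (hmass : ∀ r, 0 < r → r < r₀ → ∃ k₁ k₂, k₁ ≤ k₂ ∧ r ≤ ρ₁ k₁ ∧ r ≤ ρ₂ k₂ ∧
      ∏ k ∈ Finset.range k₂, ((if k < k₁ then 1 else M k : ℕ) : ℝ) / ((N k : ℝ) + 1) ≤ r ^ σ)
    {S : Set (ℝ × ℝ)}
    (hS : ∀ (ω : Choices N) (x : ℝ × ℝ),
      (∀ n, |x.1 - (center n (branch child root ω n)).1| ≤ ρ₁ n) →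
      (∀ n, |x.2 - (center n (branch child root ω n)).2| ≤ ρ₂ n) → x ∈ S) :
    ENNReal.ofReal σ ≤ dimH S := by
  have hlim₁ := fun ω => exists_limit_of_halving
    (c := fun n => (center n (branch child root ω n)).1) (fun n => hoff₁ n _ _) hρ₁
  have hlim₂ := fun ω => exists_limit_of_halving
    (c := fun n => (center n (branch child root ω n)).2) (fun n => hoff₂ n _ _) hρ₂
  choose x₁ hx₁ hx₁' using hlim₁
  choose x₂ hx₂ hx₂' using hlim₂
  set X : Choices N → ℝ × ℝ := fun ω => (x₁ ω, x₂ ω) with hX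
  have hXm : Measurable X := by
    refine Measurable.prodMk ?_ ?_
    · exact measurable_of_tendsto_metrizable
        (fun n => measurable_comp_branch child root n fun p => (center n p).1)
        (tendsto_pi_nhds.2 hx₁)
    · exact measurable_of_tendsto_metrizable
        (fun n => measurable_comp_branch child root n fun p => (center n p).2)
        (tendsto_pi_nhds.2 hx₂)
  have hanti₁ : Antitone ρ₁ := antitone_nat_of_succ_le fun n => by
    have := (abs_nonneg _).trans (hx₁' (fun _ => 0) n)
    linarith [hρ₁ n]
  have hanti₂ : Antitone ρ₂ := antitone_nat_of_succ_le fun n => by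
    have := (abs_nonneg _).trans (hx₂' (fun _ => 0) n)
    linarith [hρ₂ n]
  have hbound : ∀ (U : Set (ℝ × ℝ)) (r : ℝ), 0 < r → r < r₀ →
      (∀ x ∈ U, ∀ y ∈ U, |x.1 - y.1| ≤ r ∧ |x.2 - y.2| ≤ r) →
      choiceMeasure N (X ⁻¹' U) ≤ ENNReal.ofReal (r ^ σ) := by
    intro U r hr hrr hU
    obtain ⟨k₁, k₂, hk, hr₁, hr₂, hprod⟩ := hmass r hr hrr
    have hnear₂ : ∀ n < k₂, ∀ ω ∈ X ⁻¹' U, ∀ ω' ∈ X ⁻¹' U,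
        |(center (n + 1) (branch child root ω (n + 1))).2 -
          (center (n + 1) (branch child root ω' (n + 1))).2| ≤ 3 * ρ₂ (n + 1) := by
      intro n hn ω hω ω' hω'
      have h1 := abs_le.1 (hx₂' ω (n + 1))
      have h2 := abs_le.1 (hx₂' ω' (n + 1))
      have h3 := abs_le.1 (hU _ hω _ hω').2
      have h4 : r ≤ ρ₂ (n + 1) := hr₂.trans (hanti₂ hn)
      simp only [hX] at h3
      rw [abs_le]
      constructor <;> linarith
    have hnear₁ : ∀ n < k₁, ∀ ω ∈ X ⁻¹' U, ∀ ω' ∈ X ⁻¹' U,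
        |(center (n + 1) (branch child root ω (n + 1))).1 -
          (center (n + 1) (branch child root ω' (n + 1))).1| ≤ 3 * ρ₁ (n + 1) := by
      intro n hn ω hω ω' hω'
      have h1 := abs_le.1 (hx₁' ω (n + 1))
      have h2 := abs_le.1 (hx₁' ω' (n + 1))
      have h3 := abs_le.1 (hU _ hω _ hω').1
      have h4 : r ≤ ρ₁ (n + 1) := hr₁.trans (hanti₁ hn)
      simp only [hX] at h3
      rw [abs_le]
      constructor <;> linarith
    refine (choiceMeasure_le (m := fun k => if k < k₁ then 1 else if k < k₂ then M k else N k + 1)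
      _ (fun ω hω n => ?_) k₂).trans (ENNReal.ofReal_le_ofReal (le_trans (le_of_eq ?_) hprod))
    · set T := {a | ∃ ω' ∈ X ⁻¹' U, (∀ k < n, ω' k = ω k) ∧ ω' n = a} with hT
      have hT' : ∀ a ∈ T, ∃ ω' ∈ X ⁻¹' U,
          branch child root ω' (n + 1) = child n (branch child root ω n) a := by
        rintro a ⟨ω', h1, h2, rfl⟩
        exact ⟨ω', h1, by rw [branch, branch_congr child root h2]⟩
      split_ifs with hn1 hn2
      · rw [Set.ncard_le_one]
        intro a ha b hb
        obtain ⟨ω₁, h1, e1⟩ := hT' a ha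
        obtain ⟨ω₂, h2, e2⟩ := hT' b hb
        have hc₁ := hnear₁ n hn1 _ h1 _ h2
        have hc₂ := hnear₂ n (by omega) _ h1 _ h2
        rw [e1, e2] at hc₁ hc₂
        exact hsep _ _ _ _ hc₁ hc₂
      · have hinj : Set.InjOn (lab n (branch child root ω n)) T := by
          intro a ha b hb hab
          obtain ⟨ω₁, h1, e1⟩ := hT' a ha
          obtain ⟨ω₂, h2, e2⟩ := hT' b hb
          have hc₂ := hnear₂ n hn2 _ h1 _ h2
          rw [e1, e2] at hc₂
          exact hslab _ _ _ _ hab hc₂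
        calc T.ncard ≤ ((Finset.range (M n) : Finset ℕ) : Set ℕ).ncard :=
              Set.ncard_le_ncard_of_injOn _ (fun a _ => by simpa using hlab n _ a) hinj
                (Finset.finite_toSet _)
          _ = M n := by rw [Set.ncard_coe_finset, Finset.card_range]
      · calc T.ncard ≤ (Set.univ : Set (Fin (N n + 1))).ncard := Set.ncard_le_ncard (Set.subset_univ _)
          _ = N n + 1 := by rw [Set.ncard_univ, Nat.card_fin]
    · refine Finset.prod_congr rfl fun k hk => ?_
      rw [if_pos (Finset.mem_range.1 hk)]
  have hmain : (choiceMeasure N).map X ≤ μH[σ] := by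
    refine Measure.le_hausdorffMeasure σ _ (ENNReal.ofReal (r₀ / 2))
      (ENNReal.ofReal_pos.2 (by linarith)) fun s hs => ?_
    have hle : (choiceMeasure N).map X s ≤ choiceMeasure N (X ⁻¹' closure s) := by
      rw [← Measure.map_apply hXm isClosed_closure.measurableSet]
      exact measure_mono subset_closure
    refine hle.trans ?_
    have hclose : ∀ r, Metric.ediam s ≤ ENNReal.ofReal r → 0 < r →
        ∀ x ∈ closure s, ∀ y ∈ closure s, |x.1 - y.1| ≤ r ∧ |x.2 - y.2| ≤ r := by
      intro r hsr hr x hx y hy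
      have h1 := Metric.edist_le_ediam_of_mem hx hy
      rw [Metric.ediam_closure] at h1
      have h2 := h1.trans hsr
      rw [edist_dist, ENNReal.ofReal_le_ofReal_iff hr.le, Prod.dist_eq, max_le_iff,
        Real.dist_eq, Real.dist_eq] at h2
      exact h2
    have hfin : Metric.ediam s ≠ ⊤ := ne_top_of_le_ne_top ENNReal.ofReal_ne_top hs
    rcases eq_or_ne (Metric.ediam s) 0 with h0 | h0
    · rw [h0, ENNReal.zero_rpow_of_pos hσ]
      have ht : Filter.Tendsto (fun r : ℝ => ENNReal.ofReal (r ^ σ)) (nhdsWithin 0 (Set.Ioi 0))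
          (nhds 0) := by
        have h1 : Filter.Tendsto (fun r : ℝ => r ^ σ) (nhds 0) (nhds (0 ^ σ)) :=
          (Real.continuousAt_rpow_const 0 σ (Or.inr hσ.le)).tendsto
        rw [Real.zero_rpow hσ.ne'] at h1
        simpa using (ENNReal.tendsto_ofReal h1).mono_left nhdsWithin_le_nhds
      refine ge_of_tendsto ht ?_
      filter_upwards [Ioo_mem_nhdsGT hr₀] with r hr
      exact hbound _ r hr.1 hr.2 (hclose r (by simp [h0]) hr.1)
    · have hpos : 0 < (Metric.ediam s).toReal := ENNReal.toReal_pos h0 hfin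
      have hlt : (Metric.ediam s).toReal < r₀ := by
        have := ENNReal.toReal_le_of_le_ofReal (by linarith) hs
        linarith
      have h1 := hbound _ _ hpos hlt (hclose _ (ENNReal.ofReal_toReal hfin).ge hpos)
      rwa [← ENNReal.ofReal_rpow_of_pos hpos, ENNReal.ofReal_toReal hfin] at h1
  have hne : μH[σ] S ≠ 0 := by
    have h1 : X ⁻¹' S = Set.univ :=
      Set.eq_univ_of_forall fun ω => hS ω (X ω) (hx₁' ω) (hx₂' ω)
    have h2 : (1 : ENNReal) ≤ μH[σ] S := by
      calc (1 : ENNReal) = choiceMeasure N (X ⁻¹' S) := by rw [h1, measure_univ]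
        _ ≤ (choiceMeasure N).map X S := Measure.le_map_apply hXm.aemeasurable S
        _ ≤ _ := hmain S
    exact fun h => by simp [h] at h2
  have := le_dimH_of_hausdorffMeasure_ne_zero (d := σ.toNNReal) (s := S)
    (by rwa [Real.coe_toNNReal _ hσ.le])
  simpa [ENNReal.ofReal] using this

end Tree

namespace Basis3

lemma coprimality_bound {x y L : ℝ} {m n : ℕ} (hx : 0 < x) (hxy : x ≤ y) (hm1 : (1 : ℝ) ≤ m)
    (hm' : x / 16 < m + 1) (hL : 1 + Real.log (y + 1) ≤ L) (hm : 16 * (L + 33) ≤ m)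
    (hn : 16 * (L + 33) ≤ n) :
    ((m : ℝ) + n) * (1 + Real.log (⌈x⌉₊ : ℕ)) + (⌈x⌉₊ : ℕ) + n ≤ m * n / 8 := by
  have hB1 : (⌈x⌉₊ : ℝ) ≤ x + 1 := (Nat.ceil_lt_add_one hx.le).le
  have hlogB : Real.log (⌈x⌉₊ : ℝ) ≤ Real.log (y + 1) :=
    Real.log_le_log (by exact_mod_cast Nat.ceil_pos.2 hx) (by linarith)
  have hB2 : (⌈x⌉₊ : ℝ) ≤ 33 * m := by linarith
  have hn0 : (0 : ℝ) ≤ n := Nat.cast_nonneg n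
  have h1 : ((m : ℝ) + n) * (1 + Real.log (⌈x⌉₊ : ℝ)) ≤ (m + n) * L := by
    gcongr
    linarith
  have h2 : 16 * (L + 33) * n ≤ m * n := by gcongr
  have h3 : 16 * (L + 33) * m ≤ n * m := by gcongr
  linarith

lemma strip_bound {P₁ P₂ : ℝ} {n m : ℕ} (hP₂0 : 0 < P₂) (h1 : 1 ≤ P₂) (hP : P₂ ≤ P₁)
    (hn : n ≤ P₂ / 2 ^ 20) (hm : m = P₁ * P₂ / 2) :
    (2 * (17 * P₂) + 1) * (2 * (128 * P₁ / P₂) + 1) * 2 * n ≤ m / 16 := by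
  have hP₁0 : 0 < P₁ := by linarith
  have hW : 2 * (128 * P₁ / P₂) + 1 ≤ 257 * P₁ / P₂ := by
    have : 1 ≤ P₁ / P₂ := by rwa [le_div_iff₀ hP₂0, one_mul]
    have e1 : 2 * (128 * P₁ / P₂) = 256 * (P₁ / P₂) := by ring
    have e2 : 257 * P₁ / P₂ = 257 * (P₁ / P₂) := by ring
    linarith
  calc (2 * (17 * P₂) + 1) * (2 * (128 * P₁ / P₂) + 1) * 2 * n
      ≤ (35 * P₂) * (257 * P₁ / P₂) * 2 * (P₂ / 2 ^ 20) := by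
        gcongr
        linarith
    _ = 17990 / 2 ^ 20 * (P₁ * P₂) := by
        field_simp
        norm_num
    _ ≤ m / 16 := by
        rw [hm]
        linarith [mul_pos hP₁0 hP₂0]

variable {Q Z z : ℝ} {p : Basis3}

/-- The children of a node when the scales grow geometrically. -/
lemma IsNode.exists_children_of_scale (h : IsNode Q Z z p) (hQ : 0 < Q) (hZ : 0 < Z) (hz : 0 < z)
    {P₁ P₂ P₁' P₂' θ e L : ℝ} {nᵢ nⱼ nₐ N : ℕ} (hθ : 1 / 2 ≤ θ) (hθ1 : θ ≤ 1) (he : 0 < e)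
    (he1 : e ≤ 1) (hP₂ : 512 < P₂) (hP : P₂ ≤ P₁) (hP₁' : 0 < P₁') (hP₂' : P₂ ≤ P₂')
    (hZz : Z * z = e * Q) (hni : nᵢ ≤ θ * e * P₁ / 16) (hni' : θ * e * P₁ / 16 < nᵢ + 1)
    (hnj : nⱼ ≤ P₂ / 2 ^ 20) (hna : nₐ = P₁ * P₂ / 2) (hL : 1 + Real.log (P₁ + 1) ≤ L)
    (hLi : 16 * (L + 33) ≤ nᵢ) (hLj : 16 * (L + 33) ≤ nⱼ)
    (hN : (N + 1 : ℝ) ≤ nᵢ * nⱼ * nₐ / 16) :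
    ∃ (f : Fin (N + 1) → Basis3) (l : Fin (N + 1) → ℕ),
      (∀ c, l c < nᵢ) ∧ (∀ c, IsNode (P₁ * P₂ * Q) (θ * P₁ * Z) (θ * P₂ * z) (f c)) ∧
      (∀ c, |(f c).center.1 - p.center.1| ≤ θ * P₂ * z / (P₁ * P₂ * Q * Q)) ∧
      (∀ c, |(f c).center.2 - p.center.2| ≤ θ * P₁ * Z / (P₁ * P₂ * Q * Q)) ∧
      (∀ c c', (f c).1 = (f c').1 → l c = l c') ∧
      ∀ c c', l c = l c' → |(f c).center.2 - (f c').center.2| ≤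
        3 * (2 * (θ * P₁' * (θ * P₁ * Z)) / (P₁' * P₂' * (P₁ * P₂ * Q) * (P₁ * P₂ * Q))) →
          c = c' := by
  have hP₂0 : 0 < P₂ := by linarith
  have hP₁0 : 0 < P₁ := by linarith
  have hP₂'0 : 0 < P₂' := by linarith
  have hθ0 : 0 < θ := by linarith
  have hlog : 0 ≤ Real.log (P₁ + 1) := Real.log_nonneg (by linarith)
  have hni1 : (1 : ℝ) ≤ nᵢ := by linarith
  have heP' : 0 < θ * e * P₁ := by positivity
  have heP1 : θ * e * P₁ ≤ P₁ := by
    calc θ * e * P₁ ≤ 1 * 1 * P₁ := by gcongr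
      _ = P₁ := by ring
  have hQne := hQ.ne'
  refine h.exists_children (W := 128 * P₁ / P₂) (A := 17 * P₂) (nⱼ := nⱼ) (nₐ := nₐ)
    (B := ⌈θ * e * P₁⌉₊) hQ hZ hz (by positivity) (by positivity) (by positivity) (by positivity)
    ?_ (by positivity) (by linarith) ?_ ?_ ?_ ?_ ?_ ?_ ?_ ?_ ?_ ?_ hN
  · have : 2 ≤ P₁ * P₂ := by nlinarith
    gcongr
  · rw [div_lt_div_iff₀ hP₂0 (by positivity)]
    nlinarith [mul_pos hP₁0 hZ, mul_pos (mul_pos hP₁0 hZ) (by linarith : 0 < P₂ - 512),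
      mul_nonneg (mul_pos (mul_pos hP₁0 hZ) hP₂0).le (by linarith : 0 ≤ θ - 1 / 2)]
  · rw [div_mul_eq_mul_div, div_mul_eq_mul_div, le_div_iff₀ hP₂0]
    have h1 : θ * θ ≤ 1 := by nlinarith
    have h2 : θ * θ * P₂ ≤ 1 * P₂' := by gcongr
    have h3 : 0 ≤ P₁' * P₁ * Z * (P₁ * P₂ * Q) := by positivity
    nlinarith [mul_le_mul_of_nonneg_left h2 h3, mul_nonneg h3 hP₂'0.le]
  · have e1 : 2 * (P₁ * P₂ * Q) / Q = 2 * (P₁ * P₂) := by field_simp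
    have e2 : θ * P₁ * Z / (2 * Z) = θ * P₁ / 2 := by field_simp
    rw [e1, e2]
    have h1 : 128 * P₁ / P₂ ≤ P₁ * P₂ := by
      rw [div_le_iff₀ hP₂0]
      nlinarith [mul_pos hP₁0 hP₂0]
    have h2 : (17 * P₂ - 1) * (1 / 2 * P₁ / 2) ≤ (17 * P₂ - 1) * (θ * P₁ / 2) := by
      have : 0 ≤ 17 * P₂ - 1 := by linarith
      gcongr
    nlinarith [mul_pos hP₁0 hP₂0]
  · have : (nⱼ : ℝ) * z ≤ P₂ / 2 ^ 20 * z := by gcongr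
    have h2 : (1 / 2 : ℝ) * (P₂ * z) ≤ θ * (P₂ * z) := by gcongr
    have h3 : 0 < P₂ * z := mul_pos hP₂0 hz
    linarith
  · have e1 : θ * P₁ * Z * z / (16 * Q) = θ * e * P₁ / 16 := by
      rw [show θ * P₁ * Z * z = θ * P₁ * (Z * z) by ring, hZz]
      field_simp
    rw [e1]
    exact hni
  · rw [hna]
    apply le_of_eq
    field_simp
  · have : Z * z * θ * P₂ ≤ Z * z * θ * P₁ := by gcongr
    linarith
  · have e1 : θ * P₁ * Z * z / Q = θ * e * P₁ := by
      rw [show θ * P₁ * Z * z = θ * P₁ * (Z * z) by ring, hZz]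
      field_simp
    rw [e1]
    exact Nat.le_ceil _
  · exact coprimality_bound heP' heP1 hni1 hni' hL hLi hLj
  · exact strip_bound hP₂0 (by linarith) hP hnj hna

/-- Existence of a root of the tree. -/
lemma exists_isNode (Q : ℕ) (hQ : 0 < Q) (hz : 16 ≤ z) (hzZ : z ≤ Z) :
    ∃ p : Basis3, IsNode Q Z z p := by
  set d : ℤ := ⌊z⌋ - 1 with hd
  have hd1 : (d : ℝ) ≤ z - 1 := by
    rw [hd]
    push_cast
    linarith [Int.floor_le z]
  have hd2 : z - 2 < d := by
    rw [hd]
    push_cast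
    linarith [Int.lt_floor_add_one z]
  have hd0 : (0 : ℝ) < d := by linarith
  set n : ℤ := ⌊(Z - 1) / d⌋ with hn
  have hn1 : (n : ℝ) * d ≤ Z - 1 := by
    rw [← le_div_iff₀ hd0]
    exact Int.floor_le _
  have hn2 : Z - 1 < (n + 1) * d := by
    rw [← div_lt_iff₀ hd0]
    exact Int.lt_floor_add_one _
  have hn3 : (1 : ℝ) ≤ n := by
    have : 1 ≤ n := by
      rw [hn, Int.le_floor, Int.cast_one, le_div_iff₀ hd0]
      linarith
    exact_mod_cast this
  have hQR : (1 : ℝ) ≤ Q := by exact_mod_cast hQ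
  refine ⟨((d, -(n * d + 1), Q), (0, 0, 1), (1, -n, 0)), ?_, ?_, ?_, ?_, ?_, ?_, ?_, ?_⟩
  · simp [cov, cr]
    ring
  · simp [den]
  · simp [den]
    linarith
  · simpa [den] using hQR
  · simp [cov, cr]
    nlinarith
  · simp [cov, cr]
    linarith
  · simp [cov, cr]
    linarith
  · simp [cov, cr]
    linarith

end Basis3

/-- The lower bound for the denominators of the nodes of level `k`. -/
noncomputable def scaleQ (k : ℕ) : ℝ := 2 ^ ((k : ℝ) ^ 2)

/-- The size, in the direction of weight `w`, of the covectors of the nodes of level `k`. -/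
noncomputable def scaleZ (w δ : ℝ) (k : ℕ) : ℝ := 2 ^ (w * (k : ℝ) ^ 2 - δ * k)

/-- The width of the rectangles of level `k` in the direction dual to the weight `w`. -/
noncomputable def scaleWidth (w δ : ℝ) (k : ℕ) : ℝ :=
  2 * scaleZ w δ (k + 1) / (scaleQ (k + 1) * scaleQ k)

/-- The number of vertical lines containing the children of a node of level `k`. -/
noncomputable def lineCount (w₁ δ : ℝ) (k : ℕ) : ℕ := ⌊(2 : ℝ) ^ ((2 * k + 1) * (w₁ - δ)) / 16⌋₊

/-- The number of directions on each vertical line. -/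
noncomputable def dirCount (w₂ : ℝ) (k : ℕ) : ℕ := ⌊(2 : ℝ) ^ ((2 * k + 1) * w₂) / 2 ^ 20⌋₊

/-- One less than the number of children of a node of level `k`. -/
noncomputable def childCount (w₁ w₂ δ : ℝ) (k : ℕ) : ℕ :=
  ⌊(lineCount w₁ δ k * dirCount w₂ k * (2 ^ (2 * k) : ℕ) : ℝ) / 16⌋₊ - 1

section Scales

variable {w w₁ w₂ δ : ℝ} {k : ℕ}

lemma scaleQ_pos : 0 < scaleQ k := by unfold scaleQ; positivity

lemma scaleZ_pos : 0 < scaleZ w δ k := by unfold scaleZ; positivity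

lemma scaleWidth_pos : 0 < scaleWidth w δ k := by
  have := scaleQ_pos (k := k)
  have := scaleQ_pos (k := k + 1)
  have := scaleZ_pos (w := w) (δ := δ) (k := k + 1)
  unfold scaleWidth
  positivity

lemma scaleWidth_eq : scaleWidth w δ k =
    2 ^ (1 + (w - 1) * ((k : ℝ) + 1) ^ 2 - δ * (k + 1) - (k : ℝ) ^ 2) := by
  unfold scaleWidth scaleZ scaleQ
  rw [← Real.rpow_add two_pos]
  nth_rw 1 [← Real.rpow_one 2]
  rw [← Real.rpow_add two_pos, ← Real.rpow_sub two_pos]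
  congr 1
  push_cast
  ring

lemma scaleQ_succ (hsum : w₁ + w₂ = 1) :
    scaleQ (k + 1) = 2 ^ ((2 * k + 1) * w₁) * 2 ^ ((2 * k + 1) * w₂) * scaleQ k := by
  unfold scaleQ
  rw [← Real.rpow_add two_pos, ← Real.rpow_add two_pos]
  congr 1
  push_cast
  linear_combination (-(2 * k + 1) : ℝ) * hsum

lemma scaleZ_succ :
    scaleZ w δ (k + 1) = 2 ^ (-δ) * 2 ^ ((2 * k + 1) * w) * scaleZ w δ k := by
  unfold scaleZ
  rw [← Real.rpow_add two_pos, ← Real.rpow_add two_pos]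
  congr 1
  push_cast
  ring

lemma scaleZ_mul_scaleZ (hsum : w₁ + w₂ = 1) :
    scaleZ w₁ δ k * scaleZ w₂ δ k = 2 ^ (-(2 * δ * k)) * scaleQ k := by
  unfold scaleZ scaleQ
  rw [← Real.rpow_add two_pos, ← Real.rpow_add two_pos]
  congr 1
  linear_combination ((k : ℝ) ^ 2) * hsum

lemma scaleWidth_succ_le (hw : w ≤ 1) (hδ : 0 ≤ δ) :
    scaleWidth w δ (k + 1) ≤ scaleWidth w δ k / 2 := by
  rw [scaleWidth_eq, scaleWidth_eq, le_div_iff₀ two_pos]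
  nth_rw 2 [← Real.rpow_one 2]
  rw [← Real.rpow_add two_pos]
  apply Real.rpow_le_rpow_of_exponent_le one_le_two
  push_cast
  have hk : (0 : ℝ) ≤ k := k.cast_nonneg
  nlinarith [mul_nonneg (sub_nonneg.2 hw) hk]

/-- The conditions on a level of the tree under which its nodes have enough children. -/
structure IsLarge (w₁ w₂ δ : ℝ) (k : ℕ) : Prop where
  snd_pos : 0 < w₂
  snd_le : w₂ ≤ w₁
  sum_eq : w₁ + w₂ = 1
  pos : 0 < δ
  two_mul_le : 2 * δ ≤ w₂
  le_rpow : 2 ^ 25 * ((k : ℝ) + 19) ≤ 2 ^ (w₂ * k)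

namespace IsLarge

lemma le_rpow_of_le (h : IsLarge w₁ w₂ δ k) {x : ℝ} (hx : w₂ * k ≤ x) :
    2 ^ 25 * ((k : ℝ) + 19) ≤ 2 ^ x :=
  h.le_rpow.trans (Real.rpow_le_rpow_of_exponent_le one_le_two hx)

lemma le_line_exponent (h : IsLarge w₁ w₂ δ k) : w₂ * k ≤ (2 * k + 1) * (w₁ - δ) := by
  have := h.two_mul_le
  have := h.snd_le
  have := h.pos
  have hk : (0 : ℝ) ≤ k := k.cast_nonneg
  nlinarith

lemma le_dir_exponent (h : IsLarge w₁ w₂ δ k) : w₂ * k ≤ (2 * k + 1) * w₂ := by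
  have := h.snd_pos
  have hk : (0 : ℝ) ≤ k := k.cast_nonneg
  nlinarith

lemma le_lineCount (h : IsLarge w₁ w₂ δ k) : 32 * (k : ℝ) + 607 ≤ lineCount w₁ δ k := by
  have h1 := h.le_rpow_of_le h.le_line_exponent
  have h2 := Nat.lt_floor_add_one ((2 : ℝ) ^ ((2 * k + 1) * (w₁ - δ)) / 16)
  have hk : (0 : ℝ) ≤ k := k.cast_nonneg
  unfold lineCount
  linarith

lemma le_dirCount (h : IsLarge w₁ w₂ δ k) : 32 * (k : ℝ) + 607 ≤ dirCount w₂ k := by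
  have h1 := h.le_rpow_of_le h.le_dir_exponent
  have h2 := Nat.lt_floor_add_one ((2 : ℝ) ^ ((2 * k + 1) * w₂) / 2 ^ 20)
  unfold dirCount
  linarith

lemma childCount_add_one (h : IsLarge w₁ w₂ δ k) : (childCount w₁ w₂ δ k : ℝ) + 1 =
    ⌊(lineCount w₁ δ k * dirCount w₂ k * (2 ^ (2 * k) : ℕ) : ℝ) / 16⌋₊ := by
  have h1 := h.le_lineCount
  have h2 := h.le_dirCount
  have hk : (0 : ℝ) ≤ k := k.cast_nonneg
  have h3 : 1 ≤ ⌊(lineCount w₁ δ k * dirCount w₂ k * (2 ^ (2 * k) : ℕ) : ℝ) / 16⌋₊ := by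
    rw [Nat.one_le_floor_iff, le_div_iff₀ (by norm_num)]
    have h4 : (1 : ℝ) ≤ (2 ^ (2 * k) : ℕ) := by exact_mod_cast Nat.one_le_two_pow
    calc (1 : ℝ) * 16 ≤ 16 * 1 * 1 := by norm_num
      _ ≤ _ := by gcongr <;> linarith
  unfold childCount
  exact_mod_cast Nat.sub_add_cancel h3

lemma exists_children (h : IsLarge w₁ w₂ δ k) {p : Basis3}
    (hp : Basis3.IsNode (scaleQ k) (scaleZ w₁ δ k) (scaleZ w₂ δ k) p) :
    ∃ (f : Fin (childCount w₁ w₂ δ k + 1) → Basis3) (l : Fin (childCount w₁ w₂ δ k + 1) → ℕ),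
      (∀ c, l c < lineCount w₁ δ k) ∧
      (∀ c, Basis3.IsNode (scaleQ (k + 1)) (scaleZ w₁ δ (k + 1)) (scaleZ w₂ δ (k + 1)) (f c)) ∧
      (∀ c, |(f c).center.1 - p.center.1| ≤ scaleWidth w₂ δ k / 2) ∧
      (∀ c, |(f c).center.2 - p.center.2| ≤ scaleWidth w₁ δ k / 2) ∧
      (∀ c c', (f c).1 = (f c').1 → l c = l c') ∧
      ∀ c c', l c = l c' → |(f c).center.2 - (f c').center.2| ≤ 3 * scaleWidth w₁ δ (k + 1) →
        c = c' := by
  have hw₂ := h.snd_pos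
  have hw := h.snd_le
  have hδ := h.pos
  have hδ2 := h.two_mul_le
  have hk : (0 : ℝ) ≤ k := k.cast_nonneg
  have hw₁ : w₁ ≤ 1 := by linarith [h.sum_eq]
  have hP₁ : (2 : ℝ) ^ ((2 * k + 1) * w₁) ≤ 2 ^ (2 * k + 1) := by
    rw [← Real.rpow_natCast]
    apply Real.rpow_le_rpow_of_exponent_le one_le_two
    push_cast
    nlinarith
  have hlog : Real.log ((2 : ℝ) ^ ((2 * k + 1) * w₁) + 1) ≤ 2 * k + 2 := by
    calc Real.log ((2 : ℝ) ^ ((2 * k + 1) * w₁) + 1) ≤ Real.log (2 ^ (2 * k + 2)) := by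
          apply Real.log_le_log (by positivity)
          have : (1 : ℝ) ≤ 2 ^ (2 * k + 1) := one_le_pow₀ one_le_two
          rw [pow_succ 2 (2 * k + 1)]
          linarith
      _ = (2 * k + 2) * Real.log 2 := by rw [Real.log_pow]; push_cast; ring
      _ ≤ (2 * k + 2) * 1 := by
          gcongr
          linarith [Real.log_two_lt_d9]
      _ = _ := by ring
  have heq : (2 : ℝ) ^ (-δ) * 2 ^ (-(2 * δ * k)) * 2 ^ ((2 * k + 1) * w₁) / 16 =
      2 ^ ((2 * k + 1) * (w₁ - δ)) / 16 := by
    rw [← Real.rpow_add two_pos, ← Real.rpow_add two_pos]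
    congr 2
    ring
  have h1 := h.le_lineCount
  have h2 := h.le_dirCount
  obtain ⟨f, l, h1, h2, h3, h4, h5, h6⟩ := hp.exists_children_of_scale scaleQ_pos scaleZ_pos
    scaleZ_pos (P₁ := 2 ^ ((2 * k + 1) * w₁)) (P₂ := 2 ^ ((2 * k + 1) * w₂))
    (P₁' := 2 ^ ((2 * (k + 1 : ℕ) + 1) * w₁)) (P₂' := 2 ^ ((2 * (k + 1 : ℕ) + 1) * w₂))
    (θ := 2 ^ (-δ)) (e := 2 ^ (-(2 * δ * k))) (L := 2 * k + 3) (nᵢ := lineCount w₁ δ k)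
    (nⱼ := dirCount w₂ k) (nₐ := 2 ^ (2 * k)) (N := childCount w₁ w₂ δ k)
    (by
      rw [one_div, ← Real.rpow_neg_one]
      exact Real.rpow_le_rpow_of_exponent_le one_le_two (by linarith))
    (Real.rpow_le_one_of_one_le_of_nonpos one_le_two (by linarith))
    (by positivity)
    (Real.rpow_le_one_of_one_le_of_nonpos one_le_two (by
      rw [neg_nonpos]
      positivity))
    (by linarith [h.le_rpow_of_le h.le_dir_exponent])
    (Real.rpow_le_rpow_of_exponent_le one_le_two (by gcongr))
    (by positivity)
    (Real.rpow_le_rpow_of_exponent_le one_le_two (by gcongr; simp))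
    (scaleZ_mul_scaleZ h.sum_eq)
    (heq ▸ Nat.floor_le (by positivity))
    (heq ▸ Nat.lt_floor_add_one _)
    (Nat.floor_le (by positivity))
    (by
      rw [← Real.rpow_add two_pos, ← mul_add, h.sum_eq, mul_one, Real.rpow_add_one two_ne_zero]
      push_cast
      rw [mul_div_cancel_right₀ _ two_ne_zero, ← Real.rpow_natCast]
      push_cast
      rfl)
    (by linarith)
    (by linarith)
    (by linarith)
    (h.childCount_add_one ▸ Nat.floor_le (by positivity))
  refine ⟨f, l, h1, fun c => ?_, fun c => (h3 c).trans_eq ?_, fun c => (h4 c).trans_eq ?_, h5,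
    fun c c' hcc' hc => h6 c c' hcc' (hc.trans_eq ?_)⟩
  · rw [scaleQ_succ h.sum_eq, scaleZ_succ, scaleZ_succ]
    exact h2 c
  · rw [scaleWidth, scaleQ_succ h.sum_eq, scaleZ_succ]
    ring
  · rw [scaleWidth, scaleQ_succ h.sum_eq, scaleZ_succ]
    ring
  · rw [scaleWidth, scaleQ_succ (k := k + 1) h.sum_eq, scaleZ_succ (k := k + 1),
      scaleQ_succ (k := k) h.sum_eq, scaleZ_succ (k := k)]

lemma fst_eq_of_near (h : IsLarge w₁ w₂ δ k) {p p' : Basis3}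
    (hp : Basis3.IsNode (scaleQ k) (scaleZ w₁ δ k) (scaleZ w₂ δ k) p)
    (hp' : Basis3.IsNode (scaleQ k) (scaleZ w₁ δ k) (scaleZ w₂ δ k) p')
    (hx : |p.center.1 - p'.center.1| ≤ 3 * scaleWidth w₂ δ k)
    (hy : |p.center.2 - p'.center.2| ≤ 3 * scaleWidth w₁ δ k) : p.1 = p'.1 := by
  have hw₂ := h.snd_pos
  have hw := h.snd_le
  have hδ := h.pos
  have hk : (0 : ℝ) ≤ k := k.cast_nonneg
  have hC := h.le_rpow
  have hC' : (2 : ℝ) ^ 25 * 19 ≤ 2 ^ (w₂ * k) := by linarith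
  have hw₁ : w₁ = 1 - w₂ := by linarith [h.sum_eq]
  have hwk : w₂ * k ≤ w₁ * k := by gcongr
  have hdk : 0 ≤ δ * k := by positivity
  have hwk' : 0 ≤ w₂ * k := by positivity
  have e1 : 2 ^ (w₂ * k) * (scaleZ w₂ δ (k + 1) * scaleZ w₁ δ k) ≤ scaleQ (k + 1) := by
    unfold scaleZ scaleQ
    rw [← Real.rpow_add two_pos, ← Real.rpow_add two_pos]
    apply Real.rpow_le_rpow_of_exponent_le one_le_two
    push_cast
    subst hw₁
    nlinarith
  have e2 : 2 ^ (w₂ * k) * (scaleZ w₁ δ (k + 1) * scaleZ w₂ δ k) ≤ scaleQ (k + 1) := by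
    unfold scaleZ scaleQ
    rw [← Real.rpow_add two_pos, ← Real.rpow_add two_pos]
    apply Real.rpow_le_rpow_of_exponent_le one_le_two
    push_cast
    subst hw₁
    nlinarith
  have e3 : 2 ^ (w₂ * k) * (scaleZ w₁ δ (k + 1) * scaleQ k) ≤ scaleZ w₁ δ k * scaleQ (k + 1) := by
    unfold scaleZ scaleQ
    rw [← Real.rpow_add two_pos, ← Real.rpow_add two_pos, ← Real.rpow_add two_pos]
    apply Real.rpow_le_rpow_of_exponent_le one_le_two
    push_cast
    subst hw₁
    nlinarith
  have hQ' := scaleQ_pos (k := k + 1)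
  have p1 : 0 < scaleZ w₂ δ (k + 1) * scaleZ w₁ δ k := mul_pos scaleZ_pos scaleZ_pos
  have p2 : 0 < scaleZ w₁ δ (k + 1) * scaleZ w₂ δ k := mul_pos scaleZ_pos scaleZ_pos
  have p3 : 0 < scaleZ w₁ δ (k + 1) * scaleQ k := mul_pos scaleZ_pos scaleQ_pos
  have q1 := (mul_le_mul_of_nonneg_right hC' p1.le).trans e1
  have q2 := (mul_le_mul_of_nonneg_right hC' p2.le).trans e2
  have q3 := (mul_le_mul_of_nonneg_right hC' p3.le).trans e3
  refine hp.fst_eq_of_near hp' scaleQ_pos hQ' scaleZ_pos.le scaleZ_pos.le ?_ ?_ hx hy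
  · linarith
  · linarith

end IsLarge

end Scales

lemma abs_mul_sub_lt_of_scaleWidth {w v δ x E T : ℝ} {k : ℕ} {q a : ℤ} (hw : 0 ≤ w)
    (hwv : w + v = 1) (hv : 0 ≤ v) (hq : 0 < q) (hq' : (q : ℝ) < 2 * scaleQ k)
    (hx : |x - a / q| ≤ scaleWidth v δ k) (hT : 0 < T) (hT' : T ≤ 2 * scaleQ (k + 1))
    (hE : 8 * 2 ^ (-(δ * (k + 1))) < E) : |q * x - a| < E * T ^ (-w) := by
  have hQ := scaleQ_pos (k := k)
  have hQ' := scaleQ_pos (k := k + 1)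
  have hq0 : (0 : ℝ) < q := by exact_mod_cast hq
  have h2w : (1 / 2 : ℝ) ≤ 2 ^ (-w) := by
    rw [one_div, ← Real.rpow_neg_one]
    exact Real.rpow_le_rpow_of_exponent_le one_le_two (by linarith)
  have hZ : scaleZ v δ (k + 1) / scaleQ (k + 1) = 2 ^ (-(δ * (k + 1))) * scaleQ (k + 1) ^ (-w) := by
    unfold scaleZ scaleQ
    rw [← Real.rpow_mul two_pos.le, ← Real.rpow_sub two_pos, ← Real.rpow_add two_pos]
    congr 1
    push_cast
    linear_combination ((k : ℝ) + 1) ^ 2 * hwv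
  have hpow : (2 * scaleQ (k + 1)) ^ (-w) ≤ T ^ (-w) :=
    Real.rpow_le_rpow_of_nonpos hT hT' (by linarith)
  rw [Real.mul_rpow two_pos.le hQ'.le] at hpow
  have hQw : 0 < scaleQ (k + 1) ^ (-w) := Real.rpow_pos_of_pos hQ' _
  have hE0 : 0 < E := lt_trans (by positivity) hE
  calc |q * x - a| = q * |x - a / q| := by
        rw [← abs_of_pos hq0, ← abs_mul, abs_of_pos hq0]
        congr 1
        field_simp
    _ ≤ 2 * scaleQ k * scaleWidth v δ k := by gcongr
    _ = 4 * (scaleZ v δ (k + 1) / scaleQ (k + 1)) := by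
        unfold scaleWidth
        field_simp
        ring
    _ = 8 * 2 ^ (-(δ * (k + 1))) * (1 / 2 * scaleQ (k + 1) ^ (-w)) := by rw [hZ]; ring
    _ < E * (1 / 2 * scaleQ (k + 1) ^ (-w)) := by gcongr
    _ ≤ E * (2 ^ (-w) * scaleQ (k + 1) ^ (-w)) := by gcongr
    _ ≤ E * T ^ (-w) := by gcongr

lemma natCast_le_scaleQ (k : ℕ) : (k : ℝ) ≤ scaleQ k := by
  unfold scaleQ
  calc (k : ℝ) ≤ 2 ^ k := by exact_mod_cast Nat.lt_two_pow_self.le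
    _ = 2 ^ (k : ℝ) := (Real.rpow_natCast 2 k).symm
    _ ≤ 2 ^ ((k : ℝ) ^ 2) := by
        apply Real.rpow_le_rpow_of_exponent_le one_le_two
        exact_mod_cast Nat.le_self_pow two_ne_zero k

lemma mem_sing_of_nodes {w₁ w₂ δ : ℝ} {K : ℕ} (hw₂ : 0 < w₂) (hw : w₂ ≤ w₁) (hsum : w₁ + w₂ = 1)
    (hδ : 0 < δ) {x : EuclideanSpace ℝ (Fin 2)}
    (h : ∀ n, ∃ p : Basis3,
      Basis3.IsNode (scaleQ (K + n)) (scaleZ w₁ δ (K + n)) (scaleZ w₂ δ (K + n)) p ∧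
      |x 0 - p.center.1| ≤ scaleWidth w₂ δ (K + n) ∧
      |x 1 - p.center.2| ≤ scaleWidth w₁ δ (K + n)) : x ∈ Sing w₁ w₂ := by
  intro ε hε
  have hlim : Filter.Tendsto (fun n : ℕ => (2 : ℝ) ^ (-(δ * (n + 1)))) Filter.atTop (nhds 0) := by
    have h0 := (tendsto_pow_atTop_nhds_zero_of_lt_one (r := (2 : ℝ) ^ (-δ)) (by positivity)
      (Real.rpow_lt_one_of_one_lt_of_neg one_lt_two (by linarith))).comp
        (Filter.tendsto_add_atTop_nat 1)
    refine h0.congr fun n => ?_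
    rw [Function.comp_apply, ← Real.rpow_natCast, ← Real.rpow_mul two_pos.le]
    push_cast
    ring_nf
  have hlim8 := hlim.const_mul 8
  rw [mul_zero] at hlim8
  obtain ⟨n₀, hn₀⟩ := Filter.eventually_atTop.1
    ((hlim8.eventually_lt_const (Real.rpow_pos_of_pos hε w₁)).and
      (hlim8.eventually_lt_const (Real.rpow_pos_of_pos hε w₂)))
  have hQ1 : 1 ≤ scaleQ (K + n₀) := by
    unfold scaleQ
    exact Real.one_le_rpow one_le_two (by positivity)
  refine ⟨2 * scaleQ (K + n₀), by linarith, fun T hT => ?_⟩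
  have hex : ∃ j, T ≤ 2 * scaleQ (K + n₀ + j) := by
    obtain ⟨j, hj⟩ := exists_nat_ge T
    refine ⟨j, ?_⟩
    have := natCast_le_scaleQ (K + n₀ + j)
    push_cast at this
    have hK : (0 : ℝ) ≤ K := K.cast_nonneg
    have hn : (0 : ℝ) ≤ n₀ := n₀.cast_nonneg
    have hj0 : (0 : ℝ) ≤ j := j.cast_nonneg
    linarith
  classical
  obtain ⟨i, hi⟩ : ∃ i, Nat.find hex = i + 1 := by
    refine Nat.exists_eq_succ_of_ne_zero fun h0 => ?_
    have := Nat.find_spec hex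
    rw [h0, add_zero] at this
    linarith
  have hi1 := Nat.find_spec hex
  rw [hi] at hi1
  have hi2 := Nat.find_min hex (m := i) (by omega)
  rw [not_le] at hi2
  obtain ⟨p, hp, hx, hy⟩ := h (n₀ + i)
  rw [← add_assoc] at hp hx hy
  have hden : (0 : ℝ) < p.den := scaleQ_pos.trans_le hp.le_den
  have hden' : 0 < p.den := by exact_mod_cast hden
  obtain ⟨hE₁, hE₂⟩ := hn₀ (K + n₀ + i) (by omega)
  have hT0 : 0 < T := by linarith
  exact ⟨p.1.1, p.1.2.1, p.den,
    abs_mul_sub_lt_of_scaleWidth (by linarith) hsum hw₂.le hden' hp.den_lt hx hT0 hi1 hE₁,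
    abs_mul_sub_lt_of_scaleWidth hw₂.le (by linarith) (by linarith) hden' hp.den_lt hy hT0 hi1 hE₂,
    hden', hp.den_lt.trans hi2⟩

/-- The nodes of level `k` of the tree. -/
abbrev LevelNode (w₁ w₂ δ : ℝ) (k : ℕ) : Type :=
  {p : Basis3 // Basis3.IsNode (scaleQ k) (scaleZ w₁ δ k) (scaleZ w₂ δ k) p}

lemma le_dimH_sing_of_mass {w₁ w₂ δ σ r₀ : ℝ} {K : ℕ} (hK : ∀ n, IsLarge w₁ w₂ δ (K + n))
    (root : LevelNode w₁ w₂ δ K) (hσ : 0 < σ) (hr₀ : 0 < r₀)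
    (hmass : ∀ r, 0 < r → r < r₀ → ∃ k₁ k₂, k₁ ≤ k₂ ∧ r ≤ scaleWidth w₂ δ (K + k₁) ∧
      r ≤ scaleWidth w₁ δ (K + k₂) ∧
      ∏ k ∈ Finset.range k₂, ((if k < k₁ then 1 else lineCount w₁ δ (K + k) : ℕ) : ℝ) /
        ((childCount w₁ w₂ δ (K + k) : ℝ) + 1) ≤ r ^ σ) :
    ENNReal.ofReal σ ≤ dimH (Sing w₁ w₂) := by
  have hK0 := hK 0
  have hδ := hK0.pos
  have hw₂ := hK0.snd_pos
  have hw := hK0.snd_le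
  have hsum := hK0.sum_eq
  choose f l hl hf hf₁ hf₂ hfl hslab using
    fun n (p : LevelNode w₁ w₂ δ (K + n)) => (hK n).exists_children p.2
  let child : ∀ n, LevelNode w₁ w₂ δ (K + n) → Fin (childCount w₁ w₂ δ (K + n) + 1) →
      LevelNode w₁ w₂ δ (K + (n + 1)) := fun n p c => ⟨f n p c, hf n p c⟩
  rw [← planeEquiv.dimH_image]
  refine le_dimH_of_tree (𝒩 := fun n => LevelNode w₁ w₂ δ (K + n)) child root l
    (fun _ p => p.1.center) (ρ₁ := fun n => scaleWidth w₂ δ (K + n))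
    (ρ₂ := fun n => scaleWidth w₁ δ (K + n)) hl hf₁ hf₂
    (fun n => scaleWidth_succ_le (by linarith) hδ.le)
    (fun n => scaleWidth_succ_le (by linarith) hδ.le) (fun n p c c' h₁ h₂ => ?_)
    hslab hσ hr₀ hmass fun ω x h₁ h₂ => ?_
  · exact hslab n p c c' (hfl n p c c' ((hK (n + 1)).fst_eq_of_near (hf n p c) (hf n p c') h₁ h₂)) h₂
  · refine ⟨planeEquiv.symm x, mem_sing_of_nodes (K := K) hw₂ hw hsum hδ fun n => ?_,
      planeEquiv.apply_symm_apply x⟩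
    have hx : ((planeEquiv.symm x) 0, (planeEquiv.symm x) 1) = x := by
      rw [← planeEquiv_apply, planeEquiv.apply_symm_apply]
    refine ⟨(branch child root ω n).1, (branch child root ω n).2, ?_, ?_⟩
    · rw [show (planeEquiv.symm x) 0 = x.1 from congrArg Prod.fst hx]
      exact h₁ n
    · rw [show (planeEquiv.symm x) 1 = x.2 from congrArg Prod.snd hx]
      exact h₂ n

lemma exists_crossing {ρ : ℕ → ℝ} {r : ℝ} {m : ℕ} (hρ : ∀ n, ρ (n + 1) ≤ ρ n / 2) (hr : 0 < r)
    (hm : r ≤ ρ m) : ∃ k, m ≤ k ∧ r ≤ ρ k ∧ ρ (k + 1) < r := by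
  have hle : ∀ j, ρ (m + j) ≤ ρ m * (1 / 2) ^ j := by
    intro j
    induction j with
    | zero => simp
    | succ j ih =>
        rw [← add_assoc, pow_succ]
        linarith [hρ (m + j)]
  have hex : ∃ j, ρ (m + j) < r := by
    obtain ⟨j, hj⟩ := exists_pow_lt_of_lt_one (div_pos hr (hr.trans_le hm))
      (show (1 / 2 : ℝ) < 1 by norm_num)
    refine ⟨j, (hle j).trans_lt ?_⟩
    rwa [lt_div_iff₀' (hr.trans_le hm)] at hj
  classical
  obtain ⟨i, hi⟩ : ∃ i, Nat.find hex = i + 1 := by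
    refine Nat.exists_eq_succ_of_ne_zero fun h0 => ?_
    have := Nat.find_spec hex
    rw [h0, add_zero] at this
    linarith
  have h1 := Nat.find_spec hex
  rw [hi] at h1
  exact ⟨m + i, by omega, not_lt.1 (Nat.find_min hex (m := i) (by omega)), h1⟩

namespace IsLarge

variable {w₁ w₂ δ : ℝ} {k : ℕ}

lemma rpow_le_dirCount (h : IsLarge w₁ w₂ δ k) :
    (2 : ℝ) ^ (2 * k * w₂ - 21) ≤ dirCount w₂ k := by
  have h1 := h.le_dirCount
  have h2 := Nat.lt_floor_add_one ((2 : ℝ) ^ ((2 * k + 1) * w₂) / 2 ^ 20)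
  have hk : (0 : ℝ) ≤ k := k.cast_nonneg
  have h3 : (2 : ℝ) ^ (2 * k * w₂ - 21) ≤ 2 ^ ((2 * k + 1) * w₂) / 2 ^ 20 / 2 := by
    rw [div_div, ← pow_succ, ← Real.rpow_natCast, ← Real.rpow_sub two_pos]
    apply Real.rpow_le_rpow_of_exponent_le one_le_two
    push_cast
    linarith [h.snd_pos]
  unfold dirCount at *
  linarith

lemma rpow_le_lineCount (h : IsLarge w₁ w₂ δ k) :
    (2 : ℝ) ^ (2 * k * (w₁ - δ) - 5) ≤ lineCount w₁ δ k := by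
  have h1 := h.le_lineCount
  have h2 := Nat.lt_floor_add_one ((2 : ℝ) ^ ((2 * k + 1) * (w₁ - δ)) / 16)
  have hk : (0 : ℝ) ≤ k := k.cast_nonneg
  have h3 : (2 : ℝ) ^ (2 * k * (w₁ - δ) - 5) ≤ 2 ^ ((2 * k + 1) * (w₁ - δ)) / 16 / 2 := by
    rw [div_div, show (16 * 2 : ℝ) = 2 ^ (5 : ℝ) by norm_num, ← Real.rpow_sub two_pos]
    apply Real.rpow_le_rpow_of_exponent_le one_le_two
    linarith [h.two_mul_le, h.snd_le, h.snd_pos]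
  unfold lineCount at *
  linarith

lemma le_childCount (h : IsLarge w₁ w₂ δ k) :
    (2 : ℝ) ^ (2 * k * w₂ + 2 * k - 26) * lineCount w₁ δ k ≤ childCount w₁ w₂ δ k + 1 := by
  have h1 := h.le_lineCount
  have h2 := h.le_dirCount
  have hk : (0 : ℝ) ≤ k := k.cast_nonneg
  have h4 : (1 : ℝ) ≤ (2 ^ (2 * k) : ℕ) := by exact_mod_cast Nat.one_le_two_pow
  have h5 : (1 : ℝ) ≤ (lineCount w₁ δ k * dirCount w₂ k * (2 ^ (2 * k) : ℕ) : ℝ) / 16 := by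
    rw [le_div_iff₀ (by norm_num)]
    calc (1 : ℝ) * 16 ≤ 16 * 1 * 1 := by norm_num
      _ ≤ _ := by gcongr <;> linarith
  have h6 := Nat.lt_floor_add_one
    ((lineCount w₁ δ k * dirCount w₂ k * (2 ^ (2 * k) : ℕ) : ℝ) / 16)
  rw [← h.childCount_add_one] at h6
  have h7 : (1 : ℝ) ≤ childCount w₁ w₂ δ k + 1 := by
    have : (0 : ℝ) ≤ childCount w₁ w₂ δ k := Nat.cast_nonneg _
    linarith
  have h8 : (2 : ℝ) ^ (2 * k * w₂ + 2 * k - 26) =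
      2 ^ (2 * k * w₂ - 21) * (2 ^ (2 * k) : ℕ) / 32 := by
    rw [show (32 : ℝ) = 2 ^ (5 : ℝ) by norm_num]
    push_cast
    rw [← Real.rpow_natCast, ← Real.rpow_add two_pos, ← Real.rpow_sub two_pos]
    congr 1
    push_cast
    ring
  have h9 : (2 : ℝ) ^ (2 * k * w₂ - 21) * ((2 ^ (2 * k) : ℕ) * lineCount w₁ δ k) ≤
      dirCount w₂ k * ((2 ^ (2 * k) : ℕ) * lineCount w₁ δ k) :=
    mul_le_mul_of_nonneg_right h.rpow_le_dirCount (by positivity)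
  rw [h8]
  linarith

lemma lineCount_div_le (h : IsLarge w₁ w₂ δ k) (hk : 32 ≤ δ * k) :
    (lineCount w₁ δ k : ℝ) / (childCount w₁ w₂ δ k + 1) ≤ 2 ^ (-((2 + 2 * w₂ - δ) * k)) := by
  rw [div_le_iff₀ (by positivity)]
  calc (lineCount w₁ δ k : ℝ) = 1 * lineCount w₁ δ k := (one_mul _).symm
    _ ≤ 2 ^ (-((2 + 2 * w₂ - δ) * k)) * 2 ^ (2 * k * w₂ + 2 * k - 26) * lineCount w₁ δ k := by
        gcongr
        rw [← Real.rpow_add two_pos]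
        apply Real.one_le_rpow one_le_two
        linarith
    _ ≤ 2 ^ (-((2 + 2 * w₂ - δ) * k)) * (childCount w₁ w₂ δ k + 1) := by
        rw [mul_assoc]
        gcongr
        exact h.le_childCount

lemma one_div_childCount_le (h : IsLarge w₁ w₂ δ k) (hk : 32 ≤ δ * k) :
    1 / ((childCount w₁ w₂ δ k : ℝ) + 1) ≤
      2 ^ (-((2 * w₁ - 2 * δ) * k) - (2 + 2 * w₂ - δ) * k) := by
  rw [div_le_iff₀ (by positivity)]
  calc (1 : ℝ) ≤ 2 ^ (-((2 * w₁ - 2 * δ) * k) - (2 + 2 * w₂ - δ) * k) *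
        (2 ^ (2 * k * w₂ + 2 * k - 26) * 2 ^ (2 * k * (w₁ - δ) - 5)) := by
        rw [← Real.rpow_add two_pos, ← Real.rpow_add two_pos]
        apply Real.one_le_rpow one_le_two
        linarith
    _ ≤ _ := by
        gcongr
        refine le_trans ?_ h.le_childCount
        gcongr
        exact h.rpow_le_lineCount

end IsLarge

lemma prod_range_le {w₁ w₂ δ : ℝ} {K : ℕ} (hK : ∀ n, IsLarge w₁ w₂ δ (K + n))
    (hK' : 32 ≤ δ * K) (k₁ : ℕ) (n : ℕ) :
    ∏ k ∈ Finset.range n, ((if k < k₁ then 1 else lineCount w₁ δ (K + k) : ℕ) : ℝ) /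
        ((childCount w₁ w₂ δ (K + k) : ℝ) + 1) ≤
      2 ^ (-((w₁ - δ) * (((K + min n k₁ : ℕ) : ℝ) * ((K + min n k₁ : ℕ) - 1) - K * (K - 1)) +
        (1 + w₂ - δ / 2) * (((K + n : ℕ) : ℝ) * ((K + n : ℕ) - 1) - K * (K - 1)))) := by
  induction n with
  | zero => simp
  | succ n ih =>
      have hn : 32 ≤ δ * (K + n : ℕ) := by
        have hδ := (hK 0).pos
        push_cast
        have : 0 ≤ δ * n := by positivity
        linarith
      rw [Finset.prod_range_succ]
      have hnn : 0 ≤ ((if n < k₁ then 1 else lineCount w₁ δ (K + n) : ℕ) : ℝ) /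
        ((childCount w₁ w₂ δ (K + n) : ℝ) + 1) := by positivity
      refine (mul_le_mul_of_nonneg_right ih hnn).trans ?_
      split_ifs with h
      · rw [Nat.cast_one, min_eq_left (by omega : n ≤ k₁), min_eq_left (by omega : n + 1 ≤ k₁)]
        refine (mul_le_mul_of_nonneg_left ((hK n).one_div_childCount_le hn)
          (by positivity)).trans_eq ?_
        rw [← Real.rpow_add two_pos]
        congr 1
        push_cast
        ring
      · rw [min_eq_right (by omega : k₁ ≤ n), min_eq_right (by omega : k₁ ≤ n + 1)]
        refine (mul_le_mul_of_nonneg_left ((hK n).lineCount_div_le hn)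
          (by positivity)).trans_eq ?_
        rw [← Real.rpow_add two_pos]
        congr 1
        push_cast
        ring

lemma neg_logb_le_of_scaleWidth_lt {w v δ η r : ℝ} {k : ℕ} (hwv : w + v = 1) (hv : v ≤ 1)
    (hδ : δ ≤ 1) (hr : scaleWidth w δ (k + 1) < r) (hk : 14 * (k : ℝ) + 14 ≤ η * k ^ 2) :
    -Real.logb 2 r ≤ (1 + v + η) * k ^ 2 := by
  have h1 := Real.logb_lt_logb one_lt_two scaleWidth_pos hr
  rw [scaleWidth_eq, Real.logb_rpow two_pos (by norm_num)] at h1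
  have hw : w = 1 - v := by linarith
  subst hw
  push_cast at h1
  have hk0 : (0 : ℝ) ≤ k := k.cast_nonneg
  have h2 : δ * k ≤ 1 * k := by gcongr
  have h3 : v * k ≤ 1 * k := by gcongr
  linarith

lemma exponent_le {w₁ w₂ δ η σ ℓ κ₁ κ₂ K : ℝ} (hw₁ : w₁ ≤ 1) (hw₂ : 0 < w₂) (hw₂' : w₂ ≤ 1)
    (hηw : η ≤ w₁) (hδ : 0 < δ)
    (hδη : 4 * δ ≤ η) (hσ : σ ≤ (w₁ - η) / (1 + w₁ + η) + (1 + w₂ - η) / (1 + w₂ + η))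
    (hK : 0 ≤ K) (hκ₁ : 0 ≤ κ₁) (hκ₂ : 0 ≤ κ₂)
    (h₁ : 14 * κ₁ + 14 + 4 * K ^ 2 ≤ η * κ₁ ^ 2) (h₂ : 14 * κ₂ + 14 + 4 * K ^ 2 ≤ η * κ₂ ^ 2)
    (hℓ : 0 ≤ ℓ) (hℓ₁ : ℓ ≤ (1 + w₁ + η) * κ₁ ^ 2) (hℓ₂ : ℓ ≤ (1 + w₂ + η) * κ₂ ^ 2) :
    ℓ * σ ≤ (w₁ - δ) * (κ₁ * (κ₁ - 1) - K * (K - 1)) +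
      (1 + w₂ - δ / 2) * (κ₂ * (κ₂ - 1) - K * (K - 1)) := by
  have a1 : ℓ / (1 + w₁ + η) ≤ κ₁ ^ 2 := by
    rwa [div_le_iff₀' (by linarith)]
  have a2 : ℓ / (1 + w₂ + η) ≤ κ₂ ^ 2 := by
    rwa [div_le_iff₀' (by linarith)]
  have b1 : (w₁ - η) * κ₁ ^ 2 ≤ (w₁ - δ) * (κ₁ * (κ₁ - 1) - K * (K - 1)) := by
    have c1 : (w₁ - δ) * (κ₁ + K ^ 2) ≤ 1 * (κ₁ + K ^ 2) := by
      gcongr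
      linarith
    have c2 : 4 * δ * κ₁ ^ 2 ≤ η * κ₁ ^ 2 := by gcongr
    have c3 : 0 ≤ (w₁ - δ) * K := mul_nonneg (by linarith) hK
    nlinarith
  have b2 : (1 + w₂ - η) * κ₂ ^ 2 ≤ (1 + w₂ - δ / 2) * (κ₂ * (κ₂ - 1) - K * (K - 1)) := by
    have c1 : (1 + w₂ - δ / 2) * (κ₂ + K ^ 2) ≤ 2 * (κ₂ + K ^ 2) := by
      gcongr
      linarith
    have c2 : 4 * δ * κ₂ ^ 2 ≤ η * κ₂ ^ 2 := by gcongr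
    have c3 : 0 ≤ (1 + w₂ - δ / 2) * K := mul_nonneg (by linarith) hK
    nlinarith
  calc ℓ * σ ≤ ℓ * ((w₁ - η) / (1 + w₁ + η) + (1 + w₂ - η) / (1 + w₂ + η)) := by gcongr
    _ = (w₁ - η) * (ℓ / (1 + w₁ + η)) + (1 + w₂ - η) * (ℓ / (1 + w₂ + η)) := by ring
    _ ≤ (w₁ - η) * κ₁ ^ 2 + (1 + w₂ - η) * κ₂ ^ 2 := by
        gcongr
        linarith
    _ ≤ _ := by linarith

lemma exists_mass_bound {w₁ w₂ δ η σ : ℝ} {K : ℕ} (hK : ∀ n, IsLarge w₁ w₂ δ (K + n))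
    (hK' : 32 ≤ δ * K) (hη : 0 < η) (hηw : η ≤ w₁) (hδη : 4 * δ ≤ η)
    (hσ : σ ≤ (w₁ - η) / (1 + w₁ + η) + (1 + w₂ - η) / (1 + w₂ + η)) :
    ∃ r₀ > 0, ∀ r, 0 < r → r < r₀ → ∃ k₁ k₂, k₁ ≤ k₂ ∧ r ≤ scaleWidth w₂ δ (K + k₁) ∧
      r ≤ scaleWidth w₁ δ (K + k₂) ∧
      ∏ k ∈ Finset.range k₂, ((if k < k₁ then 1 else lineCount w₁ δ (K + k) : ℕ) : ℝ) /
        ((childCount w₁ w₂ δ (K + k) : ℝ) + 1) ≤ r ^ σ := by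
  have hδ := (hK 0).pos
  have hw₂ := (hK 0).snd_pos
  have hw := (hK 0).snd_le
  have hsum := (hK 0).sum_eq
  obtain ⟨m, hm⟩ := exists_nat_ge ((28 + 4 * (K : ℝ) ^ 2) / η)
  rw [div_le_iff₀ hη] at hm
  have hquad : ∀ k, m + 1 ≤ k →
      14 * ((K + k : ℕ) : ℝ) + 14 + 4 * (K : ℝ) ^ 2 ≤ η * ((K + k : ℕ) : ℝ) ^ 2 := by
    intro k hk
    have h1 : (m : ℝ) + 1 ≤ (K + k : ℕ) := by exact_mod_cast (by omega : m + 1 ≤ K + k)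
    have h2 : (0 : ℝ) ≤ m := m.cast_nonneg
    generalize ((K + k : ℕ) : ℝ) = x at *
    have hx : 0 < x := by linarith
    have h3 : (28 + 4 * (K : ℝ) ^ 2) * x ≤ m * η * x := by gcongr
    have h4 : (m : ℝ) * (η * x) ≤ x * (η * x) := by gcongr; linarith
    have h5 : 4 * (K : ℝ) ^ 2 * 1 ≤ 4 * (K : ℝ) ^ 2 * x := by gcongr; linarith
    linarith
  refine ⟨min 1 (scaleWidth w₂ δ (K + (m + 1))), lt_min one_pos scaleWidth_pos,
    fun r hr hr₀ => ?_⟩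
  obtain ⟨k₁, hk₁, h1, h1'⟩ := exists_crossing (ρ := fun n => scaleWidth w₂ δ (K + n))
    (fun n => scaleWidth_succ_le (by linarith) hδ.le) hr (hr₀.le.trans (min_le_right _ _))
  have hle : scaleWidth w₂ δ (K + k₁) ≤ scaleWidth w₁ δ (K + k₁) := by
    rw [scaleWidth_eq, scaleWidth_eq]
    apply Real.rpow_le_rpow_of_exponent_le one_le_two
    gcongr
  obtain ⟨k₂, hk₂, h2, h2'⟩ := exists_crossing (ρ := fun n => scaleWidth w₁ δ (K + n))
    (fun n => scaleWidth_succ_le (by linarith) hδ.le) hr (h1.trans hle)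
  refine ⟨k₁, k₂, hk₂, h1, h2, (prod_range_le hK hK' k₁ k₂).trans ?_⟩
  rw [min_eq_right hk₂]
  have hr2 : r = 2 ^ Real.logb 2 r := (Real.rpow_logb two_pos (by norm_num) hr).symm
  have hℓ : 0 ≤ -Real.logb 2 r := by
    rw [neg_nonneg]
    exact Real.logb_nonpos one_lt_two hr.le (hr₀.le.trans (min_le_left _ _))
  have q1 := hquad k₁ hk₁
  have q2 := hquad k₂ (hk₁.trans hk₂)
  have hKK : 0 ≤ 4 * (K : ℝ) ^ 2 := by positivity
  have key := exponent_le (by linarith) hw₂ (by linarith) hηw hδ hδη hσ K.cast_nonneg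
    (Nat.cast_nonneg _) (Nat.cast_nonneg _) q1 q2 hℓ
    (neg_logb_le_of_scaleWidth_lt (by linarith) (by linarith) (by linarith) h1' (by linarith))
    (neg_logb_le_of_scaleWidth_lt hsum (by linarith) (by linarith) h2' (by linarith))
  calc _ ≤ (2 : ℝ) ^ (Real.logb 2 r * σ) :=
        Real.rpow_le_rpow_of_exponent_le one_le_two (by linarith)
    _ = r ^ σ := by
        rw [Real.rpow_mul two_pos.le, ← hr2]

lemma eventually_isLarge {w₁ w₂ δ : ℝ} (hw₂ : 0 < w₂) (hw : w₂ ≤ w₁) (hsum : w₁ + w₂ = 1)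
    (hδ : 0 < δ) (hδ' : 2 * δ ≤ w₂) : ∃ k₀, ∀ k, k₀ ≤ k → IsLarge w₁ w₂ δ k := by
  have h1 : (1 : ℝ) < 2 ^ w₂ := Real.one_lt_rpow one_lt_two hw₂
  have h2 := ((tendsto_pow_const_div_const_pow_of_one_lt 1 h1).const_mul (2 ^ 25)).add
    ((tendsto_pow_const_div_const_pow_of_one_lt 0 h1).const_mul (2 ^ 25 * 19))
  rw [mul_zero, mul_zero, add_zero] at h2
  obtain ⟨k₀, hk₀⟩ := Filter.eventually_atTop.1 (h2.eventually_le_const one_pos)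
  refine ⟨k₀, fun k hk => ⟨hw₂, hw, hsum, hδ, hδ', ?_⟩⟩
  have h3 := hk₀ k hk
  rw [pow_one, pow_zero, mul_div_assoc', mul_div_assoc', ← add_div, div_le_one (by positivity),
    ← Real.rpow_mul_natCast two_pos.le] at h3
  linarith

lemma exists_levelNode {w₁ w₂ δ : ℝ} {K : ℕ} (h : IsLarge w₁ w₂ δ K) (hK : 32 ≤ δ * K) :
    ∃ p : Basis3, Basis3.IsNode (scaleQ K) (scaleZ w₁ δ K) (scaleZ w₂ δ K) p := by
  have hQ : scaleQ K = (2 ^ K ^ 2 : ℕ) := by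
    unfold scaleQ
    push_cast
    exact_mod_cast Real.rpow_natCast 2 (K ^ 2)
  rw [hQ]
  refine Basis3.exists_isNode _ (by positivity) ?_ ?_
  · unfold scaleZ
    rw [show (16 : ℝ) = 2 ^ (4 : ℝ) by norm_num]
    apply Real.rpow_le_rpow_of_exponent_le one_le_two
    have hK1 : (1 : ℝ) ≤ K := by
      rcases Nat.eq_zero_or_pos K with h0 | h0
      · rw [h0, Nat.cast_zero] at hK
        linarith
      · exact_mod_cast h0
    have h1 : 2 * δ * (K * 1) ≤ w₂ * (K * K) := by
      gcongr
      exacts [h.snd_pos.le, h.two_mul_le]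
    linarith
  · unfold scaleZ
    apply Real.rpow_le_rpow_of_exponent_le one_le_two
    have := h.snd_le
    gcongr

lemma le_dimH_sing {w₁ w₂ σ : ℝ} (hw₂ : 0 < w₂) (hw : w₂ ≤ w₁) (hsum : w₁ + w₂ = 1)
    (hσ : 0 < σ) (hσ' : σ < 2 - 1 / (1 + w₁)) : ENNReal.ofReal σ ≤ dimH (Sing w₁ w₂) := by
  have hw₁ : 0 < w₁ := hw₂.trans_le hw
  have hcont : ContinuousAt
      (fun η : ℝ => (w₁ - η) / (1 + w₁ + η) + (1 + w₂ - η) / (1 + w₂ + η)) 0 := by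
    refine ContinuousAt.add (ContinuousAt.div ?_ ?_ ?_) (ContinuousAt.div ?_ ?_ ?_)
    any_goals fun_prop
    all_goals linarith
  have hval : σ < (w₁ - 0) / (1 + w₁ + 0) + (1 + w₂ - 0) / (1 + w₂ + 0) := by
    rw [sub_zero, add_zero, sub_zero, add_zero, div_self (by linarith)]
    convert hσ' using 1
    field_simp
    ring
  have hev := hcont.tendsto.eventually_const_lt hval
  obtain ⟨ε, hε, hball⟩ := Metric.eventually_nhds_iff.1 hev
  set η := min (ε / 2) w₁ with hη
  have hη0 : 0 < η := lt_min (by linarith) hw₁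
  have hση : σ < (w₁ - η) / (1 + w₁ + η) + (1 + w₂ - η) / (1 + w₂ + η) := by
    apply hball
    rw [Real.dist_eq, sub_zero, abs_of_pos hη0]
    linarith [min_le_left (ε / 2) w₁]
  set δ := min (η / 4) (w₂ / 2) with hδ
  have hδ0 : 0 < δ := lt_min (by linarith) (by linarith)
  have hδη : 4 * δ ≤ η := by linarith [min_le_left (η / 4) (w₂ / 2)]
  have hδw : 2 * δ ≤ w₂ := by linarith [min_le_right (η / 4) (w₂ / 2)]
  obtain ⟨k₀, hk₀⟩ := eventually_isLarge hw₂ hw hsum hδ0 hδw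
  obtain ⟨k₁, hk₁⟩ := exists_nat_ge (32 / δ)
  rw [div_le_iff₀' hδ0] at hk₁
  have hK : 32 ≤ δ * (k₀ + k₁ : ℕ) := by
    push_cast
    have : 0 ≤ δ * k₀ := by positivity
    linarith
  have hlarge : ∀ n, IsLarge w₁ w₂ δ (k₀ + k₁ + n) := fun n => hk₀ _ (by omega)
  obtain ⟨p, hp⟩ := exists_levelNode (hlarge 0) hK
  obtain ⟨r₀, hr₀, hmass⟩ := exists_mass_bound hlarge hK hη0 (min_le_right _ _) hδη hση.le
  exact le_dimH_sing_of_mass hlarge ⟨p, hp⟩ hσ hr₀ hmass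

/-- The Hausdorff dimension of the set of `w`-weighted singular vectors in `ℝ²`
is `2 - 1/(1+w₁)`. -/
theorem dimH_sing (w₁ w₂ : ℝ) (hw₂ : 0 < w₂) (hw : w₂ ≤ w₁) (hsum : w₁ + w₂ = 1) :
    dimH (Sing w₁ w₂) = ENNReal.ofReal (2 - 1 / (1 + w₁)) := by
  refine le_antisymm (dimH_sing_le hw₂ hw hsum) (le_of_forall_lt_imp_le_of_dense fun a ha => ?_)
  have ha' : a ≠ ⊤ := ha.ne_top
  rcases eq_or_ne a 0 with rfl | ha0
  · exact zero_le
  rw [← ENNReal.ofReal_toReal ha']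
  exact le_dimH_sing hw₂ hw hsum (ENNReal.toReal_pos ha0 ha')
    ((ENNReal.lt_ofReal_iff_toReal_lt ha').1 ha)
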